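/- There exist absolute constants κ > 0 and C > 0 such that the following holds. Let q be a prime, N a positive integer, I = {1,…,N} ⊆ ℤ/qℤ, and let Λ₁, Λ₂ ⊆ ℤ/qℤ be such that A = I ∔ Λ₁ and B = I ∔ Λ₂ (i.e. A = {i+λ : i ∈ I, λ ∈ Λ₁} with all N·|Λ₁| sums distinct, and similarly for B), with 0 ∉ B. Then | |A ∩ B⁻¹| − |A|·|B|/q | ≤ C·√(|A|·|B|)·N^{−κ}, where B⁻¹ = {b⁻¹ : b ∈ B} is the set of multiplicative inverses of elements of B in ℤ/qℤ. -/

import Mathlib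

section
open Finset
open scoped Pointwise
set_option maxHeartbeats 2000000
set_option linter.unusedSectionVars false
namespace IUC

/-- fibre counting. -/
lemma cnt {α β : Type*} [DecidableEq β] (P : Finset α) (X : Finset β) (f : α → β) (r : ℝ)
    (h : ∀ x ∈ X, r ≤ ((P.filter (fun p => f p = x)).card : ℝ)) :
    (X.card : ℝ) * r ≤ P.card := by
  classical
  have h1 : ∑ x ∈ X, ((P.filter (fun p => f p = x)).card : ℝ) ≤ P.card := by
    have : ∑ x ∈ X, (P.filter (fun p => f p = x)).card ≤ P.card := by
      rw [← Finset.card_biUnion]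
      · apply Finset.card_le_card
        intro p hp
        simp only [Finset.mem_biUnion, Finset.mem_filter] at hp
        tauto
      · intro x _ y _ hxy
        rw [Function.onFun, Finset.disjoint_left]
        intro p hp hp'
        simp only [Finset.mem_filter] at hp hp'
        exact hxy (hp.2.symm.trans hp'.2)
    exact_mod_cast this
  calc (X.card : ℝ) * r = ∑ x ∈ X, r := by simp
    _ ≤ _ := Finset.sum_le_sum h
    _ ≤ _ := h1

variable {G : Type*} [Group G] [DecidableEq G]

/-- Part C : from small difference set to approximate group. -/
lemma partC (A : Finset G) (hA : A.Nonempty) (K : ℝ) (hK : 1 ≤ K)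
    (h : ((A * A⁻¹).card : ℝ) ≤ K * A.card) :
    ∃ H : Finset G, 1 ∈ H ∧ (∀ x ∈ H, x⁻¹ ∈ H) ∧
      (∀ n : ℕ, ((H ^ n).card : ℝ) ≤ (2 * K ^ 2) ^ n * (K * A.card)) ∧
      (A.card : ℝ) ≤ 2 * K * H.card ∧
      ∃ c : G, (A.card : ℝ) ≤ 2 * K * (A.filter (fun a => c⁻¹ * a ∈ H)).card := by
  classical
  have hApos : (0 : ℝ) < A.card := by exact_mod_cast hA.card_pos
  set r : G → ℝ := fun x => (((A ×ˢ A).filter (fun p => p.1⁻¹ * p.2 = x)).card : ℝ) with hr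
  set D : Finset G := A⁻¹ * A with hD
  set H : Finset G := D.filter (fun x => (A.card : ℝ) / (2 * K) ≤ r x) with hH
  have hrle : ∀ x, r x ≤ A.card := by
    intro x
    simp only [hr]
    have : ((A ×ˢ A).filter (fun p => p.1⁻¹ * p.2 = x)).card ≤ A.card := by
      apply Finset.card_le_card_of_injOn (fun p => p.1)
      · intro p hp
        simp at hp
        exact hp.1.1
      · rintro ⟨a, b⟩ hp ⟨a', b'⟩ hp' heq
        simp at hp hp' heq
        subst heq
        have := hp.2.trans hp'.2.symm
        simpa using this
    exact_mod_cast this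
  have hr0 : ∀ x, 0 ≤ r x := fun x => by simp only [hr]; positivity
  have hmapD : ∀ p ∈ A ×ˢ A, p.1⁻¹ * p.2 ∈ D := by
    intro p hp
    simp at hp
    exact Finset.mul_mem_mul (Finset.inv_mem_inv hp.1) hp.2
  have hsum : ∑ x ∈ D, r x = (A.card : ℝ) ^ 2 := by
    have := Finset.card_eq_sum_card_fiberwise (f := fun p : G × G => p.1⁻¹ * p.2) hmapD
    simp only [hr]
    rw [← Nat.cast_sum, ← this, Finset.card_product]; push_cast; ring
  -- energy
  have hen : (A.card : ℝ) ^ 3 ≤ K * ∑ x ∈ D, r x ^ 2 := by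
    set r2 : G → ℝ := fun x => (((A ×ˢ A).filter (fun p => p.1 * p.2⁻¹ = x)).card : ℝ) with hr2
    have hmap2 : ∀ p ∈ A ×ˢ A, p.1 * p.2⁻¹ ∈ A * A⁻¹ := by
      intro p hp
      simp at hp
      exact Finset.mul_mem_mul hp.1 (Finset.inv_mem_inv hp.2)
    have hsum2 : ∑ x ∈ A * A⁻¹, r2 x = (A.card : ℝ) ^ 2 := by
      have := Finset.card_eq_sum_card_fiberwise (f := fun p : G × G => p.1 * p.2⁻¹) hmap2
      simp only [hr2]
      rw [← Nat.cast_sum, ← this, Finset.card_product]; push_cast; ring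
    have hCS : (∑ x ∈ A * A⁻¹, r2 x) ^ 2 ≤ (A * A⁻¹).card * ∑ x ∈ A * A⁻¹, r2 x ^ 2 :=
      sq_sum_le_card_mul_sum_sq
    set Q := (A ×ˢ A) ×ˢ (A ×ˢ A)
    have e1 : ∑ x ∈ D, r x ^ 2 = ((Q.filter (fun p => p.1.1⁻¹ * p.1.2 = p.2.1⁻¹ * p.2.2)).card : ℝ) := by
      have : (Q.filter (fun p => p.1.1⁻¹ * p.1.2 = p.2.1⁻¹ * p.2.2)).card
          = ∑ x ∈ D, ((Q.filter (fun p => p.1.1⁻¹ * p.1.2 = p.2.1⁻¹ * p.2.2)).filter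
              (fun p => p.1.1⁻¹ * p.1.2 = x)).card := by
        apply Finset.card_eq_sum_card_fiberwise
        intro p hp
        simp only [Finset.coe_filter, Set.mem_ofPred_eq, Q, Finset.mem_product (p := p)] at hp
        exact hmapD _ hp.1.1
      rw [this]; push_cast
      apply Finset.sum_congr rfl
      intro x hx
      rw [sq]; simp only [hr]; rw [← Nat.cast_mul, ← Finset.card_product]
      congr 2
      ext p
      simp only [Finset.mem_product, Finset.mem_filter, Q]
      constructor
      · rintro ⟨⟨⟨a, b⟩, c⟩, ⟨d, e⟩, f⟩
        exact ⟨⟨⟨⟨a, b⟩, d, e⟩, c.trans f.symm⟩, c⟩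
      · rintro ⟨⟨⟨⟨a, b⟩, d, e⟩, c⟩, f⟩
        exact ⟨⟨⟨a, b⟩, f⟩, ⟨d, e⟩, c.symm.trans f⟩
    have e2 : ∑ x ∈ A * A⁻¹, r2 x ^ 2 = ((Q.filter (fun p => p.1.1 * p.1.2⁻¹ = p.2.1 * p.2.2⁻¹)).card : ℝ) := by
      have : (Q.filter (fun p => p.1.1 * p.1.2⁻¹ = p.2.1 * p.2.2⁻¹)).card
          = ∑ x ∈ A * A⁻¹, ((Q.filter (fun p => p.1.1 * p.1.2⁻¹ = p.2.1 * p.2.2⁻¹)).filter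
              (fun p => p.1.1 * p.1.2⁻¹ = x)).card := by
        apply Finset.card_eq_sum_card_fiberwise
        intro p hp
        simp only [Finset.coe_filter, Set.mem_ofPred_eq, Q, Finset.mem_product (p := p)] at hp
        exact hmap2 _ hp.1.1
      rw [this]; push_cast
      apply Finset.sum_congr rfl
      intro x hx
      rw [sq]; simp only [hr2]; rw [← Nat.cast_mul, ← Finset.card_product]
      congr 2
      ext p
      simp only [Finset.mem_product, Finset.mem_filter, Q]
      constructor
      · rintro ⟨⟨⟨a, b⟩, c⟩, ⟨d, e⟩, f⟩
        exact ⟨⟨⟨⟨a, b⟩, d, e⟩, c.trans f.symm⟩, c⟩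
      · rintro ⟨⟨⟨⟨a, b⟩, d, e⟩, c⟩, f⟩
        exact ⟨⟨⟨a, b⟩, f⟩, ⟨d, e⟩, c.symm.trans f⟩
    have e3 : (Q.filter (fun p => p.1.1 * p.1.2⁻¹ = p.2.1 * p.2.2⁻¹)).card
        = (Q.filter (fun p => p.1.1⁻¹ * p.1.2 = p.2.1⁻¹ * p.2.2)).card := by
      -- a b⁻¹ = c d⁻¹ iff c⁻¹ a = d⁻¹ b
      apply Finset.card_bij (fun p _ => ((p.2.1, p.1.1), (p.2.2, p.1.2)))
      · rintro ⟨⟨a, b⟩, ⟨c, d⟩⟩ hp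
        simp only [Finset.mem_product, Finset.mem_filter, Q] at hp ⊢
        refine ⟨by tauto, ?_⟩
        have h2 : a = c * d⁻¹ * b := by rw [← hp.2]; group
        rw [h2]; group
      · rintro ⟨⟨a, b⟩, ⟨c, d⟩⟩ hp ⟨⟨a', b'⟩, ⟨c', d'⟩⟩ hp'
        simp only [Prod.mk.injEq]
        tauto
      · rintro ⟨⟨c, a⟩, ⟨d, b⟩⟩ hp
        simp only [Finset.mem_product, Finset.mem_filter, Q] at hp
        refine ⟨((a, b), (c, d)), ?_, rfl⟩
        simp only [Finset.mem_product, Finset.mem_filter, Q]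
        refine ⟨by tauto, ?_⟩
        have h2 : a = c * (d⁻¹ * b) := by rw [← hp.2]; group
        rw [h2]; group
    rw [e1, ← e3, ← e2]
    rw [hsum2] at hCS
    have hnn : 0 ≤ ∑ x ∈ A * A⁻¹, r2 x ^ 2 := Finset.sum_nonneg (fun x _ => sq_nonneg _)
    clear_value r2 Q r
    have h5 : ((A.card : ℝ) ^ 2) ^ 2 ≤ K * A.card * ∑ x ∈ A * A⁻¹, r2 x ^ 2 :=
      hCS.trans (mul_le_mul_of_nonneg_right h hnn)
    have : (A.card : ℝ) * A.card ^ 3 ≤ A.card * (K * ∑ x ∈ A * A⁻¹, r2 x ^ 2) := by nlinarith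
    exact le_of_mul_le_mul_left this hApos
  have hKpos : 0 < K := by linarith
  -- sum over H
  have hHsq : (A.card : ℝ) ^ 3 ≤ 2 * K * ∑ x ∈ H, r x ^ 2 := by
    have hsplit := Finset.sum_filter_add_sum_filter_not D (fun x => (A.card : ℝ) / (2 * K) ≤ r x) (fun x => r x ^ 2)
    have hsm : ∑ x ∈ D.filter (fun x => ¬ (A.card : ℝ) / (2 * K) ≤ r x), r x ^ 2
        ≤ (A.card : ℝ) / (2 * K) * (A.card : ℝ) ^ 2 := by
      rw [← hsum, Finset.mul_sum]
      calc _ ≤ ∑ x ∈ D.filter (fun x => ¬ (A.card : ℝ) / (2 * K) ≤ r x), (A.card : ℝ) / (2 * K) * r x := by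
            apply Finset.sum_le_sum
            intro x hx
            simp at hx
            rw [sq]
            exact mul_le_mul_of_nonneg_right hx.2.le (hr0 x)
        _ ≤ _ := by
            apply Finset.sum_le_sum_of_subset_of_nonneg (Finset.filter_subset _ _)
            intros; have := hr0 ‹_›; positivity
    have e : K * ((A.card : ℝ) / (2 * K) * (A.card : ℝ) ^ 2) = (A.card : ℝ) ^ 3 / 2 := by field_simp
    rw [← hsplit] at hen
    have := mul_le_mul_of_nonneg_left hsm hKpos.le
    rw [e] at this
    rw [mul_add] at hen
    simp only [hH]
    linarith
  have hH1 : (A.card : ℝ) ^ 2 ≤ 2 * K * ∑ x ∈ H, r x := by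
    have : ∑ x ∈ H, r x ^ 2 ≤ A.card * ∑ x ∈ H, r x := by
      rw [Finset.mul_sum]
      apply Finset.sum_le_sum
      intro x _
      rw [sq]; exact mul_le_mul_of_nonneg_right (hrle x) (hr0 x)
    have h6 : (A.card : ℝ) * A.card ^ 2 ≤ A.card * (2 * K * ∑ x ∈ H, r x) := by
      have := mul_le_mul_of_nonneg_left this (by positivity : 0 ≤ 2 * K)
      nlinarith
    exact le_of_mul_le_mul_left h6 hApos
  refine ⟨H, ?_, ?_, ?_, ?_, ?_⟩
  · simp only [hH, Finset.mem_filter]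
    obtain ⟨a, ha⟩ := hA
    refine ⟨by have h7 := hmapD (a, a) (by simp [ha]); rwa [inv_mul_cancel] at h7, ?_⟩
    have : A.card ≤ ((A ×ˢ A).filter (fun p => p.1⁻¹ * p.2 = 1)).card := by
      apply Finset.card_le_card_of_injOn (fun a => (a, a))
      · intro a ha; simp at ha ⊢; exact ha
      · intro a _ b _ hab; simpa using hab
    have h7 : (A.card : ℝ) ≤ r 1 := by simp only [hr]; exact_mod_cast this
    refine le_trans ?_ h7
    apply div_le_self hApos.le; linarith
  · intro x hx
    simp only [hH, Finset.mem_filter] at hx ⊢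
    have hrx : r x⁻¹ = r x := by
      simp only [hr]; congr 1
      apply Finset.card_bij (fun p _ => (p.2, p.1))
      · rintro ⟨a, b⟩ hp
        simp at hp ⊢
        refine ⟨by tauto, ?_⟩
        rw [← inv_inv x, ← hp.2]; group
      · rintro ⟨a, b⟩ _ ⟨a', b'⟩ _; simp; tauto
      · rintro ⟨a, b⟩ hp
        simp at hp
        refine ⟨(b, a), ?_, rfl⟩
        simp
        refine ⟨by tauto, ?_⟩
        rw [← hp.2]; group
    rw [hrx]
    refine ⟨?_, hx.2⟩
    have := Finset.inv_mem_inv hx.1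
    simpa [hD, mul_inv_rev] using this
  · intro n
    have key : ∀ n : ℕ, ((A * H ^ n * A⁻¹).card : ℝ) ≤ (2 * K ^ 2) ^ n * (K * A.card) := by
      intro n
      induction n with
      | zero => simpa using h
      | succ n ih =>
        have hc := cnt ((A * A⁻¹) ×ˢ (A * H ^ n * A⁻¹)) (A * H ^ (n+1) * A⁻¹) (fun p => p.1 * p.2)
          ((A.card : ℝ) / (2 * K)) (by
            intro x hx
            rw [pow_succ', ] at hx
            obtain ⟨y, hy, b, hb, rfl⟩ := Finset.mem_mul.1 hx
            obtain ⟨a, ha, z, hz, rfl⟩ := Finset.mem_mul.1 hy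
            obtain ⟨h1, hh1, w, hw, rfl⟩ := Finset.mem_mul.1 hz
            have hh := (Finset.mem_filter.1 hh1).2
            refine hh.trans ?_
            simp only [hr]
            have : ((A ×ˢ A).filter (fun p => p.1⁻¹ * p.2 = h1)).card ≤
              (((A * A⁻¹) ×ˢ (A * H ^ n * A⁻¹)).filter (fun p => p.1 * p.2 = a * (h1 * w) * b)).card := by
              apply Finset.card_le_card_of_injOn (fun p => (a * p.1⁻¹, p.2 * w * b))
              · rintro ⟨c, d⟩ hp
                simp only [Finset.coe_filter, Set.mem_ofPred_eq, Finset.mem_product] at hp ⊢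
                refine ⟨⟨Finset.mul_mem_mul ha (Finset.inv_mem_inv hp.1.1),
                  Finset.mul_mem_mul (Finset.mul_mem_mul hp.1.2 hw) hb⟩, ?_⟩
                rw [← hp.2]; group
              · rintro ⟨c, d⟩ _ ⟨c', d'⟩ _ heq
                simp at heq
                simp [heq]
            exact_mod_cast this)
        rw [Finset.card_product] at hc
        push_cast at hc
        have h8 : ((A * A⁻¹).card : ℝ) * (A * H ^ n * A⁻¹).card ≤ K * A.card * ((2 * K ^ 2) ^ n * (K * A.card)) :=
          mul_le_mul h ih (by positivity) (by positivity)
        have h9 := hc.trans h8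
        have h10 : ((A * H ^ (n+1) * A⁻¹).card : ℝ) * (A.card / (2 * K)) ≤
            ((2 * K ^ 2) ^ (n+1) * (K * A.card)) * (A.card / (2 * K)) := by
          refine h9.trans (le_of_eq ?_)
          field_simp
          ring
        exact le_of_mul_le_mul_right h10 (by positivity)
    refine le_trans ?_ (key n)
    obtain ⟨a, ha⟩ := hA
    have : (H ^ n).card ≤ (A * H ^ n * A⁻¹).card := by
      apply Finset.card_le_card_of_injOn (fun x => a * x * a⁻¹)
      · intro x hx
        exact Finset.mul_mem_mul (Finset.mul_mem_mul ha hx) (Finset.inv_mem_inv ha)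
      · intro x _ y _ hxy
        simpa using hxy
    exact_mod_cast this
  · have : ∑ x ∈ H, r x ≤ H.card * A.card := by
      calc _ ≤ ∑ x ∈ H, (A.card : ℝ) := Finset.sum_le_sum (fun x _ => hrle x)
        _ = _ := by simp
    have h6 : (A.card : ℝ) * A.card ≤ (2 * K * H.card) * A.card := by
      have := mul_le_mul_of_nonneg_left this (by positivity : 0 ≤ 2 * K)
      nlinarith
    exact le_of_mul_le_mul_right h6 hApos
  · by_contra hcon
    push Not at hcon
    have e1 : ∑ x ∈ H, r x = ∑ c ∈ A, ((A.filter (fun a => c⁻¹ * a ∈ H)).card : ℝ) := by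
      have l1 : ∑ x ∈ H, r x = (((A ×ˢ A).filter (fun p => p.1⁻¹ * p.2 ∈ H)).card : ℝ) := by
        have := Finset.card_eq_sum_card_fiberwise (f := fun p : G × G => p.1⁻¹ * p.2)
          (s := (A ×ˢ A).filter (fun p => p.1⁻¹ * p.2 ∈ H)) (t := H) (by
            intro p hp; simp only [Finset.coe_filter, Set.mem_ofPred_eq] at hp; exact hp.2)
        rw [this]; push_cast
        apply Finset.sum_congr rfl
        intro x hx
        simp only [hr]; congr 2
        ext p
        simp only [Finset.mem_filter]
        constructor
        · rintro ⟨a, b⟩; exact ⟨⟨a, b ▸ hx⟩, b⟩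
        · rintro ⟨⟨a, b⟩, c⟩; exact ⟨a, c⟩
      rw [l1]
      rw [Finset.card_filter, Finset.sum_product]
      push_cast
      apply Finset.sum_congr rfl
      intro c _
      rw [Finset.card_filter]; push_cast; rfl
    rw [e1] at hH1
    have : 2 * K * ∑ c ∈ A, ((A.filter (fun a => c⁻¹ * a ∈ H)).card : ℝ) < (A.card : ℝ) ^ 2 := by
      rw [Finset.mul_sum, sq]
      calc _ < ∑ c ∈ A, (A.card : ℝ) := Finset.sum_lt_sum_of_nonempty hA (fun c _ => hcon c)
        _ = _ := by simp
    linarith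

end IUC
end

section
open Finset
open scoped Pointwise
set_option maxHeartbeats 2000000
set_option linter.unusedSectionVars false
namespace IUC
variable {G : Type*} [Group G] [DecidableEq G]

/-- Balog–Szemerédi–Gowers. -/
lemma partB (A S : Finset G) (hA : A.Nonempty) (L : ℝ) (hL : 1 ≤ L)
    (hE : (A.card : ℝ) ^ 2 ≤ L * ((A ×ˢ A).filter (fun p => p.1 * p.2 ∈ S)).card)
    (hS : (S.card : ℝ) ≤ L * A.card) :
    ∃ B ⊆ A, B.Nonempty ∧ (A.card : ℝ) ≤ 4 * L * B.card ∧
      ((B * B⁻¹).card : ℝ) ≤ 16384 * L ^ 10 * B.card := by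
  classical
  have hApos : (0 : ℝ) < A.card := by exact_mod_cast hA.card_pos
  have hL0 : 0 < L := by linarith
  set Nb : G → Finset G := fun b => A.filter (fun a => a * b ∈ S) with hNb
  set η : ℝ := 1 / (32 * L ^ 2) with hη
  set cd : G → G → ℝ := fun a a' => ((A.filter (fun b => a * b ∈ S ∧ a' * b ∈ S)).card : ℝ) with hcd
  set bad : Finset (G × G) := (A ×ˢ A).filter (fun p => cd p.1 p.2 < η * A.card) with hbad
  have hsumN : ∑ b ∈ A, ((Nb b).card : ℝ) = ((A ×ˢ A).filter (fun p => p.1 * p.2 ∈ S)).card := by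
    rw [Finset.card_filter, Finset.sum_product_right]
    push_cast
    apply Finset.sum_congr rfl
    intro b _
    simp only [hNb]
    rw [Finset.card_filter]; push_cast; rfl
  have hCS : (∑ b ∈ A, ((Nb b).card : ℝ)) ^ 2 ≤ A.card * ∑ b ∈ A, ((Nb b).card : ℝ) ^ 2 :=
    sq_sum_le_card_mul_sum_sq
  have hN2 : (A.card : ℝ) ^ 3 ≤ L ^ 2 * ∑ b ∈ A, ((Nb b).card : ℝ) ^ 2 := by
    rw [← hsumN] at hE
    have h1 : ((A.card : ℝ) ^ 2) ^ 2 ≤ (L * ∑ b ∈ A, ((Nb b).card : ℝ)) ^ 2 :=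
      pow_le_pow_left₀ (by positivity) hE 2
    rw [mul_pow] at h1
    have h2 : (A.card : ℝ) * A.card ^ 3 ≤ A.card * (L ^ 2 * ∑ b ∈ A, ((Nb b).card : ℝ) ^ 2) := by
      have := mul_le_mul_of_nonneg_left hCS (by positivity : 0 ≤ L ^ 2)
      nlinarith
    exact le_of_mul_le_mul_left h2 hApos
  have hbadsum : ∑ b ∈ A, ((bad.filter (fun p => p.1 * b ∈ S ∧ p.2 * b ∈ S)).card : ℝ)
      ≤ η * A.card ^ 3 := by
    have e : ∑ b ∈ A, ((bad.filter (fun p => p.1 * b ∈ S ∧ p.2 * b ∈ S)).card : ℝ)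
        = ∑ p ∈ bad, cd p.1 p.2 := by
      simp only [hcd, Finset.card_filter]
      push_cast
      rw [Finset.sum_comm]
    rw [e]
    calc _ ≤ ∑ p ∈ bad, η * A.card := by
          apply Finset.sum_le_sum
          intro p hp
          exact (Finset.mem_filter.1 hp).2.le
      _ = bad.card * (η * A.card) := by simp
      _ ≤ (A.card * A.card : ℝ) * (η * A.card) := by
          apply mul_le_mul_of_nonneg_right _ (by positivity)
          have : bad.card ≤ (A ×ˢ A).card := Finset.card_le_card (Finset.filter_subset _ _)
          rw [Finset.card_product] at this
          exact_mod_cast this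
      _ = _ := by ring
  obtain ⟨b, hbA, hb⟩ : ∃ b ∈ A, (A.card : ℝ) ^ 2 / (2 * L ^ 2) ≤ ((Nb b).card : ℝ) ^ 2
      - 16 * ((bad.filter (fun p => p.1 * b ∈ S ∧ p.2 * b ∈ S)).card : ℝ) := by
    by_contra hcon
    push Not at hcon
    have h1 := Finset.sum_lt_sum_of_nonempty hA hcon
    rw [Finset.sum_sub_distrib, ← Finset.mul_sum] at h1
    have e : ∑ i ∈ A, (A.card : ℝ) ^ 2 / (2 * L ^ 2) = (A.card : ℝ) ^ 3 / (2 * L ^ 2) := by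
      simp; ring
    rw [e] at h1
    have h2 : (A.card : ℝ) ^ 3 / L ^ 2 ≤ ∑ b ∈ A, ((Nb b).card : ℝ) ^ 2 := by
      rw [div_le_iff₀ (by positivity)]; linarith
    have e2 : 16 * (η * A.card ^ 3) = (A.card : ℝ) ^ 3 / (2 * L ^ 2) := by
      rw [hη]; field_simp; norm_num
    have e3 : (A.card : ℝ) ^ 3 / L ^ 2 = (A.card : ℝ) ^ 3 / (2 * L ^ 2) + (A.card : ℝ) ^ 3 / (2 * L ^ 2) := by
      field_simp; norm_num
    linarith
  set P := Nb b with hP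
  set bb := bad.filter (fun p => p.1 * b ∈ S ∧ p.2 * b ∈ S) with hbb
  have hPn : (A.card : ℝ) ≤ 2 * L * P.card := by
    have h1 : (A.card : ℝ) ^ 2 / (2 * L ^ 2) ≤ (P.card : ℝ) ^ 2 := by
      have : (0 : ℝ) ≤ bb.card := by positivity
      linarith
    rw [div_le_iff₀ (by positivity)] at h1
    apply le_of_sq_le_sq _ (by positivity)
    nlinarith
  have hPpos : (0 : ℝ) < P.card := by
    by_contra h0
    have : (P.card : ℝ) = 0 := le_antisymm (not_lt.1 h0) (by positivity)
    rw [this] at hPn; linarith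
  have hbb16 : 16 * (bb.card : ℝ) ≤ (P.card : ℝ) ^ 2 := by
    have : 0 ≤ (A.card : ℝ) ^ 2 / (2 * L ^ 2) := by positivity
    linarith
  set bp : G → Finset G := fun a => P.filter (fun a' => cd a a' < η * A.card) with hbp
  set B := P.filter (fun a => 4 * ((bp a).card : ℝ) ≤ P.card) with hB
  have hPA : P ⊆ A := Finset.filter_subset _ _
  have hbbeq : (bb.card : ℝ) = ∑ a ∈ P, ((bp a).card : ℝ) := by
    have : bb = (P ×ˢ P).filter (fun p => cd p.1 p.2 < η * A.card) := by
      ext p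
      simp only [hbb, hbad, hP, hNb, Finset.mem_filter, Finset.mem_product]
      tauto
    rw [this, Finset.card_filter, Finset.sum_product]
    push_cast
    apply Finset.sum_congr rfl
    intro a _
    simp only [hbp]
    rw [Finset.card_filter]; push_cast; rfl
  have hBc : 3 * (P.card : ℝ) ≤ 4 * B.card := by
    have hsplit : (B.card : ℝ) + ((P.filter (fun a => ¬ 4 * ((bp a).card : ℝ) ≤ P.card)).card : ℝ) = P.card := by
      have h7 := Finset.card_filter_add_card_filter_not (s := P) (fun a => 4 * ((bp a).card : ℝ) ≤ P.card)
      rw [← Nat.cast_add]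
      exact congrArg Nat.cast h7
    set B' := P.filter (fun a => ¬ 4 * ((bp a).card : ℝ) ≤ P.card) with hB'
    have h1 : (B'.card : ℝ) * P.card ≤ 4 * bb.card := by
      rw [hbbeq, Finset.mul_sum]
      calc _ = ∑ a ∈ B', (P.card : ℝ) := by simp
        _ ≤ ∑ a ∈ B', 4 * ((bp a).card : ℝ) := by
            apply Finset.sum_le_sum
            intro a ha
            exact (not_le.1 (Finset.mem_filter.1 ha).2).le
        _ ≤ _ := by
            apply Finset.sum_le_sum_of_subset_of_nonneg (Finset.filter_subset _ _)
            intros; positivity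
    have h2 : 4 * (B'.card : ℝ) * P.card ≤ P.card * P.card := by nlinarith
    have h3 := le_of_mul_le_mul_right h2 hPpos
    linarith
  set D : Finset G := (S * S⁻¹).filter (fun d => η * A.card ≤ (((S ×ˢ S).filter (fun p => p.1 * p.2⁻¹ = d)).card : ℝ)) with hD
  have hDc : (D.card : ℝ) ≤ 32 * L ^ 4 * A.card := by
    have h1 := cnt (S ×ˢ S) D (fun p => p.1 * p.2⁻¹) (η * A.card) (fun d hd => (Finset.mem_filter.1 hd).2)
    rw [Finset.card_product] at h1
    push_cast at h1
    have h2 : (S.card : ℝ) * S.card ≤ (L * A.card) * (L * A.card) := mul_le_mul hS hS (by positivity) (by positivity)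
    have h3 : (D.card : ℝ) * (η * A.card) ≤ (32 * L ^ 4 * A.card) * (η * A.card) := by
      refine h1.trans (h2.trans (le_of_eq ?_))
      rw [hη]; field_simp
    exact le_of_mul_le_mul_right h3 (by rw [hη]; positivity)
  have hgood : ∀ a ∈ P, ∀ a' ∈ P, a' ∉ bp a → a * a'⁻¹ ∈ D := by
    intro a ha a' ha' hn
    have hcd1 : η * A.card ≤ cd a a' := by
      by_contra h0
      exact hn (Finset.mem_filter.2 ⟨ha', not_le.1 h0⟩)
    have ha2 := (Finset.mem_filter.1 ha).2
    have ha2' := (Finset.mem_filter.1 ha').2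
    refine Finset.mem_filter.2 ⟨?_, hcd1.trans ?_⟩
    · have : a * a'⁻¹ = (a * b) * (a' * b)⁻¹ := by group
      rw [this]
      exact Finset.mul_mem_mul ha2 (Finset.inv_mem_inv ha2')
    · simp only [hcd]
      have : (A.filter (fun b => a * b ∈ S ∧ a' * b ∈ S)).card ≤
          ((S ×ˢ S).filter (fun p => p.1 * p.2⁻¹ = a * a'⁻¹)).card := by
        apply Finset.card_le_card_of_injOn (fun b => (a * b, a' * b))
        · intro x hx
          simp only [Finset.coe_filter, Set.mem_ofPred_eq, Finset.mem_product] at hx ⊢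
          exact ⟨hx.2, by group⟩
        · intro x _ y _ hxy
          simp at hxy
          exact hxy
      exact_mod_cast this
  have hcdsymm : ∀ a a', cd a a' = cd a' a := by
    intro a a'; simp only [hcd, and_comm]
  have hBB : ((B * B⁻¹).card : ℝ) * (P.card / 2) ≤ (D.card : ℝ) * D.card := by
    have := cnt (D ×ˢ D) (B * B⁻¹) (fun p => p.1 * p.2) (P.card / 2) (by
      intro x hx
      obtain ⟨a, ha, c', hc', rfl⟩ := Finset.mem_mul.1 hx
      obtain ⟨c, hc, rfl⟩ := Finset.mem_inv.1 hc'
      have ha1 := Finset.mem_filter.1 ha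
      have hc1 := Finset.mem_filter.1 hc
      have hsub : (P \ (bp a ∪ bp c)).card ≤ ((D ×ˢ D).filter (fun p => p.1 * p.2 = a * c⁻¹)).card := by
        apply Finset.card_le_card_of_injOn (fun y => (a * y⁻¹, y * c⁻¹))
        · intro y hy
          simp only [Finset.coe_sdiff, Finset.coe_union, Set.mem_sdiff, Finset.mem_coe, Set.mem_union, not_or] at hy
          simp only [Finset.coe_filter, Set.mem_ofPred_eq, Finset.mem_product]
          refine ⟨⟨hgood a ha1.1 y hy.1 hy.2.1, hgood y hy.1 c hc1.1 ?_⟩, by group⟩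
          intro hcon
          apply hy.2.2
          refine Finset.mem_filter.2 ⟨hy.1, ?_⟩
          rw [hcdsymm]; exact (Finset.mem_filter.1 hcon).2
        · intro x _ y _ hxy
          simp at hxy
          exact hxy
      have h1 : P.card ≤ (P \ (bp a ∪ bp c)).card + ((bp a).card + (bp c).card) := by
        have h2 := Finset.le_card_sdiff (bp a ∪ bp c) P
        have h3 := Finset.card_union_le (bp a) (bp c)
        omega
      have h1' : (P.card : ℝ) ≤ (P \ (bp a ∪ bp c)).card + ((bp a).card + (bp c).card) := by exact_mod_cast h1
      have hsub' : ((P \ (bp a ∪ bp c)).card : ℝ) ≤ ((D ×ˢ D).filter (fun p => p.1 * p.2 = a * c⁻¹)).card := by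
        exact_mod_cast hsub
      linarith [ha1.2, hc1.2])
    rw [Finset.card_product] at this
    push_cast at this
    exact this
  have hBpos : (0 : ℝ) < B.card := by linarith
  have hAB : (A.card : ℝ) ≤ 4 * L * B.card := by nlinarith
  refine ⟨B, (Finset.filter_subset _ _).trans hPA, ?_, hAB, ?_⟩
  · exact Finset.card_pos.1 (by exact_mod_cast hBpos)
  · have h1 : (D.card : ℝ) * D.card ≤ (32 * L ^ 4 * A.card) * (32 * L ^ 4 * A.card) :=
      mul_le_mul hDc hDc (by positivity) (by positivity)
    have h2 : ((B * B⁻¹).card : ℝ) * (A.card) ≤ (4096 * L ^ 9 * A.card) * A.card := by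
      have h4 : ((B * B⁻¹).card : ℝ) * A.card ≤ ((B * B⁻¹).card : ℝ) * (2 * L * P.card) :=
        mul_le_mul_of_nonneg_left hPn (by positivity)
      have h5 : ((B * B⁻¹).card : ℝ) * (2 * L * P.card) = 4 * L * (((B * B⁻¹).card : ℝ) * (P.card / 2)) := by ring
      have h6 := mul_le_mul_of_nonneg_left (hBB.trans h1) (by positivity : 0 ≤ 4 * L)
      calc _ ≤ _ := h4
        _ = _ := h5
        _ ≤ _ := h6
        _ = _ := by ring
    have h3 := le_of_mul_le_mul_right h2 hApos
    calc _ ≤ _ := h3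
      _ ≤ 4096 * L ^ 9 * (4 * L * B.card) := mul_le_mul_of_nonneg_left hAB (by positivity)
      _ = _ := by ring

end IUC
end

section
open Finset
open scoped Pointwise
set_option maxHeartbeats 2000000
set_option linter.unusedSectionVars false
namespace IUC
variable {G : Type*} [Group G] [DecidableEq G] [Fintype G]

def conv (f g : G → ℝ) (x : G) : ℝ := ∑ y, f y * g (y⁻¹ * x)

lemma conv_nonneg {f g : G → ℝ} (hf : ∀ x, 0 ≤ f x) (hg : ∀ x, 0 ≤ g x) (x : G) : 0 ≤ conv f g x :=
  Finset.sum_nonneg (fun y _ => mul_nonneg (hf y) (hg _))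

lemma sum_conv_mul (f g h : G → ℝ) : ∑ x, conv f g x * h x = ∑ y, ∑ z, f y * g z * h (y * z) := by
  simp only [conv, Finset.sum_mul]
  rw [Finset.sum_comm]
  apply Finset.sum_congr rfl
  intro y _
  rw [← Equiv.sum_comp (Equiv.mulLeft y)]
  simp

lemma sum_conv (f g : G → ℝ) : ∑ x, conv f g x = (∑ x, f x) * ∑ x, g x := by
  have := sum_conv_mul f g (fun _ => 1)
  simp only [mul_one] at this
  rw [this, Finset.sum_mul_sum]

lemma conv_self_le (f : G → ℝ) (x : G) : conv f f x ≤ ∑ y, f y ^ 2 := by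
  have h1 : conv f f x ≤ ∑ y, (f y ^ 2 / 2 + f (y⁻¹ * x) ^ 2 / 2) := by
    apply Finset.sum_le_sum
    intro y _
    nlinarith [sq_nonneg (f y - f (y⁻¹ * x))]
  rw [Finset.sum_add_distrib] at h1
  have h2 : ∑ y, f (y⁻¹ * x) ^ 2 / 2 = ∑ y, f y ^ 2 / 2 :=
    Fintype.sum_equiv ((Equiv.inv G).trans (Equiv.mulRight x)) _ _ (fun y => by simp)
  rw [h2, ← Finset.sum_add_distrib] at h1
  simpa using h1

theorem bsg_main (ν : G → ℝ) (h0 : ∀ x, 0 ≤ ν x) (h1 : ∑ x, ν x = 1) (K : ℝ) (hK : 2 ≤ K)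
    (M : ℝ) (hM : M = ∑ x, ν x ^ 2) (hconv : M ≤ K * ∑ x, conv ν ν x ^ 2) :
    ∃ H : Finset G, 1 ∈ H ∧ (∀ x ∈ H, x⁻¹ ∈ H) ∧
      (∀ n : ℕ, ((H ^ n).card : ℝ) ≤ (K ^ 549) ^ (n + 1) * H.card) ∧
      1 ≤ K ^ 310 * M * H.card ∧ H.card * M ≤ K ^ 830 ∧
      ∃ c : G, 1 ≤ K ^ 317 * ∑ x ∈ univ.filter (fun x => c⁻¹ * x ∈ H), ν x := by
  classical
  have hKpos : 0 < K := by linarith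
  have hMpos : 0 < M := by
    rw [hM]
    have : (∑ x, ν x) ^ 2 ≤ (univ : Finset G).card * ∑ x, ν x ^ 2 := sq_sum_le_card_mul_sum_sq
    rw [h1] at this
    by_contra hcon
    have h2 : ∑ x, ν x ^ 2 ≤ 0 := not_lt.1 hcon
    have : (1:ℝ) ^ 2 ≤ 0 := this.trans (mul_nonpos_of_nonneg_of_nonpos (by positivity) h2)
    norm_num at this
  set F := conv ν ν with hF
  have hF0 : ∀ x, 0 ≤ F x := conv_nonneg h0 h0
  have hFM : ∀ x, F x ≤ M := fun x => hM ▸ conv_self_le ν x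
  have hFs : ∑ x, F x = 1 := by rw [hF, sum_conv, h1]; norm_num
  set S : Finset G := univ.filter (fun x => M / (2 * K) ≤ F x) with hS
  have hScard : (S.card : ℝ) * M ≤ 2 * K := by
    have : (S.card : ℝ) * (M / (2 * K)) ≤ 1 := by
      rw [← hFs]
      calc _ = ∑ x ∈ S, M / (2 * K) := by simp
        _ ≤ ∑ x ∈ S, F x := Finset.sum_le_sum (fun x hx => (Finset.mem_filter.1 hx).2)
        _ ≤ _ := Finset.sum_le_sum_of_subset_of_nonneg (Finset.subset_univ _) (fun x _ _ => hF0 x)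
    rw [← mul_div_assoc, div_le_one (by positivity)] at this
    exact this
  have hFS : 1 ≤ 2 * K * ∑ x ∈ S, F x := by
    have hsplit := Finset.sum_filter_add_sum_filter_not univ (fun x => M / (2 * K) ≤ F x) (fun x => F x ^ 2)
    have hsm : ∑ x ∈ univ.filter (fun x => ¬ M / (2 * K) ≤ F x), F x ^ 2 ≤ M / (2 * K) := by
      calc _ ≤ ∑ x ∈ univ.filter (fun x => ¬ M / (2 * K) ≤ F x), M / (2 * K) * F x := by
            apply Finset.sum_le_sum
            intro x hx
            rw [sq]
            exact mul_le_mul_of_nonneg_right (not_le.1 (Finset.mem_filter.1 hx).2).le (hF0 x)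
        _ ≤ ∑ x, M / (2 * K) * F x :=
            Finset.sum_le_sum_of_subset_of_nonneg (Finset.subset_univ _)
              (fun x _ _ => mul_nonneg (by positivity) (hF0 x))
        _ = _ := by rw [← Finset.mul_sum, hFs, mul_one]
    have hbig : ∑ x ∈ S, F x ^ 2 ≤ M * ∑ x ∈ S, F x := by
      rw [Finset.mul_sum]
      apply Finset.sum_le_sum
      intro x _
      rw [sq]; exact mul_le_mul_of_nonneg_right (hFM x) (hF0 x)
    rw [← hsplit] at hconv
    have e : K * (M / (2 * K)) = M / 2 := by field_simp
    have h3 : K * ∑ x ∈ univ.filter (fun x => ¬ M / (2 * K) ≤ F x), F x ^ 2 ≤ M / 2 := by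
      rw [← e]; exact mul_le_mul_of_nonneg_left hsm hKpos.le
    have h4 : M / 2 ≤ K * ∑ x ∈ S, F x ^ 2 := by rw [mul_add] at hconv; linarith
    have h5 : M * 1 ≤ M * (2 * K * ∑ x ∈ S, F x) := by
      have := mul_le_mul_of_nonneg_left hbig hKpos.le
      nlinarith
    exact le_of_mul_le_mul_left h5 hMpos
  set A : Finset G := univ.filter (fun x => M ≤ 32 * K ^ 2 * ν x ∧ ν x ≤ 8 * K * M) with hA
  set E := (A ×ˢ A).filter (fun p => p.1 * p.2 ∈ S) with hE
  set Bg : Finset G := univ.filter (fun x => 8 * K * M < ν x) with hBg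
  set Sm : Finset G := univ.filter (fun x => 32 * K ^ 2 * ν x < M) with hSm
  have hBgs : 8 * K * ∑ x ∈ Bg, ν x ≤ 1 := by
    have : (8 * K * ∑ x ∈ Bg, ν x) * M ≤ 1 * M := by
      rw [one_mul]
      nth_rw 2 [hM]
      calc _ = ∑ x ∈ Bg, (8 * K * M) * ν x := by rw [← Finset.mul_sum]; ring
        _ ≤ ∑ x ∈ Bg, ν x ^ 2 := by
          apply Finset.sum_le_sum; intro x hx
          rw [sq]; exact mul_le_mul_of_nonneg_right (Finset.mem_filter.1 hx).2.le (h0 x)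
        _ ≤ _ := Finset.sum_le_sum_of_subset_of_nonneg (Finset.subset_univ _) (fun x _ _ => sq_nonneg _)
    exact le_of_mul_le_mul_right this hMpos
  set w : G → G → ℝ := fun x y => ν x * ν y * (if x * y ∈ S then 1 else 0) with hw
  have hw0 : ∀ x y, 0 ≤ w x y := fun x y => by
    have := h0 x; have := h0 y
    simp only [hw]; split_ifs <;> positivity
  have hwle : ∀ x y, w x y ≤ ν x * ν y := fun x y => by
    have := mul_nonneg (h0 x) (h0 y)
    simp only [hw]; split_ifs <;> linarith
  have hFw : ∑ x ∈ S, F x = ∑ x, ∑ y, w x y := by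
    have := sum_conv_mul ν ν (fun x => if x ∈ S then (1:ℝ) else 0)
    simp only [hw]
    rw [← this, ← Finset.sum_filter_add_sum_filter_not univ (fun x => x ∈ S)]
    have e1 : univ.filter (fun x => x ∈ S) = S := by ext; simp
    have e2 : ∑ x ∈ univ.filter (fun x => x ∉ S), conv ν ν x * (if x ∈ S then (1:ℝ) else 0) = 0 := by
      apply Finset.sum_eq_zero; intro x hx
      rw [if_neg (Finset.mem_filter.1 hx).2, mul_zero]
    rw [e2, e1, add_zero]
    apply Finset.sum_congr rfl
    intro x hx; rw [if_pos hx, mul_one]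
  have hSsm : ∀ y, ∑ x ∈ Sm, (if x * y ∈ S then (1:ℝ) else 0) ≤ S.card := by
    intro y
    rw [← Finset.sum_filter, Finset.sum_const, nsmul_eq_mul, mul_one]
    have : (Sm.filter (fun x => x * y ∈ S)).card ≤ S.card := by
      apply Finset.card_le_card_of_injOn (fun x => x * y)
      · intro x hx; simp only [Finset.coe_filter, Set.mem_ofPred_eq] at hx; exact hx.2
      · intro x _ z _ h; simpa using h
    exact_mod_cast this
  have hSsm' : ∀ x, ∑ y ∈ Sm, (if x * y ∈ S then (1:ℝ) else 0) ≤ S.card := by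
    intro x
    rw [← Finset.sum_filter, Finset.sum_const, nsmul_eq_mul, mul_one]
    have : (Sm.filter (fun y => x * y ∈ S)).card ≤ S.card := by
      apply Finset.card_le_card_of_injOn (fun y => x * y)
      · intro x hx; simp only [Finset.coe_filter, Set.mem_ofPred_eq] at hx; exact hx.2
      · intro x _ z _ h; simpa using h
    exact_mod_cast this
  have hsmb : 16 * K * ∑ y, ∑ x ∈ Sm, w x y ≤ 1 := by
    have : ∀ y, 32 * K ^ 2 * ∑ x ∈ Sm, w x y ≤ ν y * (2 * K) := by
      intro y
      rw [Finset.mul_sum]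
      calc _ ≤ ∑ x ∈ Sm, (ν y * M) * (if x * y ∈ S then (1:ℝ) else 0) := by
            apply Finset.sum_le_sum; intro x hx
            have hx := (Finset.mem_filter.1 hx).2
            simp only [hw]
            rw [← mul_assoc]
            apply mul_le_mul_of_nonneg_right _ (by split_ifs <;> norm_num)
            have := mul_le_mul_of_nonneg_right hx.le (h0 y)
            linarith
        _ = (ν y * M) * ∑ x ∈ Sm, (if x * y ∈ S then (1:ℝ) else 0) := by rw [Finset.mul_sum]
        _ ≤ (ν y * M) * S.card := mul_le_mul_of_nonneg_left (hSsm y) (mul_nonneg (h0 y) hMpos.le)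
        _ ≤ ν y * (2 * K) := by rw [mul_assoc]; apply mul_le_mul_of_nonneg_left _ (h0 y); linarith
    have h3 := Finset.sum_le_sum (fun y (_ : y ∈ univ) => this y)
    rw [← Finset.mul_sum, ← Finset.sum_mul, h1] at h3
    have h4 : (2 * K) * (16 * K * ∑ y, ∑ x ∈ Sm, w x y) ≤ (2 * K) * 1 := by nlinarith
    exact le_of_mul_le_mul_left h4 (by positivity)
  have hsmb' : 16 * K * ∑ x, ∑ y ∈ Sm, w x y ≤ 1 := by
    have : ∀ x, 32 * K ^ 2 * ∑ y ∈ Sm, w x y ≤ ν x * (2 * K) := by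
      intro x
      rw [Finset.mul_sum]
      calc _ ≤ ∑ y ∈ Sm, (ν x * M) * (if x * y ∈ S then (1:ℝ) else 0) := by
            apply Finset.sum_le_sum; intro y hy
            have hy := (Finset.mem_filter.1 hy).2
            simp only [hw]
            rw [← mul_assoc]
            apply mul_le_mul_of_nonneg_right _ (by split_ifs <;> norm_num)
            have := mul_le_mul_of_nonneg_left hy.le (h0 x)
            linarith
        _ = (ν x * M) * ∑ y ∈ Sm, (if x * y ∈ S then (1:ℝ) else 0) := by rw [Finset.mul_sum]
        _ ≤ (ν x * M) * S.card := mul_le_mul_of_nonneg_left (hSsm' x) (mul_nonneg (h0 x) hMpos.le)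
        _ ≤ ν x * (2 * K) := by rw [mul_assoc]; apply mul_le_mul_of_nonneg_left _ (h0 x); linarith
    have h3 := Finset.sum_le_sum (fun y (_ : y ∈ univ) => this y)
    rw [← Finset.mul_sum, ← Finset.sum_mul, h1] at h3
    have h4 : (2 * K) * (16 * K * ∑ y, ∑ x ∈ Sm, w y x) ≤ (2 * K) * 1 := by nlinarith
    exact le_of_mul_le_mul_left h4 (by positivity)
  have hbgb : 8 * K * ∑ y, ∑ x ∈ Bg, w x y ≤ 1 := by
    refine le_trans ?_ hBgs
    apply mul_le_mul_of_nonneg_left _ (by positivity)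
    calc _ ≤ ∑ y, ∑ x ∈ Bg, ν x * ν y := Finset.sum_le_sum (fun y _ => Finset.sum_le_sum (fun x _ => hwle x y))
      _ = ∑ y, (∑ x ∈ Bg, ν x) * ν y := by simp only [Finset.sum_mul]
      _ = _ := by rw [← Finset.mul_sum, h1, mul_one]
  have hbgb' : 8 * K * ∑ x, ∑ y ∈ Bg, w x y ≤ 1 := by
    refine le_trans ?_ hBgs
    apply mul_le_mul_of_nonneg_left _ (by positivity)
    calc _ ≤ ∑ x, ∑ y ∈ Bg, ν x * ν y := Finset.sum_le_sum (fun y _ => Finset.sum_le_sum (fun x _ => hwle _ _))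
      _ = ∑ x, ν x * (∑ y ∈ Bg, ν y) := by simp only [Finset.mul_sum]
      _ = _ := by rw [← Finset.sum_mul, h1, one_mul]
  have htot : ∑ x, ∑ y, w x y ≤ ∑ x ∈ A, ∑ y ∈ A, w x y + (∑ y, ∑ x ∈ Sm, w x y) + (∑ x, ∑ y ∈ Sm, w x y)
      + (∑ y, ∑ x ∈ Bg, w x y) + ∑ x, ∑ y ∈ Bg, w x y := by
    rw [Finset.sum_comm (s := univ) (t := Sm), Finset.sum_comm (s := univ) (t := Bg)]
    have conv1 : ∀ (T : Finset G) (f : G → ℝ), ∑ x ∈ T, f x = ∑ x, if x ∈ T then f x else 0 := by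
      intro T f; rw [← Finset.sum_filter]; congr 1; ext; simp
    have hpt : ∀ x y, w x y ≤ (if x ∈ A then (if y ∈ A then w x y else 0) else 0) + (if x ∈ Sm then w x y else 0)
      + (if y ∈ Sm then w x y else 0) + (if x ∈ Bg then w x y else 0) + (if y ∈ Bg then w x y else 0) := by
      intro x y
      have hh := hw0 x y
      have hx : x ∈ A ∨ x ∈ Sm ∨ x ∈ Bg := by
        simp only [hA, hSm, hBg, Finset.mem_filter, Finset.mem_univ, true_and]
        by_contra hcon
        push Not at hcon
        exact absurd (hcon.1 hcon.2.1) (not_lt.2 hcon.2.2)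
      have hy : y ∈ A ∨ y ∈ Sm ∨ y ∈ Bg := by
        simp only [hA, hSm, hBg, Finset.mem_filter, Finset.mem_univ, true_and]
        by_contra hcon
        push Not at hcon
        exact absurd (hcon.1 hcon.2.1) (not_lt.2 hcon.2.2)
      split_ifs <;> first | linarith | tauto
    calc _ ≤ ∑ x, ∑ y, ((if x ∈ A then (if y ∈ A then w x y else 0) else 0) + (if x ∈ Sm then w x y else 0)
      + (if y ∈ Sm then w x y else 0) + (if x ∈ Bg then w x y else 0) + (if y ∈ Bg then w x y else 0)) :=
        Finset.sum_le_sum (fun x _ => Finset.sum_le_sum (fun y _ => hpt x y))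
      _ = _ := by
        simp only [Finset.sum_add_distrib]
        rw [conv1 A, conv1 Sm, conv1 Bg]
        congr 1
        · congr 1
          · congr 1
            · congr 1
              · apply Finset.sum_congr rfl; intro x _
                split_ifs
                · rw [conv1 A]
                · simp
              · apply Finset.sum_congr rfl; intro x _
                split_ifs <;> simp
            · apply Finset.sum_congr rfl; intro x _; rw [conv1 Sm]
          · apply Finset.sum_congr rfl; intro x _
            split_ifs <;> simp
        · apply Finset.sum_congr rfl; intro x _; rw [conv1 Bg]
  have hAA : 1 ≤ 8 * K * ∑ x ∈ A, ∑ y ∈ A, w x y := by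
    rw [hFw] at hFS
    have := mul_le_mul_of_nonneg_left htot (by positivity : 0 ≤ 16 * K)
    nlinarith
  have hEc : ∑ x ∈ A, ∑ y ∈ A, w x y ≤ (8 * K * M) ^ 2 * E.card := by
    rw [hE, Finset.card_filter, Finset.sum_product]
    push_cast
    rw [Finset.mul_sum]
    apply Finset.sum_le_sum; intro x hx
    rw [Finset.mul_sum]
    apply Finset.sum_le_sum; intro y hy
    simp only [hw]
    apply mul_le_mul_of_nonneg_right _ (by split_ifs <;> norm_num)
    rw [sq]
    exact mul_le_mul (Finset.mem_filter.1 hx).2.2 (Finset.mem_filter.1 hy).2.2 (h0 y) (by positivity)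
  have hE1 : 1 ≤ 512 * K ^ 3 * M ^ 2 * E.card := by
    have := mul_le_mul_of_nonneg_left hEc (by positivity : 0 ≤ 8 * K)
    nlinarith
  have hAc : (A.card : ℝ) * M ≤ 32 * K ^ 2 := by
    calc (A.card : ℝ) * M = ∑ x ∈ A, M := by simp
      _ ≤ ∑ x ∈ A, 32 * K ^ 2 * ν x := Finset.sum_le_sum (fun x hx => (Finset.mem_filter.1 hx).2.1)
      _ ≤ ∑ x, 32 * K ^ 2 * ν x := Finset.sum_le_sum_of_subset_of_nonneg (Finset.subset_univ _)
          (fun x _ _ => mul_nonneg (by positivity) (h0 x))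
      _ = _ := by rw [← Finset.mul_sum, h1, mul_one]
  have hEA : (E.card : ℝ) ≤ A.card ^ 2 := by
    have : E.card ≤ (A ×ˢ A).card := Finset.card_le_card (Finset.filter_subset _ _)
    rw [Finset.card_product, ← sq] at this
    exact_mod_cast this
  have hAM : 1 ≤ 32 * K ^ 2 * (A.card * M) := by
    have h2 : 1 ≤ 512 * K ^ 3 * (A.card * M) ^ 2 := by
      have := mul_le_mul_of_nonneg_left hEA (by positivity : 0 ≤ 512 * K ^ 3 * M ^ 2)
      nlinarith
    have h3 : (1:ℝ) ^ 2 ≤ (32 * K ^ 2 * (A.card * M)) ^ 2 := by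
      have : 512 * K ^ 3 * (A.card * M) ^ 2 ≤ (32 * K ^ 2 * (A.card * M)) ^ 2 := by
        rw [mul_pow (32 * K ^ 2)]
        apply mul_le_mul_of_nonneg_right _ (by positivity)
        have : K ^ 3 ≤ K ^ 4 := pow_le_pow_right₀ (by linarith) (by norm_num)
        nlinarith [pow_pos hKpos 4]
      linarith
    exact le_of_sq_le_sq h3 (by positivity)
  have hAne : A.Nonempty := by
    rw [Finset.nonempty_iff_ne_empty]
    intro h
    rw [h] at hAM
    norm_num at hAM
  set L : ℝ := 2 ^ 19 * K ^ 7 with hLdef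
  have hL1 : 1 ≤ L := by
    have : 1 ≤ K ^ 7 := one_le_pow₀ (by linarith)
    rw [hLdef]; nlinarith
  obtain ⟨B, hBA, hBne, hAB, hBB⟩ := partB A S hAne L hL1 (by
      -- |A|² ≤ L |E|
      have h2 : (A.card * M) ^ 2 ≤ (32 * K ^ 2) ^ 2 := pow_le_pow_left₀ (by positivity) hAc 2
      have h3 : (A.card : ℝ) ^ 2 * M ^ 2 ≤ (L * E.card) * M ^ 2 := by
        calc (A.card : ℝ) ^ 2 * M ^ 2 = (A.card * M) ^ 2 * 1 := by ring
          _ ≤ (32 * K ^ 2) ^ 2 * (512 * K ^ 3 * M ^ 2 * E.card) :=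
            mul_le_mul h2 hE1 (by norm_num) (by positivity)
          _ = _ := by rw [hLdef]; ring
      exact le_of_mul_le_mul_right h3 (by positivity)) (by
      have h3 : (S.card : ℝ) * M ≤ (L * A.card) * M := by
        calc (S.card : ℝ) * M ≤ 2 * K * 1 := by linarith
          _ ≤ 2 * K * (32 * K ^ 2 * (A.card * M)) := mul_le_mul_of_nonneg_left hAM (by positivity)
          _ = (64 * K ^ 3) * (A.card * M) := by ring
          _ ≤ L * (A.card * M) := by
            apply mul_le_mul_of_nonneg_right _ (by positivity)
            have : K ^ 3 ≤ K ^ 7 := pow_le_pow_right₀ (by linarith) (by norm_num)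
            rw [hLdef]; nlinarith [pow_pos hKpos 7]
          _ = _ := by ring
      exact le_of_mul_le_mul_right h3 hMpos)
  have two_pow : ∀ a b : ℕ, (2:ℝ) ^ a * K ^ b ≤ K ^ (a + b) := by
    intro a b
    rw [pow_add]
    exact mul_le_mul_of_nonneg_right (pow_le_pow_left₀ (by norm_num) hK a) (by positivity)
  have hLK : L ≤ K ^ 26 := two_pow 19 7
  set K2 : ℝ := K ^ 274 with hK2
  have hK2' : 16384 * L ^ 10 ≤ K2 := by
    calc 16384 * L ^ 10 = 2 ^ 204 * K ^ 70 := by rw [hLdef]; ring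
      _ ≤ _ := two_pow 204 70
  have hK21 : 1 ≤ K2 := one_le_pow₀ (by linarith)
  obtain ⟨H, hH1, hHinv, hHn, hHB, c, hc⟩ := partC B hBne K2 hK21
    (hBB.trans (mul_le_mul_of_nonneg_right hK2' (by positivity)))
  have hBcA : (B.card : ℝ) ≤ A.card := by exact_mod_cast Finset.card_le_card hBA
  have h2K2 : 2 * K2 ^ 2 ≤ K ^ 549 := by
    calc 2 * K2 ^ 2 = 2 ^ 1 * K ^ 548 := by rw [hK2]; ring
      _ ≤ _ := two_pow 1 548
  have hchain : 1 ≤ (32 * K ^ 2) * (4 * L) * (B.card * M) := by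
    calc (1:ℝ) ≤ 32 * K ^ 2 * (A.card * M) := hAM
      _ ≤ 32 * K ^ 2 * ((4 * L * B.card) * M) := by gcongr
      _ = _ := by ring
  refine ⟨H, hH1, hHinv, ?_, ?_, ?_, c, ?_⟩
  · intro n
    calc ((H ^ n).card : ℝ) ≤ (2 * K2 ^ 2) ^ n * (K2 * B.card) := hHn n
      _ ≤ (2 * K2 ^ 2) ^ n * (K2 * (2 * K2 * H.card)) := by gcongr
      _ = (2 * K2 ^ 2) ^ (n + 1) * H.card := by ring
      _ ≤ _ := by gcongr
  · calc (1:ℝ) ≤ _ := hchain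
      _ ≤ (32 * K ^ 2) * (4 * L) * ((2 * K2 * H.card) * M) := by gcongr
      _ = (2 ^ 27 * K ^ 283) * M * H.card := by rw [hLdef, hK2]; ring
      _ ≤ K ^ 310 * M * H.card := by
        have := two_pow 27 283
        gcongr
  · have h3 := hHn 1
    rw [pow_one, pow_one] at h3
    calc (H.card : ℝ) * M ≤ (2 * K2 ^ 2 * (K2 * B.card)) * M := by gcongr
      _ ≤ (2 * K2 ^ 2 * (K2 * A.card)) * M := by gcongr
      _ = 2 * K2 ^ 3 * (A.card * M) := by ring
      _ ≤ 2 * K2 ^ 3 * (32 * K ^ 2) := by gcongr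
      _ = 2 ^ 6 * K ^ 824 := by rw [hK2]; ring
      _ ≤ _ := two_pow 6 824
  · have h3 : (B.filter (fun a => c⁻¹ * a ∈ H)).card * M ≤ 32 * K ^ 2 * ∑ x ∈ univ.filter (fun x => c⁻¹ * x ∈ H), ν x := by
      calc ((B.filter (fun a => c⁻¹ * a ∈ H)).card : ℝ) * M = ∑ x ∈ B.filter (fun a => c⁻¹ * a ∈ H), M := by simp
        _ ≤ ∑ x ∈ B.filter (fun a => c⁻¹ * a ∈ H), 32 * K ^ 2 * ν x := by
          apply Finset.sum_le_sum; intro x hx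
          exact (Finset.mem_filter.1 (hBA (Finset.mem_filter.1 hx).1)).2.1
        _ ≤ ∑ x ∈ univ.filter (fun x => c⁻¹ * x ∈ H), 32 * K ^ 2 * ν x := by
          apply Finset.sum_le_sum_of_subset_of_nonneg
          · intro x hx; simp only [Finset.mem_filter, Finset.mem_univ, true_and] at hx ⊢; exact hx.2
          · intro x _ _; exact mul_nonneg (by positivity) (h0 x)
        _ = _ := by rw [Finset.mul_sum]
    have hnn : 0 ≤ ∑ x ∈ univ.filter (fun x => c⁻¹ * x ∈ H), ν x := Finset.sum_nonneg (fun x _ => h0 x)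
    calc (1:ℝ) ≤ _ := hchain
      _ ≤ (32 * K ^ 2) * (4 * L) * ((2 * K2 * (B.filter (fun a => c⁻¹ * a ∈ H)).card) * M) := by gcongr
      _ = (32 * K ^ 2) * (4 * L) * (2 * K2) * ((B.filter (fun a => c⁻¹ * a ∈ H)).card * M) := by ring
      _ ≤ (32 * K ^ 2) * (4 * L) * (2 * K2) * (32 * K ^ 2 * ∑ x ∈ univ.filter (fun x => c⁻¹ * x ∈ H), ν x) := by gcongr
      _ = (2 ^ 32 * K ^ 285) * ∑ x ∈ univ.filter (fun x => c⁻¹ * x ∈ H), ν x := by rw [hLdef, hK2]; ring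
      _ ≤ K ^ 317 * _ := by
        have := two_pow 32 285
        gcongr

end IUC
end

section
open Finset
open scoped Pointwise
set_option maxHeartbeats 2000000
set_option linter.unusedSectionVars false
namespace IUC
variable {F : Type*} [Field F]

abbrev M2 (F : Type*) := Matrix (Fin 2) (Fin 2) F
abbrev SL (F : Type*) [Field F] := Matrix.SpecialLinearGroup (Fin 2) F

lemma m2ext {x y : M2 F} (h00 : x 0 0 = y 0 0) (h01 : x 0 1 = y 0 1) (h10 : x 1 0 = y 1 0)
    (h11 : x 1 1 = y 1 1) : x = y := by
  ext i j; fin_cases i <;> fin_cases j <;> assumption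

lemma rank1 (n x : M2 F) (hn : n.det = 0) : n * x * n = (x * n).trace • n := by
  rw [Matrix.det_fin_two] at hn
  apply m2ext <;> simp only [Matrix.mul_apply, Fin.sum_univ_two, Matrix.trace_fin_two, Matrix.smul_apply, smul_eq_mul]
  · linear_combination (-x 1 1) * hn
  · linear_combination (x 0 1) * hn
  · linear_combination (x 1 0) * hn
  · linear_combination (-x 0 0) * hn

def np : Option F → M2 F
  | none => !![0, 1; 0, 0]
  | some a => !![a, -a ^ 2; 1, -a]

lemma np_det (p : Option F) : (np p).det = 0 := by
  cases p <;> simp [np, Matrix.det_fin_two]; ring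
lemma np_trace (p : Option F) : (np p).trace = 0 := by
  cases p <;> simp [np, Matrix.trace_fin_two]
lemma np_ne (p : Option F) : np p ≠ 0 := by
  cases p with
  | none => intro h; have := congrFun (congrFun h 0) 1; simp [np] at this
  | some a => intro h; have := congrFun (congrFun h 1) 0; simp [np] at this

lemma sq_zero {n : M2 F} (ht : n.trace = 0) (hd : n.det = 0) : n * n = 0 := by
  have := rank1 n 1 hd
  simpa [ht] using this

lemma exists_np {n : M2 F} (ht : n.trace = 0) (hd : n.det = 0) (hn : n ≠ 0) :
    ∃ p : Option F, ∃ c : F, c ≠ 0 ∧ n = c • np p := by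
  rw [Matrix.trace_fin_two] at ht
  rw [Matrix.det_fin_two] at hd
  have h11 : n 1 1 = - n 0 0 := by linear_combination ht
  by_cases hc : n 1 0 = 0
  · have h00 : n 0 0 = 0 := by
      rw [h11, hc] at hd
      have : n 0 0 ^ 2 = 0 := by linear_combination -hd
      exact pow_eq_zero_iff (by norm_num) |>.1 this
    refine ⟨none, n 0 1, ?_, ?_⟩
    · intro h01
      apply hn
      apply m2ext <;> simp [h00, h01, hc, h11]
    · apply m2ext <;> simp [np, h00, hc, h11]
  · refine ⟨some (n 0 0 / n 1 0), n 1 0, hc, ?_⟩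
    apply m2ext <;> simp [np]
    · field_simp
    · field_simp
      rw [h11] at hd
      linear_combination -hd
    · field_simp; exact h11

def lam : Option F → M2 F → F
  | none, x => x 0 0
  | some a, x => x 1 0 * a + x 1 1

lemma mul_np {p : Option F} {x : M2 F} (h : (x * np p).trace = 0) : x * np p = lam p x • np p := by
  cases p with
  | none =>
    simp [np, Matrix.trace_fin_two, Matrix.mul_apply, Fin.sum_univ_two] at h
    apply m2ext <;> simp [np, lam, Matrix.mul_apply, Fin.sum_univ_two, h]
  | some a =>
    simp [np, Matrix.trace_fin_two, Matrix.mul_apply, Fin.sum_univ_two] at h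
    apply m2ext <;> simp [np, lam, Matrix.mul_apply, Fin.sum_univ_two]
    · linear_combination h
    · linear_combination -a * h
    · ring

lemma lam_eq {p : Option F} {x : M2 F} (h : (x * np p).trace = 0) (hd : x.det = 1) :
    lam p x ^ 2 - x.trace * lam p x + 1 = 0 := by
  rw [Matrix.det_fin_two] at hd
  cases p with
  | none =>
    simp [np, Matrix.trace_fin_two, Matrix.mul_apply, Fin.sum_univ_two] at h
    simp [lam, Matrix.trace_fin_two]
    linear_combination -hd - x 0 1 * h
  | some a =>
    simp [np, Matrix.trace_fin_two, Matrix.mul_apply, Fin.sum_univ_two] at h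
    simp [lam, Matrix.trace_fin_two]
    linear_combination -hd - x 1 0 * h

lemma fix_unip {p : Option F} {x : M2 F} (h : x * np p = np p) (hd : x.det = 1) :
    ∃ s : F, x = 1 + s • np p := by
  rw [Matrix.det_fin_two] at hd
  cases p with
  | none =>
    have h1 := congrFun (congrFun h 0) 1
    have h2 := congrFun (congrFun h 1) 1
    simp [np, Matrix.mul_apply, Fin.sum_univ_two] at h1 h2
    refine ⟨x 0 1, ?_⟩
    rw [h1, h2] at hd
    apply m2ext <;> simp [np, h1, h2]
    linear_combination hd
  | some a =>
    have h1 := congrFun (congrFun h 0) 0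
    have h2 := congrFun (congrFun h 1) 0
    simp [np, Matrix.mul_apply, Fin.sum_univ_two] at h1 h2
    have e1 : x 0 1 = a - x 0 0 * a := by linear_combination h1
    have e2 : x 1 1 = 1 - x 1 0 * a := by linear_combination h2
    rw [e1, e2] at hd
    have e3 : x 0 0 = 1 + x 1 0 * a := by linear_combination hd
    refine ⟨x 1 0, ?_⟩
    apply m2ext <;> simp [np, e1, e2, e3] <;> ring

/-- a collinear triple in {det = 1, trace = t} -/
lemma coll {x m : M2 F} {s : F} (h0 : x.det = 1) (h1 : (x + m).det = 1) (h2 : (x + s • m).det = 1)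
    (hm : m.trace = 0) (hs0 : s ≠ 0) (hs1 : s ≠ 1) : m.det = 0 ∧ (x * m).trace = 0 := by
  simp only [Matrix.det_fin_two, Matrix.trace_fin_two, Matrix.add_apply, Matrix.smul_apply, smul_eq_mul,
    Matrix.mul_apply, Fin.sum_univ_two] at *
  set B := x 0 0 * m 1 1 + x 1 1 * m 0 0 - x 0 1 * m 1 0 - x 1 0 * m 0 1 with hB
  set D := m 0 0 * m 1 1 - m 0 1 * m 1 0 with hD
  have e1 : B + D = 0 := by rw [hB, hD]; linear_combination h1 - h0
  have e2 : s * (B + s * D) = 0 := by rw [hB, hD]; linear_combination h2 - h0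
  have e3 : B + s * D = 0 := (mul_eq_zero.1 e2).resolve_left hs0
  have e4 : (s - 1) * D = 0 := by linear_combination e3 - e1
  have e5 : D = 0 := (mul_eq_zero.1 e4).resolve_left (sub_ne_zero.2 hs1)
  refine ⟨e5, ?_⟩
  rw [e5] at e1
  have e6 : m 1 1 = - m 0 0 := by linear_combination hm
  rw [hB] at e1
  linear_combination -e1 + (x 0 0 + x 1 1) * hm

lemma coll_np {x m : M2 F} {s : F} (h0 : x.det = 1) (h1 : (x + m).det = 1) (h2 : (x + s • m).det = 1)
    (hm : m.trace = 0) (hs0 : s ≠ 0) (hs1 : s ≠ 1) (hm0 : m ≠ 0) :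
    ∃ p : Option F, ∃ c : F, c ≠ 0 ∧ m = c • np p ∧ (x * np p).trace = 0 := by
  obtain ⟨hd, ht⟩ := coll h0 h1 h2 hm hs0 hs1
  obtain ⟨p, c, hc, hmc⟩ := exists_np hm hd hm0
  refine ⟨p, c, hc, hmc, ?_⟩
  rw [hmc] at ht
  simp at ht
  exact ht.resolve_left hc

/-- at most two fixed points -/
lemma fix_le_two [Fintype F] [DecidableEq F] {x : M2 F} (hd : x.det = 1) (h2 : x.trace ≠ 2) (h2' : x.trace ≠ -2) :
    (univ.filter (fun p : Option F => (x * np p).trace = 0)).card ≤ 2 := by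
  by_contra hcon
  obtain ⟨p, hp, q, hq, r, hr, hpq, hpr, hqr⟩ := Finset.two_lt_card.1 (not_le.1 hcon)
  rw [Matrix.det_fin_two] at hd
  rw [Matrix.trace_fin_two] at h2 h2'
  simp only [Finset.mem_filter, Finset.mem_univ, true_and] at hp hq hr
  have key0 : x 1 0 = 0 → x 0 0 = x 1 1 → False := by
    intro h1 h3
    rw [h1, h3] at hd
    have : (x 1 1 - 1) * (x 1 1 + 1) = 0 := by linear_combination hd
    rcases mul_eq_zero.1 this with h | h
    · exact h2 (by rw [h3]; linear_combination 2 * h)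
    · exact h2' (by rw [h3]; linear_combination 2 * h)
  have key2 : ∀ a b : F, a ≠ b → (x * np none).trace = 0 → (x * np (some a)).trace = 0 → (x * np (some b)).trace = 0 → False := by
    intro a b hab h1 h3 h4
    simp [np, Matrix.trace_fin_two, Matrix.mul_apply, Fin.sum_univ_two] at h1 h3 h4
    apply key0 h1
    rw [h1] at h3 h4
    have : (a - b) * (x 0 0 - x 1 1) = 0 := by linear_combination h3 - h4
    exact sub_eq_zero.1 ((mul_eq_zero.1 this).resolve_left (sub_ne_zero.2 hab))
  have key3 : ∀ a b c : F, a ≠ b → a ≠ c → b ≠ c → (x * np (some a)).trace = 0 → (x * np (some b)).trace = 0 →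
      (x * np (some c)).trace = 0 → False := by
    intro a b c hab hac hbc h1 h3 h4
    simp [np, Matrix.trace_fin_two, Matrix.mul_apply, Fin.sum_univ_two] at h1 h3 h4
    have e1 : (a - b) * ((x 0 0 - x 1 1) - x 1 0 * (a + b)) = 0 := by linear_combination h1 - h3
    have e2 : (a - c) * ((x 0 0 - x 1 1) - x 1 0 * (a + c)) = 0 := by linear_combination h1 - h4
    have e3 := (mul_eq_zero.1 e1).resolve_left (sub_ne_zero.2 hab)
    have e4 := (mul_eq_zero.1 e2).resolve_left (sub_ne_zero.2 hac)
    have e5 : (b - c) * x 1 0 = 0 := by linear_combination e4 - e3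
    have e6 := (mul_eq_zero.1 e5).resolve_left (sub_ne_zero.2 hbc)
    apply key0 e6
    rw [e6] at e3; linear_combination e3
  cases p with
  | none =>
    cases q with
    | none => exact hpq rfl
    | some b => cases r with
      | none => exact hpr rfl
      | some c => exact key2 b c (fun h => hqr (by rw [h])) hp hq hr
  | some a =>
    cases q with
    | none => cases r with
      | none => exact hqr rfl
      | some c => exact key2 a c (fun h => hpr (by rw [h])) hq hp hr
    | some b => cases r with
      | none => exact key2 a b (fun h => hpq (by rw [h])) hr hp hq
      | some c => exact key3 a b c (fun h => hpq (by rw [h])) (fun h => hpr (by rw [h])) (fun h => hqr (by rw [h])) hp hq hr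

lemma cayley (x : M2 F) (hd : x.det = 1) : x * x = x.trace • x - 1 := by
  rw [Matrix.det_fin_two] at hd
  apply m2ext <;> simp [Matrix.mul_apply, Fin.sum_univ_two, Matrix.trace_fin_two]
  · linear_combination -hd
  · ring
  · ring
  · linear_combination -hd

lemma inv_coe (h : SL F) : ((h⁻¹ : SL F) : M2 F) = (h : M2 F).trace • (1 : M2 F) - (h : M2 F) := by
  rw [Matrix.SpecialLinearGroup.SL2_inv_expl]
  apply m2ext <;> simp [Matrix.trace_fin_two]

/-- D0. -/
lemma unip_count [DecidableEq F] (n : M2 F) (ht : n.trace = 0) (hd : n.det = 0) (Y : Finset (SL F))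
    (hY : ∀ y ∈ Y, ∃ s : F, (y : M2 F) = 1 + s • n) (h : SL F) (hh : ((h : M2 F) * n).trace ≠ 0)
    (Z : Finset (SL F)) (hZ : ∀ x ∈ Y, ∀ y ∈ Y, ∀ z ∈ Y, x * h * y * h⁻¹ * z ∈ Z) :
    Y.card * Y.card * (Y.card - 1) ≤ Z.card := by
  classical
  have hnn := sq_zero ht hd
  choose! s hs using hY
  have hsinj : ∀ x ∈ Y, ∀ y ∈ Y, s x = s y → x = y := by
    intro x hx y hy hxy
    apply Subtype.ext
    rw [hs x hx, hs y hy, hxy]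
  set hm : M2 F := (h : M2 F) with hhm
  set hi : M2 F := ((h⁻¹ : SL F) : M2 F) with hhi
  set τ : F := (hm * n).trace with hτ
  have t1 : n * hm * n = τ • n := rank1 n hm hd
  have t2 : n * hi * n = (-τ) • n := by
    rw [rank1 n hi hd]
    congr 1
    rw [hhi, inv_coe, sub_mul, Matrix.trace_sub]
    simp [ht, hτ, hhm]
  have hhh : hm * hi = 1 := by
    rw [hhm, hhi, ← Matrix.SpecialLinearGroup.coe_mul]; simp
  -- product
  have prod : ∀ x ∈ Y, ∀ y ∈ Y, ∀ z ∈ Y, ((x * h * y * h⁻¹ * z : SL F) : M2 F)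
      = (1 + s x • n) * (1 + s y • (hm * n * hi)) * (1 + s z • n) := by
    intro x hx y hy z hz
    simp only [Matrix.SpecialLinearGroup.coe_mul]
    rw [hs x hx, hs y hy, hs z hz, ← hhm, ← hhi]
    have : hm * (1 + s y • n) * hi = 1 + s y • (hm * n * hi) := by
      rw [mul_add, add_mul, mul_one, hhh, Matrix.mul_smul, Matrix.smul_mul]
    rw [← this]
    simp only [mul_assoc]
  set n' := hm * n * hi with hn'
  have tn : n * n' * n = (-τ^2) • n := by
    calc n * n' * n = (n * hm * n) * hi * n := by rw [hn']; simp only [mul_assoc]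
      _ = τ • (n * hi * n) := by rw [t1]; simp only [Matrix.smul_mul]
      _ = _ := by rw [t2, smul_smul]; congr 1; ring
  have hτ2 : -τ^2 ≠ 0 := neg_ne_zero.2 (pow_ne_zero 2 hh)
  have hn0 : n ≠ 0 := by
    rintro rfl; apply hh; simp [hτ]
  have pn : ∀ a b c : F, n * ((1 + a • n) * (1 + b • n') * (1 + c • n)) * n = (b * (-τ^2)) • n := by
    intro a b c
    have e1 : n * (1 + a • n) = n := by rw [mul_add, Matrix.mul_smul, hnn]; simp
    have e2 : (1 + c • n) * n = n := by rw [add_mul, Matrix.smul_mul, hnn]; simp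
    calc _ = (n * (1 + a • n)) * (1 + b • n') * ((1 + c • n) * n) := by simp only [mul_assoc]
      _ = n * (1 + b • n') * n := by rw [e1, e2]
      _ = _ := by rw [mul_add, add_mul, mul_one, hnn, Matrix.mul_smul, Matrix.smul_mul, tn, zero_add, smul_smul]
  have pr : ∀ a b c : F, ((1 + a • n) * (1 + b • n') * (1 + c • n)) * n = n + b • (n' * n) + (a * (b * (-τ^2))) • n := by
    intro a b c
    have e2 : (1 + c • n) * n = n := by rw [add_mul, Matrix.smul_mul, hnn]; simp
    calc _ = (1 + a • n) * ((1 + b • n') * ((1 + c • n) * n)) := by simp only [mul_assoc]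
      _ = (1 + a • n) * ((1 + b • n') * n) := by rw [e2]
      _ = _ := by
        have : n * (n' * n) = (-τ^2) • n := by rw [← mul_assoc, tn]
        simp only [add_mul, mul_add, one_mul, Matrix.smul_mul, Matrix.mul_smul, hnn, this, smul_zero, add_zero, smul_smul]
        rw [mul_left_comm b a, add_assoc]
  have pl : ∀ a b c : F, n * ((1 + a • n) * (1 + b • n') * (1 + c • n)) = n + b • (n * n') + (c * (b * (-τ^2))) • n := by
    intro a b c
    have e1 : n * (1 + a • n) = n := by rw [mul_add, Matrix.mul_smul, hnn]; simp
    calc _ = (n * (1 + a • n)) * (1 + b • n') * (1 + c • n) := by simp only [mul_assoc]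
      _ = n * (1 + b • n') * (1 + c • n) := by rw [e1]
      _ = _ := by
        simp only [add_mul, mul_add, mul_one, Matrix.smul_mul, Matrix.mul_smul, hnn, tn, smul_zero, zero_add, smul_smul]
  have smul_inj : ∀ a b : F, a • n = b • n → a = b := by
    intro a b hab
    have : (a - b) • n = 0 := by rw [sub_smul, hab, sub_self]
    exact sub_eq_zero.1 ((smul_eq_zero.1 this).resolve_right hn0)
  set Y' := Y.erase 1 with hY'
  have hcard : Y.card - 1 ≤ Y'.card := Finset.pred_card_le_card_erase
  have main : (Y ×ˢ Y' ×ˢ Y).card ≤ Z.card := by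
    apply Finset.card_le_card_of_injOn (fun t => t.1 * h * t.2.1 * h⁻¹ * t.2.2)
    · rintro ⟨x, y, z⟩ hp
      simp only [Finset.coe_product, Set.mem_prod, Finset.mem_coe] at hp
      exact hZ x hp.1 y (Finset.mem_of_mem_erase hp.2.1) z hp.2.2
    · rintro ⟨x, y, z⟩ hp ⟨x', y', z'⟩ hp' heq
      simp only [Finset.coe_product, Set.mem_prod, Finset.mem_coe] at hp hp'
      simp only at heq
      have hy := Finset.mem_of_mem_erase hp.2.1
      have hy' := Finset.mem_of_mem_erase hp'.2.1
      have e : (1 + s x • n) * (1 + s y • n') * (1 + s z • n) = (1 + s x' • n) * (1 + s y' • n') * (1 + s z' • n) := by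
        rw [← prod x hp.1 y hy z hp.2.2, ← prod x' hp'.1 y' hy' z' hp'.2.2, heq]
      have ey : s y = s y' := by
        have := pn (s x) (s y) (s z)
        rw [e, pn] at this
        exact (mul_right_cancel₀ hτ2 (smul_inj _ _ this)).symm
      have hsy : s y * (-τ^2) ≠ 0 := by
        apply mul_ne_zero _ hτ2
        intro h0
        apply Finset.ne_of_mem_erase hp.2.1
        apply Subtype.ext
        rw [hs y hy, h0]; simp
      have ex : s x = s x' := by
        have := pr (s x) (s y) (s z)
        rw [e, pr, ← ey] at this
        have := add_left_cancel this
        exact (mul_right_cancel₀ hsy (smul_inj _ _ this)).symm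
      have ez : s z = s z' := by
        have := pl (s x) (s y) (s z)
        rw [e, pl, ← ey] at this
        have := add_left_cancel this
        exact (mul_right_cancel₀ hsy (smul_inj _ _ this)).symm
      rw [hsinj x hp.1 x' hp'.1 ex, hsinj y hy y' hy' ey, hsinj z hp.2.2 z' hp'.2.2 ez]
  rw [Finset.card_product, Finset.card_product] at main
  calc Y.card * Y.card * (Y.card - 1) ≤ Y.card * Y.card * Y'.card := Nat.mul_le_mul_left _ hcard
    _ = Y.card * (Y'.card * Y.card) := by ring
    _ ≤ _ := main

end IUC
end

section
open Finset
open scoped Pointwise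
set_option maxHeartbeats 2000000
set_option linter.unusedSectionVars false
namespace IUC
variable {F : Type*} [Field F]

lemma lin3 {ι : Type*} [Fintype ι] (hι : Fintype.card ι = 4) (v : Fin 3 → (ι → F)) (m m' : ι → F) (hm : m ≠ 0)
    (h : ∀ i, v i ⬝ᵥ m = 0) (h' : ∀ i, v i ⬝ᵥ m' = 0) :
    (∃ s : F, m' = s • m) ∨ ∃ c : Fin 3 → F, (∃ i, c i ≠ 0) ∧ ∑ i, c i • v i = 0 := by
  classical
  by_cases hv : LinearIndependent F v
  · left
    set A : Matrix (Fin 3) ι F := Matrix.of v with hA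
    have hr : A.rank = 3 := by
      have : LinearIndependent F A.row := hv
      simpa using this.rank_matrix
    have hk := A.mulVecLin.finrank_range_add_finrank_ker
    have hr' : Module.finrank F (LinearMap.range A.mulVecLin) = 3 := hr
    rw [hr'] at hk
    simp [hι] at hk
    have hk1 : Module.finrank F (LinearMap.ker A.mulVecLin) = 1 := by omega
    have memk : ∀ w : ι → F, (∀ i, v i ⬝ᵥ w = 0) → w ∈ LinearMap.ker A.mulVecLin := by
      intro w hw
      rw [LinearMap.mem_ker]
      ext i
      exact hw i
    have hm1 : (⟨m, memk m h⟩ : LinearMap.ker A.mulVecLin) ≠ 0 := by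
      intro h0; exact hm (congrArg Subtype.val h0)
    obtain ⟨s, hs⟩ := (finrank_eq_one_iff_of_nonzero' _ hm1).1 hk1 ⟨m', memk m' h'⟩
    exact ⟨s, (congrArg Subtype.val hs).symm⟩
  · right
    rw [Fintype.not_linearIndependent_iff] at hv
    obtain ⟨c, h1, h2⟩ := hv
    exact ⟨c, h2, h1⟩

lemma lin3M (y : Fin 3 → M2 F) (m m' : M2 F) (hm : m ≠ 0)
    (h : ∀ i, (y i * m).trace = 0) (h' : ∀ i, (y i * m').trace = 0) :
    (∃ s : F, m' = s • m) ∨ ∃ c : Fin 3 → F, (∃ i, c i ≠ 0) ∧ ∑ i, c i • y i = 0 := by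
  have key : ∀ (y m : M2 F), (fun p : Fin 2 × Fin 2 => y p.2 p.1) ⬝ᵥ (fun p : Fin 2 × Fin 2 => m p.1 p.2) = (y * m).trace := by
    intro y m
    simp [dotProduct, Fintype.sum_prod_type, Fin.sum_univ_two, Matrix.trace_fin_two, Matrix.mul_apply]
    ring
  rcases lin3 (F := F) (ι := Fin 2 × Fin 2) (by simp) (fun i p => y i p.2 p.1) (fun p => m p.1 p.2) (fun p => m' p.1 p.2)
    (by
      intro h0; apply hm
      ext i j; exact congrFun h0 (i, j))
    (fun i => by rw [key]; exact h i) (fun i => by rw [key]; exact h' i) with ⟨s, hs⟩ | ⟨c, hc, hs⟩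
  · left
    refine ⟨s, ?_⟩
    ext i j
    exact congrFun hs (i, j)
  · right
    refine ⟨c, hc, ?_⟩
    ext i j
    have := congrFun hs (j, i)
    simpa [Finset.sum_apply, Matrix.sum_apply] using this

lemma quad_card [Fintype F] [DecidableEq F] (t u : F) : (univ.filter (fun l : F => l ^ 2 - t * l + u = 0)).card ≤ 2 := by
  by_contra hcon
  obtain ⟨p, hp, q, hq, r, hr, hpq, hpr, hqr⟩ := Finset.two_lt_card.1 (not_le.1 hcon)
  simp only [Finset.mem_filter, Finset.mem_univ, true_and] at hp hq hr
  have e1 : (p - q) * (p + q - t) = 0 := by linear_combination hp - hq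
  have e2 : (p - r) * (p + r - t) = 0 := by linear_combination hp - hr
  have e3 := (mul_eq_zero.1 e1).resolve_left (sub_ne_zero.2 hpq)
  have e4 := (mul_eq_zero.1 e2).resolve_left (sub_ne_zero.2 hpr)
  exact hqr (by linear_combination e3 - e4)

lemma common_np {t : F} (ht0 : t ≠ 0) (g k : M2 F) (x x' x'' : SL F)
    (hx : (x : M2 F).trace = t) (hx' : (x' : M2 F).trace = t) (hx'' : (x'' : M2 F).trace = t)
    (hg : (g * x : M2 F).trace = t) (hg' : (g * x' : M2 F).trace = t) (hg'' : (g * x'' : M2 F).trace = t)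
    (hk : (k * x : M2 F).trace = t) (hk' : (k * x' : M2 F).trace = t) (hk'' : (k * x'' : M2 F).trace = t)
    (hgd : g.det = 1) (hkd : k.det = 1)
    (h1 : x ≠ x') (h2 : x ≠ x'') (h3 : x' ≠ x'') (d1 : (x : M2 F) ≠ g * x) (d2 : (x : M2 F) ≠ k * x) (d3 : g * (x : M2 F) ≠ k * x) :
    ∃ p : Option F, ((x : M2 F) * np p).trace = 0 ∧ (g * (x : M2 F) * np p).trace = 0 ∧ (k * (x : M2 F) * np p).trace = 0 := by
  have xd : (x : M2 F).det = 1 := x.2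
  have xd' : (x' : M2 F).det = 1 := x'.2
  have xd'' : (x'' : M2 F).det = 1 := x''.2
  have hm0 : (x' : M2 F) - x ≠ 0 := fun h => h1 (Subtype.ext (sub_eq_zero.1 h)).symm
  rcases lin3M ![1, g, k] ((x' : M2 F) - x) ((x'' : M2 F) - x) hm0
    (by intro i; fin_cases i <;> simp [mul_sub, Matrix.trace_sub, *])
    (by intro i; fin_cases i <;> simp [mul_sub, Matrix.trace_sub, *]) with ⟨s, hs⟩ | ⟨c, ⟨i, hi⟩, hs⟩
  · have hs0 : s ≠ 0 := by
      rintro rfl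
      rw [zero_smul] at hs
      exact h2 (Subtype.ext (sub_eq_zero.1 hs)).symm
    have hs1 : s ≠ 1 := by
      rintro rfl
      rw [one_smul] at hs
      exact h3 (Subtype.ext (sub_left_injective hs)).symm
    obtain ⟨p, c, hc, hmc, hp⟩ := coll_np (x := (x : M2 F)) (m := (x' : M2 F) - x) (s := s) xd
      (by simpa using xd') (by rw [← hs]; simpa using xd'') (by simp [Matrix.trace_sub, hx, hx']) hs0 hs1 hm0
    have gn : (g * np p).trace = 0 := by
      have : (g * ((x' : M2 F) - x)).trace = 0 := by simp [mul_sub, Matrix.trace_sub, hg, hg']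
      rw [hmc] at this
      simp at this
      exact this.resolve_left hc
    have kn : (k * np p).trace = 0 := by
      have : (k * ((x' : M2 F) - x)).trace = 0 := by simp [mul_sub, Matrix.trace_sub, hk, hk']
      rw [hmc] at this
      simp at this
      exact this.resolve_left hc
    refine ⟨p, hp, ?_, ?_⟩
    · rw [mul_assoc, mul_np hp]; simp [gn]
    · rw [mul_assoc, mul_np hp]; simp [kn]
  · simp only [Fin.sum_univ_three, Matrix.cons_val_zero, Matrix.cons_val_one, Matrix.cons_val_two] at hs
    have hs' : c 0 • (1 : M2 F) + c 1 • g + c 2 • k = 0 := hs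
    have hmul : c 0 • (x : M2 F) + c 1 • (g * x) + c 2 • (k * x) = 0 := by
      have := congrArg (fun y => y * (x : M2 F)) hs'
      simpa [add_mul] using this
    have hsum : c 0 + c 1 + c 2 = 0 := by
      have := congrArg Matrix.trace hmul
      simp [Matrix.trace_add, Matrix.trace_smul, hx, hg, hk] at this
      have h4 : (c 0 + c 1 + c 2) * t = 0 := by linear_combination this
      exact (mul_eq_zero.1 h4).resolve_right ht0
    have hc0 : c 0 = - c 1 - c 2 := by linear_combination hsum
    have hlin : c 1 • (g * x - x : M2 F) + c 2 • (k * x - x : M2 F) = 0 := by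
      rw [hc0] at hmul
      rw [← hmul, smul_sub, smul_sub, sub_smul, neg_smul]; abel
    have hc2 : c 2 ≠ 0 := by
      intro h0
      rw [h0, zero_smul, add_zero] at hlin
      rcases smul_eq_zero.1 hlin with h5 | h5
      · have : c 0 = 0 := by rw [hc0, h5, h0]; simp
        fin_cases i <;> simp_all
      · exact d1 (sub_eq_zero.1 h5).symm
    set s : F := - c 1 / c 2 with hsdef
    have hks : k * (x : M2 F) - x = s • (g * x - x) := by
      have : c 2 • (k * (x : M2 F) - x) = c 2 • (s • (g * x - x)) := by
        rw [smul_smul, hsdef, mul_div_cancel₀ _ hc2, neg_smul]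
        exact eq_neg_of_add_eq_zero_right hlin
      exact smul_right_injective _ hc2 this
    have hs0 : s ≠ 0 := by
      intro h; rw [h, zero_smul] at hks; exact d2 (sub_eq_zero.1 hks).symm
    have hs1 : s ≠ 1 := by
      intro h; rw [h, one_smul] at hks; exact d3 (sub_left_injective hks).symm
    have hm1 : g * (x : M2 F) - x ≠ 0 := fun h => d1 (sub_eq_zero.1 h).symm
    obtain ⟨p, c', hc', hmc, hp⟩ := coll_np (x := (x : M2 F)) (m := g * (x : M2 F) - x) (s := s) xd
      (by simp [hgd]) (by rw [← hks]; simp [hkd]) (by simp [Matrix.trace_sub, hx, hg]) hs0 hs1 hm1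
    have e1 : g * (x : M2 F) = x + c' • np p := by rw [← hmc]; simp
    have e2 : k * (x : M2 F) = x + (s * c') • np p := by rw [mul_smul, ← hmc, ← hks]; simp
    have nn : np p * np p = 0 := sq_zero (np_trace p) (np_det p)
    refine ⟨p, hp, ?_, ?_⟩
    · rw [e1, add_mul]; simp [hp, nn]
    · rw [e2, add_mul]; simp [hp, nn]

variable [Fintype F] [DecidableEq F]

lemma fix_class_card (t : F) (X W : Finset (SL F)) (hX : ∀ x ∈ X, (x : M2 F).trace = t)
    (hW : ∀ x ∈ X, ∀ y ∈ X, x⁻¹ * y ∈ W) (p : Option F) (l : ℕ)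
    (hl : ∀ U ⊆ W, (∀ u ∈ U, ∃ s : F, (u : M2 F) = 1 + s • np p) → U.card ≤ l) :
    (X.filter (fun x : SL F => ((x : M2 F) * np p).trace = 0)).card ≤ 2 * l := by
  classical
  set Xp := X.filter (fun x : SL F => ((x : M2 F) * np p).trace = 0) with hXp
  have h1 : Xp.card ≤ l * (Xp.image (fun x : SL F => lam p (x : M2 F))).card := by
    apply Finset.card_le_mul_card_image
    intro b hb
    obtain ⟨x0, hx0, hx0b⟩ := Finset.mem_image.1 hb
    have hx0' := Finset.mem_filter.1 hx0
    rw [← Finset.card_image_of_injective _ (mul_right_injective x0⁻¹)]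
    apply hl
    · intro u hu
      obtain ⟨y, hy, rfl⟩ := Finset.mem_image.1 hu
      exact hW x0 hx0'.1 y (Finset.mem_filter.1 (Finset.mem_filter.1 hy).1).1
    · intro u hu
      obtain ⟨y, hy, rfl⟩ := Finset.mem_image.1 hu
      obtain ⟨hy1, hyb⟩ := Finset.mem_filter.1 hy
      have hy2 := Finset.mem_filter.1 hy1
      apply fix_unip _ (x0⁻¹ * y).2
      have e1 : (x0 : M2 F) * np p = b • np p := by rw [mul_np hx0'.2, hx0b]
      have e2 : (y : M2 F) * np p = b • np p := by rw [mul_np hy2.2, hyb]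
      show ((x0⁻¹ * y : SL F) : M2 F) * np p = np p
      rw [Matrix.SpecialLinearGroup.coe_mul, mul_assoc, e2, ← e1, ← mul_assoc, ← Matrix.SpecialLinearGroup.coe_mul]
      simp
  have h2 : (Xp.image (fun x : SL F => lam p (x : M2 F))).card ≤ 2 := by
    refine le_trans (Finset.card_le_card ?_) (quad_card t 1)
    intro b hb
    obtain ⟨x0, hx0, hx0b⟩ := Finset.mem_image.1 hb
    have hx0' := Finset.mem_filter.1 hx0
    simp only [Finset.mem_filter, Finset.mem_univ, true_and]
    rw [← hx0b, ← hX x0 hx0'.1]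
    exact lam_eq hx0'.2 x0.2
  calc Xp.card ≤ _ := h1
    _ ≤ l * 2 := Nat.mul_le_mul_left _ h2
    _ = _ := by ring

/-- D1. -/
lemma trace_count (t : F) (ht0 : t ≠ 0) (ht2 : t ≠ 2) (ht2' : t ≠ -2) (X W : Finset (SL F))
    (hX : ∀ x ∈ X, (x : M2 F).trace = t)
    (hW : ∀ x ∈ X, ∀ y ∈ X, x⁻¹ * y ∈ W) (hW' : ∀ x ∈ X, ∀ y ∈ X, x * y⁻¹ ∈ W) (l : ℕ)
    (hl : ∀ p : Option F, ∀ U ⊆ W, (∀ u ∈ U, ∃ s : F, (u : M2 F) = 1 + s • np p) → U.card ≤ l) :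
    X.card ^ 3 ≤ 3 * X.card ^ 2 + 8 * l ^ 2 * X.card + 2 * W.card ^ 2 := by
  classical
  set Xp : Option F → Finset (SL F) := fun p => X.filter (fun x : SL F => ((x : M2 F) * np p).trace = 0) with hXp
  have hXpc : ∀ p, (Xp p).card ≤ 2 * l := fun p => fix_class_card t X W hX hW p l (hl p)
  have hsum : ∑ p, (Xp p).card ≤ 2 * X.card := by
    simp only [hXp, Finset.card_filter]
    rw [Finset.sum_comm]
    simp only [← Finset.card_filter]
    calc _ ≤ ∑ x ∈ X, 2 := Finset.sum_le_sum (fun x hx => fix_le_two x.2 (by rw [hX x hx]; exact ht2) (by rw [hX x hx]; exact ht2'))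
      _ = _ := by simp [mul_comm]
  set T := X ×ˢ X ×ˢ X with hT
  set T1 := T.filter (fun a => a.1 = a.2.1) with hT1
  set T2 := T.filter (fun a => a.1 = a.2.2) with hT2
  set T3 := T.filter (fun a => a.2.1 = a.2.2) with hT3
  set T4 := univ.biUnion (fun p => Xp p ×ˢ Xp p ×ˢ Xp p) with hT4
  set T5 := T.filter (fun a => a.1 ≠ a.2.1 ∧ a.1 ≠ a.2.2 ∧ a.2.1 ≠ a.2.2 ∧ a ∉ T4) with hT5
  have hcov : T ⊆ T1 ∪ T2 ∪ T3 ∪ T4 ∪ T5 := by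
    intro a ha
    simp only [Finset.mem_union, hT1, hT2, hT3, hT5, Finset.mem_filter]
    tauto
  have c1 : T1.card ≤ X.card ^ 2 := by
    rw [sq, ← Finset.card_product]
    apply Finset.card_le_card_of_injOn (fun a => a.2)
    · intro a ha
      simp only [hT1, hT, Finset.coe_filter, Set.mem_ofPred_eq, Finset.mem_product] at ha
      simp [ha]
    · rintro ⟨a, b, c⟩ ha ⟨a', b', c'⟩ ha' h
      simp only [hT1, hT, Finset.coe_filter, Set.mem_ofPred_eq] at ha ha'
      simp at h
      simp [ha.2, ha'.2, h]
  have c2 : T2.card ≤ X.card ^ 2 := by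
    rw [sq, ← Finset.card_product]
    apply Finset.card_le_card_of_injOn (fun a => a.2)
    · intro a ha
      simp only [hT2, hT, Finset.coe_filter, Set.mem_ofPred_eq, Finset.mem_product] at ha
      simp [ha]
    · rintro ⟨a, b, c⟩ ha ⟨a', b', c'⟩ ha' h
      simp only [hT2, hT, Finset.coe_filter, Set.mem_ofPred_eq] at ha ha'
      simp at h
      simp [ha.2, ha'.2, h]
  have c3 : T3.card ≤ X.card ^ 2 := by
    rw [sq, ← Finset.card_product]
    apply Finset.card_le_card_of_injOn (fun a => (a.1, a.2.1))
    · intro a ha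
      simp only [hT3, hT, Finset.coe_filter, Set.mem_ofPred_eq, Finset.mem_product] at ha
      simp [ha]
    · rintro ⟨a, b, c⟩ ha ⟨a', b', c'⟩ ha' h
      simp only [hT3, hT, Finset.coe_filter, Set.mem_ofPred_eq] at ha ha'
      simp at h
      simp [← ha.2, ← ha'.2, h]
  have c4 : T4.card ≤ 8 * l ^ 2 * X.card := by
    calc T4.card ≤ ∑ p, (Xp p ×ˢ Xp p ×ˢ Xp p).card := Finset.card_biUnion_le
      _ = ∑ p, (Xp p).card * ((Xp p).card * (Xp p).card) := by simp only [Finset.card_product]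
      _ ≤ ∑ p, (Xp p).card * ((2 * l) * (2 * l)) := by
        apply Finset.sum_le_sum; intro p _
        exact Nat.mul_le_mul_left _ (Nat.mul_le_mul (hXpc p) (hXpc p))
      _ = (∑ p, (Xp p).card) * ((2 * l) * (2 * l)) := by rw [Finset.sum_mul]
      _ ≤ (2 * X.card) * ((2 * l) * (2 * l)) := Nat.mul_le_mul_right _ hsum
      _ = _ := by ring
  have c5 : T5.card ≤ 2 * W.card ^ 2 := by
    set φ : SL F × SL F × SL F → SL F × SL F := fun a => (a.1 * a.2.1⁻¹, a.2.1 * a.2.2⁻¹) with hφ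
    have h1 : T5.card ≤ 2 * (T5.image φ).card := by
      apply Finset.card_le_mul_card_image
      intro b hb
      by_contra hcon
      obtain ⟨p, hp, q, hq, r, hr, hpq, hpr, hqr⟩ := Finset.two_lt_card.1 (not_le.1 hcon)
      obtain ⟨x1, x2, x3⟩ := p
      obtain ⟨y1, y2, y3⟩ := q
      obtain ⟨z1, z2, z3⟩ := r
      simp only [hT5, hT, hφ, Finset.mem_filter, Finset.mem_product] at hp hq hr
      obtain ⟨⟨⟨hx1, hx2, hx3⟩, hx12, hx13, hx23, hx4⟩, hxb⟩ := hp
      obtain ⟨⟨⟨hy1, hy2, hy3⟩, -⟩, hyb⟩ := hq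
      obtain ⟨⟨⟨hz1, hz2, hz3⟩, -⟩, hzb⟩ := hr
      obtain ⟨b1, b2⟩ := b
      simp only [Prod.mk.injEq] at hxb hyb hzb
      have sol : ∀ a1 a2 a3 : SL F, a1 * a2⁻¹ = b1 ∧ a2 * a3⁻¹ = b2 → a2 = b1⁻¹ * a1 ∧ a3 = (b2⁻¹ * b1⁻¹) * a1 := by
        rintro a1 a2 a3 ⟨rfl, rfl⟩
        constructor <;> group
      obtain ⟨ex2, ex3⟩ := sol _ _ _ hxb
      obtain ⟨ey2, ey3⟩ := sol _ _ _ hyb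
      obtain ⟨ez2, ez3⟩ := sol _ _ _ hzb
      set g := b1⁻¹
      set k := b2⁻¹ * b1⁻¹
      have nxy : x1 ≠ y1 := by
        intro h; apply hpq; rw [ex2, ex3, ey2, ey3, h]
      have nxz : x1 ≠ z1 := by
        intro h; apply hpr; rw [ex2, ex3, ez2, ez3, h]
      have nyz : y1 ≠ z1 := by
        intro h; apply hqr; rw [ey2, ey3, ez2, ez3, h]
      have cm := fun a b : SL F => (Matrix.SpecialLinearGroup.coe_mul a b).symm
      obtain ⟨p, p1, p2, p3⟩ := common_np ht0 (g : M2 F) (k : M2 F) x1 y1 z1 (hX _ hx1) (hX _ hy1) (hX _ hz1)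
        (by rw [cm, ← ex2]; exact hX _ hx2) (by rw [cm, ← ey2]; exact hX _ hy2) (by rw [cm, ← ez2]; exact hX _ hz2)
        (by rw [cm, ← ex3]; exact hX _ hx3) (by rw [cm, ← ey3]; exact hX _ hy3) (by rw [cm, ← ez3]; exact hX _ hz3)
        g.2 k.2 nxy nxz nyz (by rw [cm, ← ex2]; exact fun h => hx12 (Subtype.ext h))
        (by rw [cm, ← ex3]; exact fun h => hx13 (Subtype.ext h))
        (by rw [cm, cm, ← ex3, ← ex2]; exact fun h => hx23 (Subtype.ext h))
      apply hx4
      rw [cm, ← ex2] at p2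
      rw [cm, ← ex3] at p3
      simp only [hT4, hXp, Finset.mem_biUnion, Finset.mem_product, Finset.mem_filter, Finset.mem_univ, true_and]
      exact ⟨p, ⟨hx1, p1⟩, ⟨hx2, p2⟩, ⟨hx3, p3⟩⟩
    have h2 : (T5.image φ).card ≤ W.card ^ 2 := by
      rw [sq, ← Finset.card_product]
      apply Finset.card_le_card
      intro b hb
      obtain ⟨⟨x1, x2, x3⟩, ha, rfl⟩ := Finset.mem_image.1 hb
      simp only [hT5, hT, Finset.mem_filter, Finset.mem_product] at ha
      simp only [hφ, Finset.mem_product]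
      exact ⟨hW' _ ha.1.1 _ ha.1.2.1, hW' _ ha.1.2.1 _ ha.1.2.2⟩
    exact h1.trans (Nat.mul_le_mul_left _ h2)
  have : T.card = X.card ^ 3 := by rw [hT, Finset.card_product, Finset.card_product]; ring
  rw [← this]
  calc T.card ≤ _ := Finset.card_le_card hcov
    _ ≤ T1.card + T2.card + T3.card + T4.card + T5.card := by
      refine (Finset.card_union_le _ _).trans ?_
      gcongr
      refine (Finset.card_union_le _ _).trans ?_
      gcongr
      refine (Finset.card_union_le _ _).trans ?_
      gcongr
      exact Finset.card_union_le _ _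
    _ ≤ _ := by omega

end IUC
end

section
open Finset
open scoped Pointwise
set_option maxHeartbeats 2000000
set_option linter.unusedSectionVars false
namespace IUC
variable {F : Type*} [Field F] [DecidableEq F]

lemma pw_mono {G : Type*} [Group G] [DecidableEq G] {H : Finset G} (h1 : (1 : G) ∈ H) {m n : ℕ} (h : m ≤ n) :
    H ^ m ⊆ H ^ n := Finset.pow_subset_pow_right h1 h

lemma pw_mul {G : Type*} [Group G] [DecidableEq G] {H : Finset G} {m n : ℕ} {x y : G} (hx : x ∈ H ^ m) (hy : y ∈ H ^ n) :
    x * y ∈ H ^ (m + n) := by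
  rw [pow_add]; exact Finset.mul_mem_mul hx hy

lemma pw_inv {G : Type*} [Group G] [DecidableEq G] {H : Finset G} (hs : ∀ x ∈ H, x⁻¹ ∈ H) (n : ℕ) {x : G} (hx : x ∈ H ^ n) :
    x⁻¹ ∈ H ^ n := by
  induction n generalizing x with
  | zero => simp at hx ⊢; exact hx
  | succ n ih =>
    rw [pow_succ] at hx
    obtain ⟨a, ha, b, hb, rfl⟩ := Finset.mem_mul.1 hx
    rw [mul_inv_rev, pow_succ']
    exact Finset.mul_mem_mul (hs b hb) (ih ha)

lemma det_sub_one (x : M2 F) (hd : x.det = 1) : (x - 1).det = 2 - x.trace := by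
  rw [Matrix.det_fin_two] at *
  simp [Matrix.trace_fin_two]
  linear_combination hd

lemma anti (a b : M2 F) (ha : a.trace = 0) (hb : b.trace = 0) (hab : (a * b).trace = 0) : a * b = - (b * a) := by
  rw [Matrix.trace_fin_two] at ha hb hab
  simp only [Matrix.mul_apply, Fin.sum_univ_two] at hab
  apply m2ext <;> simp only [Matrix.mul_apply, Fin.sum_univ_two, Matrix.neg_apply]
  · linear_combination hab + (b 0 0 ) * ha - a 1 1 * hb
  · linear_combination (b 0 1) * ha + a 0 1 * hb
  · linear_combination (b 1 0) * ha + a 1 0 * hb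
  · linear_combination hab + (b 1 1 ) * ha - a 0 0 * hb

lemma start_lemma (h2 : (2 : F) ≠ 0) (h3 : (3 : F) ≠ 0) (H : Finset (SL F)) (h1 : 1 ∈ H)
    (hc : 9 ≤ H.card) (hfix : ∀ p : Option F, ∃ h ∈ H, ((h : M2 F) * np p).trace ≠ 0) :
    ∃ g ∈ H ^ 19, (g : M2 F).trace ≠ 0 ∧ (g : M2 F).trace ≠ 2 ∧ (g : M2 F).trace ≠ -2 := by
  by_contra hcon
  push Not at hcon
  have cub : ∀ g ∈ H ^ 19, (g : M2 F).trace ^ 3 - 4 * (g : M2 F).trace = 0 := by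
    intro g hg
    by_cases e0 : (g : M2 F).trace = 0
    · rw [e0]; ring
    by_cases e1 : (g : M2 F).trace = 2
    · rw [e1]; ring
    · rw [hcon g hg e0 e1]; ring
  -- no unipotents
  have U : ∀ u ∈ H ^ 6, (u : M2 F).trace = 2 → (u : M2 F) = 1 := by
    intro u hu ht
    by_contra hne
    set n : M2 F := (u : M2 F) - 1 with hn
    have hn0 : n ≠ 0 := sub_ne_zero.2 hne
    have hnt : n.trace = 0 := by simp [hn, Matrix.trace_sub, ht]
    have hnd : n.det = 0 := by rw [hn, det_sub_one _ u.2, ht]; ring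
    have hnn : n * n = 0 := sq_zero hnt hnd
    obtain ⟨p, c, hc0, hnp⟩ := exists_np hnt hnd hn0
    obtain ⟨g, hg, hgp⟩ := hfix p
    have hgn : ((g : M2 F) * n).trace ≠ 0 := by
      rw [hnp]; simp [hc0, hgp]
    have hu1 : (u : M2 F) = 1 + n := by simp [hn]
    have hu2 : ((u : M2 F) * u) = 1 + 2 * n := by
      rw [hu1, add_mul, mul_add, mul_add, hnn]; simp; noncomm_ring
    have hu3 : ((u : M2 F) * u * u) = 1 + 3 * n := by
      rw [hu2, hu1]
      have : (1 + 2 * n) * (1 + n) = 1 + 3 * n + 2 * (n * n) := by noncomm_ring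
      rw [this, hnn]; simp
    have hg1 : g ∈ H ^ 1 := by simpa using hg
    have m0 := cub g (pw_mono h1 (by norm_num) hg1)
    have m1 := cub (g * u) (pw_mono h1 (by norm_num) (pw_mul hg1 hu))
    have m2 := cub (g * (u * u)) (pw_mono h1 (by norm_num) (pw_mul hg1 (pw_mul hu hu)))
    have m3 := cub (g * (u * u * u)) (pw_mono h1 (by norm_num) (pw_mul hg1 (pw_mul (pw_mul hu hu) hu)))
    rw [Matrix.SpecialLinearGroup.coe_mul] at m1 m2 m3
    rw [Matrix.SpecialLinearGroup.coe_mul, hu2] at m2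
    rw [Matrix.SpecialLinearGroup.coe_mul, Matrix.SpecialLinearGroup.coe_mul, hu3] at m3
    rw [hu1] at m1
    have t1 : ((g : M2 F) * (1 + n)).trace = (g : M2 F).trace + ((g : M2 F) * n).trace := by
      rw [mul_add, Matrix.trace_add, mul_one]
    have t2 : ((g : M2 F) * (1 + 2 * n)).trace = (g : M2 F).trace + 2 * ((g : M2 F) * n).trace := by
      rw [two_mul, mul_add, mul_add, Matrix.trace_add, Matrix.trace_add, mul_one]; ring
    have t3 : ((g : M2 F) * (1 + 3 * n)).trace = (g : M2 F).trace + 3 * ((g : M2 F) * n).trace := by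
      have : (3 : M2 F) * n = n + n + n := by noncomm_ring
      rw [this, mul_add, mul_add, mul_add, Matrix.trace_add, Matrix.trace_add, Matrix.trace_add, mul_one]; ring
    rw [t1] at m1; rw [t2] at m2; rw [t3] at m3
    have : 2 * 3 * ((g : M2 F) * n).trace ^ 3 = 0 := by linear_combination m3 - 3 * m2 + 3 * m1 - m0
    simp [h2, h3, hgn] at this
  have U' : ∀ u ∈ H ^ 3, (u : M2 F) ≠ 1 → (u : M2 F) ≠ -1 → (u : M2 F).trace = 0 := by
    intro u hu n1 n2
    by_contra e0
    by_cases e1 : (u : M2 F).trace = 2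
    · exact n1 (U u (pw_mono h1 (by norm_num) hu) e1)
    have e2 := hcon u (pw_mono h1 (by norm_num) hu) e0 e1
    have hsq : ((u * u : SL F) : M2 F) = (-2 : F) • (u : M2 F) - 1 := by
      rw [Matrix.SpecialLinearGroup.coe_mul, cayley _ u.2, e2]
    have h4 := U (u * u) (pw_mul hu hu) (by
      rw [hsq, Matrix.trace_sub, Matrix.trace_smul, e2]; simp; norm_num)
    rw [hsq] at h4
    apply n2
    have h5 : (-2 : F) • (u : M2 F) = (-2 : F) • (-1 : M2 F) := by
      rw [sub_eq_iff_eq_add.1 h4]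
      rw [smul_neg, neg_smul, neg_neg, two_smul]
    exact smul_right_injective _ (neg_ne_zero.2 h2) h5
  -- three anticommuting
  set H' : Finset (M2 F) := H.image (fun x : SL F => (x : M2 F)) with hH'
  have hc' : H'.card = H.card := Finset.card_image_of_injective _ Subtype.val_injective
  have pick : ∀ S : Finset (M2 F), S.card ≤ 8 → ∃ x ∈ H, (x : M2 F) ∉ S := by
    intro S hS
    obtain ⟨e, he, heS⟩ := Finset.exists_mem_notMem_of_card_lt_card (s := S) (t := H') (by omega)
    obtain ⟨x, hx, rfl⟩ := Finset.mem_image.1 he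
    exact ⟨x, hx, heS⟩
  obtain ⟨g, hg, hgS⟩ := pick {1, -1} (Finset.card_le_two.trans (by norm_num))
  obtain ⟨h, hh, hhS⟩ := pick {1, -1, (g : M2 F), -(g : M2 F)} (Finset.card_le_four.trans (by norm_num))
  obtain ⟨k, hk, hkS⟩ := pick ({1, -1, (g : M2 F), -(g : M2 F)} ∪ {(h : M2 F), -(h : M2 F), (g : M2 F) * h, -((g : M2 F) * h)})
    ((Finset.card_union_le _ _).trans (by
      have a1 := Finset.card_le_four (a := (1 : M2 F)) (b := -1) (c := (g : M2 F)) (d := -(g : M2 F))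
      have a2 := Finset.card_le_four (a := (h : M2 F)) (b := -(h : M2 F)) (c := (g : M2 F) * h) (d := -((g : M2 F) * h))
      omega))
  simp only [Finset.mem_union, Finset.mem_insert, Finset.mem_singleton, not_or] at hgS hhS hkS
  have w1 : ∀ x ∈ H, x ∈ H ^ 1 := fun x hx => by simpa using hx
  have tg := U' g (pw_mono h1 (by norm_num) (w1 g hg)) hgS.1 hgS.2
  have th := U' h (pw_mono h1 (by norm_num) (w1 h hh)) hhS.1 hhS.2.1
  have tk := U' k (pw_mono h1 (by norm_num) (w1 k hk)) hkS.1.1 hkS.1.2.1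
  -- trace zero inverse
  have pr : ∀ a b : SL F, (a : M2 F).trace = 0 → (b : M2 F) ≠ a → (b : M2 F) ≠ - (a : M2 F) → a * b ∈ H ^ 3 → ((a : M2 F) * b).trace = 0 := by
    intro a b ha n1 n2 hab
    have sq : (a : M2 F) * a = -1 := by rw [cayley _ a.2, ha]; simp
    have := U' (a * b) hab ?_ ?_
    · rwa [Matrix.SpecialLinearGroup.coe_mul] at this
    · rw [Matrix.SpecialLinearGroup.coe_mul]
      intro e
      apply n2
      have := congrArg (fun z => (a : M2 F) * z) e
      simp only [← mul_assoc, sq] at this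
      simpa [neg_eq_iff_eq_neg] using this
    · rw [Matrix.SpecialLinearGroup.coe_mul]
      intro e
      apply n1
      have := congrArg (fun z => (a : M2 F) * z) e
      simp only [← mul_assoc, sq] at this
      simpa [neg_eq_iff_eq_neg] using this
  have tgh := pr g h tg hhS.2.2.1 hhS.2.2.2 (pw_mono h1 (by norm_num) (pw_mul (w1 g hg) (w1 h hh)))
  have tgk := pr g k tg hkS.1.2.2.1 hkS.1.2.2.2 (pw_mono h1 (by norm_num) (pw_mul (w1 g hg) (w1 k hk)))
  have thk := pr h k th hkS.2.1 hkS.2.2.1 (pw_mono h1 (by norm_num) (pw_mul (w1 h hh) (w1 k hk)))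
  have tghk := pr (g * h) k (by simpa using tgh) (by simpa using hkS.2.2.2.1) (by simpa using hkS.2.2.2.2)
    (pw_mul (pw_mul (w1 g hg) (w1 h hh)) (w1 k hk))
  rw [Matrix.SpecialLinearGroup.coe_mul] at tghk
  have a1 := anti _ _ tg tk tgk
  have a2 := anti _ _ th tk thk
  have a3 := anti _ _ tgh tk tghk
  have a4 : (g : M2 F) * h * k = (k : M2 F) * (g * h) := by
    rw [mul_assoc, a2, mul_neg, ← mul_assoc, a1, neg_mul, neg_neg, mul_assoc]
  have a5 : (g : M2 F) * h * k = 0 := by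
    have : (2 : F) • ((g : M2 F) * h * k) = 0 := by
      rw [two_smul]; nth_rewrite 1 [a3]; rw [a4]; simp
    exact (smul_eq_zero.1 this).resolve_left h2
  have := congrArg Matrix.det a5
  simp at this

end IUC
end

section
open Finset
open scoped Pointwise
set_option maxHeartbeats 2000000
set_option linter.unusedSectionVars false
namespace IUC
variable {F : Type*} [Field F] [DecidableEq F]

lemma sq_one_cases {b : F} (h : b ^ 2 = 1) : b = 1 ∨ b = -1 := by
  have : (b - 1) * (b + 1) = 0 := by linear_combination h
  rcases mul_eq_zero.1 this with h | h
  · left; linear_combination h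
  · right; linear_combination h

/-- commutant of a nonscalar matrix -/
lemma comm_param (g x : M2 F) (hg : ∀ c : F, g ≠ c • (1 : M2 F)) (h : x * g = g * x) :
    ∃ a b : F, x = a • (1 : M2 F) + b • g := by
  have e00 := congrFun (congrFun h 0) 0
  have e01 := congrFun (congrFun h 0) 1
  have e10 := congrFun (congrFun h 1) 0
  simp only [Matrix.mul_apply, Fin.sum_univ_two] at e00 e01 e10
  have fin : ∀ a b : F, x 0 0 = a + b * g 0 0 → x 0 1 = b * g 0 1 → x 1 0 = b * g 1 0 → x 1 1 = a + b * g 1 1 →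
      ∃ a b : F, x = a • (1 : M2 F) + b • g := by
    intro a b h1 h2 h3 h4
    refine ⟨a, b, ?_⟩
    apply m2ext <;> simp [h1, h2, h3, h4]
  by_cases h01 : g 0 1 = 0
  · by_cases h10 : g 1 0 = 0
    · have hd : g 0 0 - g 1 1 ≠ 0 := by
        intro h0
        apply hg (g 0 0)
        apply m2ext <;> simp [h01, h10]
        linear_combination -h0
      apply fin (x 0 0 - (x 0 0 - x 1 1) / (g 0 0 - g 1 1) * g 0 0) ((x 0 0 - x 1 1) / (g 0 0 - g 1 1))
      · ring
      · rw [h01] at e01 ⊢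
        have : (g 0 0 - g 1 1) * x 0 1 = 0 := by linear_combination -e01
        simpa [hd] using this
      · rw [h10] at e10 ⊢
        have : (g 0 0 - g 1 1) * x 1 0 = 0 := by linear_combination e10
        simpa [hd] using this
      · field_simp; ring
    · apply fin (x 0 0 - x 1 0 / g 1 0 * g 0 0) (x 1 0 / g 1 0)
      · ring
      · field_simp; linear_combination e00
      · field_simp
      · field_simp; linear_combination e10
  · apply fin (x 0 0 - x 0 1 / g 0 1 * g 0 0) (x 0 1 / g 0 1)
    · ring
    · field_simp
    · field_simp; linear_combination -e00
    · field_simp; linear_combination -e01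

def nonsc (g : SL F) : Prop := (g : M2 F) ≠ 1 ∧ (g : M2 F) ≠ -1

def reg (g : SL F) : Prop := (g : M2 F).trace ≠ 0 ∧ (g : M2 F).trace ≠ 2 ∧ (g : M2 F).trace ≠ -2

lemma reg.nonsc {g : SL F} (h : reg g) : nonsc g := by
  constructor
  · intro e; apply h.2.1; rw [e]; simp
  · intro e; apply h.2.2; rw [e]; simp

lemma nonsc.ne_smul {g : SL F} (h : nonsc g) (c : F) : (g : M2 F) ≠ c • (1 : M2 F) := by
  intro e
  have hd : (g : M2 F).det = 1 := g.2
  rw [e] at hd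
  simp at hd
  rcases hd with h1 | h1
  · apply h.1; rw [e, h1]; simp
  · apply h.2; rw [e, h1]; simp

lemma coe_comm {x g : SL F} : x * g = g * x ↔ (x : M2 F) * g = g * x := by
  constructor
  · intro h; exact congrArg Subtype.val h
  · intro h; exact Subtype.ext h

/-- centralizers of commuting nonscalar elements coincide -/
lemma comm_trans {g x y : SL F} (hg : nonsc g) (hx : x * g = g * x) (hy : y * g = g * y) : x * y = y * x := by
  rw [coe_comm] at *
  obtain ⟨a, b, e⟩ := comm_param _ _ hg.ne_smul hx
  rw [e, add_mul, mul_add]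
  simp [hy]

lemma conj_trace (a g : SL F) : ((a * g * a⁻¹ : SL F) : M2 F).trace = (g : M2 F).trace := by
  rw [Matrix.SpecialLinearGroup.coe_mul, Matrix.trace_mul_comm, ← Matrix.SpecialLinearGroup.coe_mul]
  have : a⁻¹ * (a * g) = g := by group
  rw [this]

lemma det_ab (a b : F) (g : M2 F) (hg : g.det = 1) : (a • (1 : M2 F) + b • g).det = a ^ 2 + a * b * g.trace + b ^ 2 := by
  rw [Matrix.det_fin_two] at *
  simp [Matrix.trace_fin_two]
  linear_combination b ^ 2 * hg

lemma tr_ab (a b : F) (g : M2 F) : (a • (1 : M2 F) + b • g).trace = 2 * a + b * g.trace := by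
  simp [Matrix.trace_add]; ring

/-- a nonscalar element commuting with an element of trace not `±2` has trace not `±2`. -/
lemma tr_of_comm {g x : SL F} (h2 : (g : M2 F).trace ≠ 2) (h2' : (g : M2 F).trace ≠ -2) (hx : nonsc x) (hc : g * x = x * g) :
    (x : M2 F).trace ≠ 2 ∧ (x : M2 F).trace ≠ -2 := by
  obtain ⟨a, b, e⟩ := comm_param _ _ hx.ne_smul (coe_comm.1 hc)
  have hd : (g : M2 F).det = 1 := g.2
  rw [e, det_ab a b _ x.2] at hd
  rw [e, tr_ab] at h2 h2'
  constructor
  · intro ht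
    rw [ht] at hd h2 h2'
    have : (a + b) ^ 2 = 1 := by linear_combination hd
    rcases sq_one_cases this with h | h
    · apply h2; linear_combination 2 * h
    · apply h2'; linear_combination 2 * h
  · intro ht
    rw [ht] at hd h2 h2'
    have : (a - b) ^ 2 = 1 := by linear_combination hd
    rcases sq_one_cases this with h | h
    · apply h2; linear_combination 2 * h
    · apply h2'; linear_combination 2 * h

/-- same trace in a torus -/
lemma same_tr {x y : SL F} (h2 : (x : M2 F).trace ≠ 2) (h2' : (x : M2 F).trace ≠ -2) (two : (2 : F) ≠ 0)
    (hxy : y * x = x * y) (ht : (y : M2 F).trace = (x : M2 F).trace) : y = x ∨ y = x⁻¹ := by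
  have hx : nonsc x := by
    constructor
    · intro e; apply h2; rw [e]; simp
    · intro e; apply h2'; rw [e]; simp
  obtain ⟨a, b, e⟩ := comm_param _ _ hx.ne_smul (coe_comm.1 hxy)
  have hd : (y : M2 F).det = 1 := y.2
  rw [e, det_ab a b _ x.2] at hd
  rw [e, tr_ab] at ht
  set t := (x : M2 F).trace with htdef
  have h3 : (b ^ 2 - 1) * ((2 - t) * (2 + t)) = 0 := by linear_combination 4 * hd - (2 * a + b * t + t) * ht
  have h4 : (2 - t) * (2 + t) ≠ 0 := by
    apply mul_ne_zero
    · intro h; apply h2; linear_combination -h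
    · intro h; apply h2'; linear_combination h
  have h5 : b ^ 2 = 1 := by
    have := (mul_eq_zero.1 h3).resolve_right h4
    linear_combination this
  rcases sq_one_cases h5 with h | h
  · left
    have ha : a = 0 := by
      have : 2 * a = 0 := by rw [h] at ht; linear_combination ht
      exact (mul_eq_zero.1 this).resolve_left two
    apply Subtype.ext
    show (y : M2 F) = x
    rw [e, ha, h]; simp
  · right
    have ha : a = t := by
      have : 2 * (a - t) = 0 := by rw [h] at ht; linear_combination ht
      have := (mul_eq_zero.1 this).resolve_left two
      linear_combination this
    apply Subtype.ext
    show (y : M2 F) = ((x⁻¹ : SL F) : M2 F)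
    rw [e, ha, h, inv_coe, ← htdef]; simp [sub_eq_add_neg]

/-- more than four commuting elements in a torus contain a regular one. -/
lemma exists_reg (two : (2 : F) ≠ 0) {g : SL F} (hg : reg g) (S : Finset (SL F)) (hS : ∀ x ∈ S, x * g = g * x) (hc : 4 < S.card) :
    ∃ x ∈ S, reg x := by
  by_contra hcon
  push Not at hcon
  have h0 : ∀ x ∈ S, nonsc x → (x : M2 F).trace = 0 := by
    intro x hx hn
    by_contra hne
    exact hcon x hx ⟨hne, tr_of_comm hg.2.1 hg.2.2 hn (hS x hx).symm⟩
  set S' : Finset (M2 F) := S.image (fun x : SL F => (x : M2 F)) with hS'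
  have hc' : S'.card = S.card := Finset.card_image_of_injective _ Subtype.val_injective
  obtain ⟨e, he, heS⟩ := Finset.exists_mem_notMem_of_card_lt_card (s := {1, -1}) (t := S')
    (by have := Finset.card_le_two (a := (1 : M2 F)) (b := -1); omega)
  obtain ⟨x, hx, rfl⟩ := Finset.mem_image.1 he
  obtain ⟨e, he', heS'⟩ := Finset.exists_mem_notMem_of_card_lt_card (s := {1, -1, (x : M2 F), ((x⁻¹ : SL F) : M2 F)}) (t := S')
    (by have := Finset.card_le_four (a := (1 : M2 F)) (b := -1) (c := (x : M2 F)) (d := ((x⁻¹ : SL F) : M2 F)); omega)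
  obtain ⟨y, hy, rfl⟩ := Finset.mem_image.1 he'
  simp only [Finset.mem_insert, Finset.mem_singleton, not_or] at heS heS'
  have tx := h0 x hx heS
  have ty := h0 y hy ⟨heS'.1, heS'.2.1⟩
  have hxn := tr_of_comm hg.2.1 hg.2.2 (x := x) heS (hS x hx).symm
  rcases same_tr hxn.1 hxn.2 two (comm_trans hg.nonsc (hS y hy) (hS x hx)) (by rw [tx, ty]) with h | h
  · exact heS'.2.2.1 (by rw [h])
  · exact heS'.2.2.2 (by rw [h])

variable [Fintype F]

def cen (g : SL F) : Finset (SL F) := univ.filter (fun x : SL F => x * g = g * x)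

lemma mem_cen {g x : SL F} : x ∈ cen g ↔ x * g = g * x := by simp [cen]

lemma cen_eq {g g' : SL F} (hg : nonsc g) (hg' : nonsc g') (h : g * g' = g' * g) : cen g = cen g' := by
  ext x
  rw [mem_cen, mem_cen]
  constructor
  · intro hx; exact comm_trans hg hx h.symm
  · intro hx; exact comm_trans hg' hx h

lemma mem_cen_conj {a g x : SL F} : a * x * a⁻¹ ∈ cen (a * g * a⁻¹) ↔ x ∈ cen g := by
  rw [mem_cen, mem_cen]
  have e1 : a * x * a⁻¹ * (a * g * a⁻¹) = a * (x * g) * a⁻¹ := by group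
  have e2 : a * g * a⁻¹ * (a * x * a⁻¹) = a * (g * x) * a⁻¹ := by group
  rw [e1, e2]; simp

lemma cen_card {g : SL F} (hg : nonsc g) : (cen g).card ≤ 2 * Fintype.card F := by
  have h1 : cen g ⊆ (univ : Finset F).biUnion (fun b => (univ.filter (fun a : F => a ^ 2 - (- b * (g : M2 F).trace) * a + (b ^ 2 - 1) = 0)).biUnion
      (fun a => univ.filter (fun x : SL F => (x : M2 F) = a • (1 : M2 F) + b • (g : M2 F)))) := by
    intro x hx
    rw [mem_cen, coe_comm] at hx
    obtain ⟨a, b, e⟩ := comm_param _ _ hg.ne_smul hx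
    simp only [Finset.mem_biUnion, Finset.mem_filter, Finset.mem_univ, true_and]
    refine ⟨b, a, ?_, e⟩
    have hd : (x : M2 F).det = 1 := x.2
    rw [e, det_ab a b _ g.2] at hd
    linear_combination hd
  refine (Finset.card_le_card h1).trans (Finset.card_biUnion_le.trans ?_)
  calc _ ≤ ∑ b : F, 2 := by
        apply Finset.sum_le_sum
        intro b _
        refine Finset.card_biUnion_le.trans ?_
        refine (Finset.sum_le_card_nsmul _ _ 1 ?_).trans ?_
        · intro a _
          rw [Finset.card_le_one]
          intro x hx y hy
          simp only [Finset.mem_filter, Finset.mem_univ, true_and] at hx hy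
          exact Subtype.ext (hx.trans hy.symm)
        · simpa using quad_card (-b * (g : M2 F).trace) (b ^ 2 - 1)
    _ = _ := by simp [mul_comm]

end IUC
end

section
open Finset
open scoped Pointwise
set_option maxHeartbeats 400000
set_option linter.unusedSectionVars false
namespace IUC
variable {F : Type*} [Field F] [DecidableEq F] [Fintype F]

lemma cube_bound (x l L : ℕ) (hL : 1 ≤ L) (hl : l * l * (l - 1) ≤ L)
    (h : x ^ 3 ≤ 3 * x ^ 2 + 8 * l ^ 2 * x + 2 * L ^ 2) : x ^ 3 ≤ 729 * L ^ 2 := by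
  have hL2 : 1 ≤ L ^ 2 := Nat.one_le_pow _ _ hL
  have hLL : L ≤ L ^ 2 := by nlinarith
  by_cases hx : x ≤ 9
  · calc x ^ 3 ≤ 9 ^ 3 := Nat.pow_le_pow_left hx 3
      _ ≤ 729 * L ^ 2 := by omega
  push Not at hx
  have h1 : 9 * x ^ 2 ≤ x ^ 3 := by
    calc 9 * x ^ 2 ≤ x * x ^ 2 := Nat.mul_le_mul_right _ hx.le
      _ = x ^ 3 := by ring
  by_cases h2 : 24 * l ^ 2 ≤ x ^ 2
  · have h3 : 24 * l ^ 2 * x ≤ x ^ 3 := by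
      calc 24 * l ^ 2 * x ≤ x ^ 2 * x := Nat.mul_le_mul_right _ h2
        _ = x ^ 3 := by ring
    nlinarith
  · push Not at h2
    have h3 : x < 5 * l := by
      by_contra hc
      push Not at hc
      have : (5 * l) ^ 2 ≤ x ^ 2 := Nat.pow_le_pow_left hc 2
      nlinarith
    have h4 : 2 ≤ l := by omega
    obtain ⟨k, rfl⟩ : ∃ k, l = k + 1 := ⟨l - 1, by omega⟩
    simp only [Nat.add_sub_cancel] at hl
    have h5 : (k + 1) ^ 3 ≤ 2 * L := by
      have : (k + 1) * (k + 1) * (k + 1) ≤ (k + 1) * (k + 1) * (2 * k) := Nat.mul_le_mul_left _ (by omega)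
      nlinarith
    calc x ^ 3 ≤ (5 * (k + 1)) ^ 3 := Nat.pow_le_pow_left h3.le 3
      _ = 125 * (k + 1) ^ 3 := by ring
      _ ≤ 125 * (2 * L) := Nat.mul_le_mul_left _ h5
      _ ≤ _ := by omega

lemma pw_card {G : Type*} [Group G] [DecidableEq G] {H : Finset G} (h1 : (1 : G) ∈ H) {m n : ℕ} (h : m ≤ n) :
    (H ^ m).card ≤ (H ^ n).card := Finset.card_le_card (pw_mono h1 h)

lemma trace_bound {n m : ℕ} (hn : 6 * m + 2 ≤ n) (H : Finset (SL F)) (h1 : 1 ∈ H) (hs : ∀ x ∈ H, x⁻¹ ∈ H)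
    (hfix : ∀ p : Option F, ∃ h ∈ H, ((h : M2 F) * np p).trace ≠ 0) (t : F) (ht0 : t ≠ 0) (ht2 : t ≠ 2) (ht2' : t ≠ -2) :
    ((H ^ m).filter (fun x : SL F => (x : M2 F).trace = t)).card ^ 3 ≤ 729 * (H ^ n).card ^ 2 := by
  set L := (H ^ n).card with hL
  have hL1 : 1 ≤ L := by
    have := pw_mono h1 (Nat.zero_le n)
    rw [hL, Nat.one_le_iff_ne_zero, ← Nat.pos_iff_ne_zero, Finset.card_pos]
    exact ⟨1, this (by simp)⟩
  set X := (H ^ m).filter (fun x : SL F => (x : M2 F).trace = t) with hX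
  set l := Nat.findGreatest (fun l => l * l * (l - 1) ≤ L) L with hl
  have hl1 : l * l * (l - 1) ≤ L := Nat.findGreatest_spec (P := fun l => l * l * (l - 1) ≤ L) (m := 0) (Nat.zero_le _) (by simp)
  apply cube_bound _ l _ hL1 hl1
  have hm : ∀ x ∈ X, x ∈ H ^ m := fun x hx => (Finset.mem_filter.1 hx).1
  have hWm : ∀ x y : SL F, x ∈ H ^ m → y ∈ H ^ m → x * y ∈ H ^ (m + m) := by
    intro x y hx hy
    rw [pow_add]; exact Finset.mul_mem_mul hx hy
  have := trace_count t ht0 ht2 ht2' X (H ^ (m + m)) (fun x hx => (Finset.mem_filter.1 hx).2) (fun x hx y hy => hWm _ _ (pw_inv hs _ (hm x hx)) (hm y hy)) (fun x hx y hy => hWm _ _ (hm x hx) (pw_inv hs _ (hm y hy))) l ?_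
  · refine this.trans ?_
    gcongr
    exact pw_card h1 (by omega)
  · intro p U hU hUu
    obtain ⟨h, hh, hht⟩ := hfix p
    apply Nat.le_findGreatest
    · exact Finset.card_le_card (hU.trans (pw_mono h1 (by omega)))
    · apply unip_count (np p) (np_trace p) (np_det p) U hUu h hht
      intro x hx y hy z hz
      have hh1 : h ∈ H ^ 1 := by simpa using hh
      have := pw_mul (pw_mul (pw_mul (pw_mul (hU hx) hh1) (hU hy)) (pw_inv hs _ hh1)) (hU hz)
      exact pw_mono h1 (by omega) this

lemma reg_bound {n : ℕ} (hn : 128 ≤ n) (H : Finset (SL F)) (h1 : 1 ∈ H) (hs : ∀ x ∈ H, x⁻¹ ∈ H)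
    (hfix : ∀ p : Option F, ∃ h ∈ H, ((h : M2 F) * np p).trace ≠ 0) (Q : ℕ) (hQ : (H ^ n).card ≤ Q * H.card)
    (g : SL F) (hg : g ∈ H ^ 19) (hr : reg g) :
    H.card ≤ 729 * Q ^ 2 * (H ^ 2 ∩ cen g).card ^ 3 := by
  set X := (H ^ 21).filter (fun x : SL F => (x : M2 F).trace = (g : M2 F).trace) with hX
  set r := (H ^ 2 ∩ cen g).card with hr'
  have hX3 := trace_bound (m := 21) hn H h1 hs hfix (g : M2 F).trace hr.1 hr.2.1 hr.2.2
  have hc : H.card ≤ r * X.card := by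
    have e1 : H.card ≤ r * (H.image (fun h => h * g * h⁻¹)).card := by
      apply Finset.card_le_mul_card_image
      intro b hb
      obtain ⟨h0, hh0, rfl⟩ := Finset.mem_image.1 hb
      rw [← Finset.card_image_of_injective _ (mul_right_injective h0⁻¹)]
      apply Finset.card_le_card
      intro u hu
      obtain ⟨y, hy, rfl⟩ := Finset.mem_image.1 hu
      obtain ⟨hy1, hyb⟩ := Finset.mem_filter.1 hy
      rw [Finset.mem_inter, mem_cen]
      constructor
      · rw [sq]; exact Finset.mul_mem_mul (hs _ hh0) hy1
      · show h0⁻¹ * y * g = g * (h0⁻¹ * y)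
        have : y * g = h0 * g * h0⁻¹ * y := by rw [← hyb]; group
        rw [mul_assoc, this]; group
    refine e1.trans (Nat.mul_le_mul_left _ (Finset.card_le_card ?_))
    intro b hb
    obtain ⟨h0, hh0, rfl⟩ := Finset.mem_image.1 hb
    rw [hX, Finset.mem_filter]
    have hh1 : h0 ∈ H ^ 1 := by simpa using hh0
    refine ⟨?_, conj_trace h0 g⟩
    exact pw_mul (pw_mul hh1 hg) (pw_inv hs _ hh1)
  have hpos : 0 < H.card := Finset.card_pos.2 ⟨1, h1⟩
  have h3 : H.card ^ 3 ≤ 729 * Q ^ 2 * r ^ 3 * H.card ^ 2 := by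
    calc H.card ^ 3 ≤ (r * X.card) ^ 3 := Nat.pow_le_pow_left hc 3
      _ = r ^ 3 * X.card ^ 3 := by ring
      _ ≤ r ^ 3 * (729 * (H ^ n).card ^ 2) := Nat.mul_le_mul_left _ hX3
      _ ≤ r ^ 3 * (729 * (Q * H.card) ^ 2) := Nat.mul_le_mul_left _ (Nat.mul_le_mul_left _ (Nat.pow_le_pow_left hQ 2))
      _ = _ := by ring
  have h4 : H.card * H.card ^ 2 ≤ 729 * Q ^ 2 * r ^ 3 * H.card ^ 2 := by rw [← pow_succ']; exact h3
  exact Nat.le_of_mul_le_mul_right h4 (by positivity)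

lemma conj_bound {n : ℕ} (hn : 128 ≤ n) (H : Finset (SL F)) (h1 : 1 ∈ H) (hs : ∀ x ∈ H, x⁻¹ ∈ H)
    (Q : ℕ) (hQ : (H ^ n).card ≤ Q * H.card) (g a : SL F) (ha : a ∈ H) :
    (H ^ 2 ∩ cen g).card ≤ (H ^ 2 ∩ cen (a * g * a⁻¹)).card * Q := by
  set s := (H ^ 2 ∩ cen (a * g * a⁻¹)).card with hs'
  set Z := (H ^ 2 ∩ cen g).image (fun x => a * x * a⁻¹) with hZ
  have hZc : Z.card = (H ^ 2 ∩ cen g).card := by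
    apply Finset.card_image_of_injective
    intro x y hxy
    simpa using hxy
  rw [← hZc]
  have hZ4 : ∀ z ∈ Z, z ∈ H ^ 4 ∧ z ∈ cen (a * g * a⁻¹) := by
    intro z hz
    obtain ⟨x, hx, rfl⟩ := Finset.mem_image.1 hz
    rw [Finset.mem_inter] at hx
    have ha1 : a ∈ H ^ 1 := by simpa using ha
    exact ⟨pw_mul (pw_mul ha1 hx.1) (pw_inv hs _ ha1), mem_cen_conj.2 hx.2⟩
  have hpos : 0 < H.card := Finset.card_pos.2 ⟨1, h1⟩
  have e1 : (Z ×ˢ H).card ≤ s * ((Z ×ˢ H).image (fun p => p.1 * p.2)).card := by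
    apply Finset.card_le_mul_card_image
    intro b hb
    obtain ⟨⟨z0, h0⟩, hz0, rfl⟩ := Finset.mem_image.1 hb
    apply Finset.card_le_card_of_injOn (fun p => z0⁻¹ * p.1)
    · rintro ⟨z, h⟩ hp
      rw [Finset.mem_coe, Finset.mem_filter, Finset.mem_product] at hp
      rw [Finset.mem_product] at hz0
      simp only at hp hz0 ⊢
      rw [Finset.mem_coe, Finset.mem_inter]
      constructor
      · have : z0⁻¹ * z = h0 * h⁻¹ := by
          rw [inv_mul_eq_iff_eq_mul, ← mul_assoc, ← hp.2]; group
        rw [this, sq]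
        exact Finset.mul_mem_mul hz0.2 (hs _ hp.1.2)
      · have c1 := mem_cen.1 (hZ4 _ hz0.1).2
        have c2 := mem_cen.1 (hZ4 _ hp.1.1).2
        rw [mem_cen]
        have c3 : Commute z0 (a * g * a⁻¹) := c1
        have c4 : Commute z (a * g * a⁻¹) := c2
        exact (c3.inv_left).mul_left c4
    · rintro ⟨z, h⟩ hp ⟨z', h'⟩ hp' e
      rw [Finset.mem_coe, Finset.mem_filter] at hp hp'
      simp only at hp hp' e
      have ez : z = z' := mul_left_cancel e
      subst ez
      have : h = h' := mul_left_cancel (hp.2.trans hp'.2.symm)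
      rw [this]
  have e2 : ((Z ×ˢ H).image (fun p => p.1 * p.2)).card ≤ (H ^ n).card := by
    apply Finset.card_le_card
    intro b hb
    obtain ⟨⟨z0, h0⟩, hz0, rfl⟩ := Finset.mem_image.1 hb
    rw [Finset.mem_product] at hz0
    have hh1 : h0 ∈ H ^ 1 := by simpa using hz0.2
    have h5 : z0 * h0 ∈ H ^ 5 := pw_mul (hZ4 _ hz0.1).1 hh1
    exact pw_mono h1 (by omega : 5 ≤ n) h5
  rw [Finset.card_product] at e1
  have e3 : Z.card * H.card ≤ s * Q * H.card := by
    calc _ ≤ _ := e1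
      _ ≤ s * (Q * H.card) := Nat.mul_le_mul_left _ (e2.trans hQ)
      _ = _ := by ring
  exact Nat.le_of_mul_le_mul_right e3 hpos

lemma pivot_count (h2 : (2 : F) ≠ 0) (H2 : Finset (SL F)) (Γ : Subgroup (SL F)) (g0 : SL F) (hg0r : reg g0) (R : ℕ)
    (all : ∀ γ ∈ Γ, R ≤ (H2 ∩ cen (γ * g0 * γ⁻¹)).card) :
    Nat.card Γ * (R - 2) ≤ 2 * H2.card * (cen g0).card := by
  classical
  have regconj : ∀ g a : SL F, reg g → reg (a * g * a⁻¹) := by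
    intro g a hg
    unfold reg; rw [conj_trace]; exact hg
  -- count pairs
  set Γf : Finset (SL F) := univ.filter (fun x : SL F => x ∈ Γ) with hΓf
  have hcard : Nat.card Γ = Γf.card := by
    rw [Nat.card_eq_fintype_card, Fintype.card_subtype]
  rw [hcard]
  set P := (Γf ×ˢ H2).filter (fun p : SL F × SL F => nonsc p.2 ∧ p.2 ∈ cen (p.1 * g0 * p.1⁻¹)) with hP
  have lower : Γf.card * (R - 2) ≤ P.card := by
    rw [mul_comm]
    have hmaps : ∀ p ∈ P, p.1 ∈ Γf := fun p hp => (Finset.mem_product.1 (Finset.mem_filter.1 hp).1).1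
    rw [Finset.card_eq_sum_card_fiberwise (f := fun p : SL F × SL F => p.1) (t := Γf) hmaps, mul_comm, ← smul_eq_mul]
    apply Finset.card_nsmul_le_sum
    intro γ hγ
    have hγ' : γ ∈ Γ := (Finset.mem_filter.1 hγ).2
    have hall := all γ hγ'
    set S := H2 ∩ cen (γ * g0 * γ⁻¹) with hS
    have hS2 : (S.filter (fun x : SL F => ¬ nonsc x)).card ≤ 2 := by
      have hci : ((S.filter (fun x : SL F => ¬ nonsc x)).image (fun x : SL F => (x : M2 F))).card = (S.filter (fun x : SL F => ¬ nonsc x)).card :=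
        Finset.card_image_of_injective _ Subtype.val_injective
      rw [← hci]
      refine (Finset.card_le_card ?_).trans (Finset.card_le_two (a := (1 : M2 F)) (b := -1))
      intro e he
      obtain ⟨x, hx, rfl⟩ := Finset.mem_image.1 he
      have := (Finset.mem_filter.1 hx).2
      simp only [nonsc, not_and_or, not_not] at this
      simpa using this
    have hS3 := Finset.card_filter_add_card_filter_not (s := S) (fun x : SL F => nonsc x)
    have hS4 : (S.filter (fun x : SL F => nonsc x)).card ≤ (P.filter (fun p => p.1 = γ)).card := by
      apply Finset.card_le_card_of_injOn (fun x => (γ, x))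
      · intro x hx
        rw [Finset.mem_coe, Finset.mem_filter, hS, Finset.mem_inter] at hx
        rw [Finset.mem_coe, Finset.mem_filter, hP, Finset.mem_filter, Finset.mem_product]
        exact ⟨⟨⟨hγ, hx.1.1⟩, hx.2, hx.1.2⟩, rfl⟩
      · intro x _ y _ h
        exact (Prod.mk.inj h).2
    omega
  have upper : P.card ≤ 2 * H2.card * (cen g0).card := by
    have hmaps : ∀ p ∈ P, p.2 ∈ H2 := fun p hp => (Finset.mem_product.1 (Finset.mem_filter.1 hp).1).2
    rw [Finset.card_eq_sum_card_fiberwise (f := fun p : SL F × SL F => p.2) (t := H2) hmaps]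
    have : 2 * H2.card * (cen g0).card = H2.card • (2 * (cen g0).card) := by rw [smul_eq_mul]; ring
    rw [this]
    apply Finset.sum_le_card_nsmul
    intro y hy
    by_cases hne : (P.filter (fun p => p.2 = y)).Nonempty
    swap
    · rw [Finset.not_nonempty_iff_eq_empty] at hne; rw [hne]; simp
    obtain ⟨⟨γ0, y0⟩, hp0⟩ := hne
    rw [Finset.mem_filter, hP, Finset.mem_filter] at hp0
    simp only at hp0
    obtain ⟨⟨-, hy0n, hy0c⟩, rfl⟩ := hp0
    set x0 := γ0 * g0 * γ0⁻¹ with hx0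
    -- all others
    have e1 : (P.filter (fun p => p.2 = y0)).card ≤ (cen g0).card * ((P.filter (fun p => p.2 = y0)).image (fun p : SL F × SL F => p.1 * g0 * p.1⁻¹)).card := by
      apply Finset.card_le_mul_card_image
      intro b hb
      obtain ⟨⟨γ1, y1⟩, hp1, rfl⟩ := Finset.mem_image.1 hb
      apply Finset.card_le_card_of_injOn (fun p => γ1⁻¹ * p.1)
      · rintro ⟨γ, y⟩ hp
        rw [Finset.mem_coe, Finset.mem_filter] at hp
        have e := hp.2
        simp only at e ⊢
        rw [Finset.mem_coe, mem_cen]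
        have : γ * g0 = γ1 * g0 * γ1⁻¹ * γ := by rw [← e]; group
        rw [mul_assoc, this]; group
      · rintro ⟨γ, y⟩ hp ⟨γ', y'⟩ hp' e
        rw [Finset.mem_coe, Finset.mem_filter, Finset.mem_filter] at hp hp'
        have e3 := hp.1.2
        have e4 := hp'.1.2
        simp only at e e3 e4
        rw [mul_left_cancel e, e3, e4]
    have e2 : ((P.filter (fun p => p.2 = y0)).image (fun p : SL F × SL F => p.1 * g0 * p.1⁻¹)).card ≤ 2 := by
      refine (Finset.card_le_card ?_).trans (Finset.card_le_two (a := x0) (b := x0⁻¹))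
      intro b hb
      obtain ⟨⟨γ1, y1⟩, hp1, rfl⟩ := Finset.mem_image.1 hb
      rw [Finset.mem_filter, hP, Finset.mem_filter] at hp1
      simp only at hp1
      obtain ⟨⟨-, hyn, hyc⟩, rfl⟩ := hp1
      rw [mem_cen] at hyc hy0c
      have r0 := regconj g0 γ0 hg0r
      have := same_tr (x := x0) (y := γ1 * g0 * γ1⁻¹) r0.2.1 r0.2.2 h2 (comm_trans hyn hyc.symm hy0c.symm) (by rw [hx0, conj_trace, conj_trace])
      simpa using this
    calc _ ≤ _ := e1
      _ ≤ (cen g0).card * 2 := Nat.mul_le_mul_left _ e2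
      _ = _ := by ring
  exact lower.trans upper

/-- The pivot argument. -/
lemma pivot {n : ℕ} (hn : 128 ≤ n) (h2 : (2 : F) ≠ 0) (h3 : (3 : F) ≠ 0) (H : Finset (SL F)) (h1 : 1 ∈ H) (hs : ∀ x ∈ H, x⁻¹ ∈ H)
    (hfix : ∀ p : Option F, ∃ h ∈ H, ((h : M2 F) * np p).trace ≠ 0) (Q : ℕ) (hQ1 : 1 ≤ Q)
    (hQ : (H ^ n).card ≤ Q * H.card) (hbig : 10 ^ 7 * Q ^ 5 ≤ H.card) :
    ∃ g : SL F, g ∈ Subgroup.closure (H : Set (SL F)) ∧ reg g ∧ ∃ R : ℕ, 14 ≤ R ∧ H.card ≤ 729 * Q ^ 2 * R ^ 3 ∧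
      R ≤ (H ^ 2 ∩ cen g).card ∧
      Nat.card (Subgroup.closure (H : Set (SL F))) * (R - 2) ≤ 2 * (H ^ 2).card * (cen g).card := by
  classical
  set Γ := Subgroup.closure (H : Set (SL F)) with hΓ
  have hHΓ : ∀ n, ∀ x ∈ H ^ n, x ∈ Γ := by
    intro n
    induction n with
    | zero => intro x hx; simp at hx; rw [hx]; exact one_mem _
    | succ n ih =>
      intro x hx
      rw [pow_succ] at hx
      obtain ⟨a, ha, b, hb, rfl⟩ := Finset.mem_mul.1 hx
      exact mul_mem (ih a ha) (Subgroup.subset_closure hb)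
  have hex : ∃ R, H.card ≤ 729 * Q ^ 2 * R ^ 3 := ⟨H.card, by
    have : 1 ≤ Q ^ 2 := Nat.one_le_pow _ _ hQ1
    have hpos : 0 < H.card := Finset.card_pos.2 ⟨1, h1⟩
    have : H.card ≤ H.card ^ 3 := Nat.le_self_pow (by norm_num) _
    nlinarith⟩
  set R := Nat.find hex with hR
  have hRs : H.card ≤ 729 * Q ^ 2 * R ^ 3 := Nat.find_spec hex
  have hRmin : ∀ r, H.card ≤ 729 * Q ^ 2 * r ^ 3 → R ≤ r := fun r hr => Nat.find_min' hex hr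
  have hR14 : 14 * Q ≤ R := by
    by_contra hc
    push Not at hc
    have : 729 * Q ^ 2 * R ^ 3 ≤ 729 * Q ^ 2 * (14 * Q) ^ 3 := by gcongr
    have e : 729 * Q ^ 2 * (14 * Q) ^ 3 = 2000376 * Q ^ 5 := by ring
    have : 1 ≤ Q ^ 5 := Nat.one_le_pow _ _ hQ1
    omega
  have hrr : ∀ g ∈ H ^ 19, reg g → R ≤ (H ^ 2 ∩ cen g).card := fun g hg hr => hRmin _ (reg_bound hn H h1 hs hfix Q hQ g hg hr)
  have h5 : 1 ≤ Q ^ 5 := Nat.one_le_pow _ _ hQ1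
  obtain ⟨g0, hg0, hg0r⟩ := start_lemma h2 h3 H h1 (by omega) hfix
  have hg0r : reg g0 := hg0r
  have key : ∀ g : SL F, reg g → 4 < (H ^ 2 ∩ cen g).card → ∃ g' ∈ H ^ 19, reg g' ∧ cen g = cen g' := by
    intro g hg hc
    obtain ⟨x, hx, hxr⟩ := exists_reg h2 hg (H ^ 2 ∩ cen g) (fun x hx => mem_cen.1 (Finset.mem_inter.1 hx).2) hc
    refine ⟨x, pw_mono h1 (by norm_num) (Finset.mem_inter.1 hx).1, hxr, ?_⟩
    exact cen_eq hg.nonsc hxr.nonsc (mem_cen.1 (Finset.mem_inter.1 hx).2).symm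
  have regconj : ∀ g a : SL F, reg g → reg (a * g * a⁻¹) := by
    intro g a hg
    unfold reg; rw [conj_trace]; exact hg
  have all : ∀ γ ∈ Γ, R ≤ (H ^ 2 ∩ cen (γ * g0 * γ⁻¹)).card := by
    have base : R ≤ (H ^ 2 ∩ cen g0).card := hrr g0 hg0 hg0r
    have stepH : ∀ a ∈ H, ∀ γ, R ≤ (H ^ 2 ∩ cen (γ * g0 * γ⁻¹)).card → R ≤ (H ^ 2 ∩ cen (a * γ * g0 * (a * γ)⁻¹)).card := by
      intro a ha γ hγ
      have := conj_bound hn H h1 hs Q hQ (γ * g0 * γ⁻¹) a ha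
      have e : a * (γ * g0 * γ⁻¹) * a⁻¹ = a * γ * g0 * (a * γ)⁻¹ := by group
      rw [e] at this
      have hgt : 4 < (H ^ 2 ∩ cen (a * γ * g0 * (a * γ)⁻¹)).card := by
        by_contra hc
        push Not at hc
        have : (H ^ 2 ∩ cen (a * γ * g0 * (a * γ)⁻¹)).card * Q ≤ 4 * Q := Nat.mul_le_mul_right _ hc
        omega
      obtain ⟨g', hg', hr', hcen⟩ := key _ (regconj g0 (a * γ) hg0r) hgt
      rw [hcen]
      exact hrr g' hg' hr'
    intro γ hγ
    induction hγ using Subgroup.closure_induction_left with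
    | one => simpa using base
    | mul_left x hx y hy ih => exact stepH x hx y ih
    | inv_mul_cancel x hx y hy ih => exact stepH x⁻¹ (hs x hx) y ih
  refine ⟨g0, hHΓ _ _ hg0, hg0r, R, by omega, hRs, by simpa using all 1 (one_mem _), ?_⟩
  exact pivot_count h2 (H ^ 2) Γ g0 hg0r R all

end IUC
end

section
open Finset
open scoped Pointwise
set_option maxHeartbeats 400000
set_option linter.unusedSectionVars false
namespace IUC

section grp
variable {G : Type*} [Group G] [Fintype G] [DecidableEq G]

def cn (y : G) : Finset G := univ.filter (fun x => x * y = y * x)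

lemma mem_cn {x y : G} : x ∈ cn y ↔ x * y = y * x := by simp [cn]

lemma cn_conj {k x y : G} : k * x * k⁻¹ ∈ cn (k * y * k⁻¹) ↔ x ∈ cn y := by
  rw [mem_cn, mem_cn]
  have e1 : k * x * k⁻¹ * (k * y * k⁻¹) = k * (x * y) * k⁻¹ := by group
  have e2 : k * y * k⁻¹ * (k * x * k⁻¹) = k * (y * x) * k⁻¹ := by group
  rw [e1, e2]; simp

variable (Z : Finset G)

def Scl (y : G) : Finset G := univ.filter (fun x => x ∉ Z ∧ ∃ h : G, h * x * h⁻¹ ∈ cn y)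

structure ZData : Prop where
  one : (1 : G) ∈ Z
  conj : ∀ x k : G, k * x * k⁻¹ ∈ Z ↔ x ∈ Z
  comm : ∀ x ∈ Z, ∀ y : G, x * y = y * x
  tr : ∀ g : G, g ∉ Z → ∀ x y : G, x * g = g * x → y * g = g * y → x * y = y * x
  inv : ∀ x : G, x ∉ Z → ∀ k : G, k * x * k⁻¹ * x = x * (k * x * k⁻¹) → k * x * k⁻¹ = x ∨ k * x * k⁻¹ = x⁻¹
  dvd : ∀ x : G, Z.card ∣ (cn x).card

variable {Z}

lemma ZData.cn_eq (D : ZData Z) {x y : G} (hx : x ∉ Z) (hy : y ∉ Z) (h : x ∈ cn y) : cn x = cn y := by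
  rw [mem_cn] at h
  ext w
  rw [mem_cn, mem_cn]
  constructor
  · intro hw; exact D.tr x hx w y hw h.symm
  · intro hw; exact D.tr y hy w x hw h

lemma ZData.scl_count (D : ZData Z) {y : G} (hy : y ∉ Z) :
    ∃ N, (N = (cn y).card ∨ N = 2 * (cn y).card) ∧ N ≤ Fintype.card G ∧
      N * (Scl Z y).card = Fintype.card G * ((cn y).card - Z.card) := by
  set NN : Finset G := univ.filter (fun k => k * y * k⁻¹ ∈ cn y) with hNN
  refine ⟨NN.card, ?_, Finset.card_le_univ _, ?_⟩
  · by_cases hex : ∃ k0 ∈ NN, k0 * y * k0⁻¹ ≠ y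
    · right
      obtain ⟨k0, hk0, hne⟩ := hex
      have hk0' := (Finset.mem_filter.1 hk0).2
      have hk0i : k0 * y * k0⁻¹ = y⁻¹ := (D.inv y hy k0 (mem_cn.1 hk0')).resolve_left hne
      have hyy : y ≠ y⁻¹ := fun h => hne (hk0i.trans h.symm)
      have : NN = cn y ∪ (cn y).image (fun c => k0 * c) := by
        ext k
        simp only [hNN, Finset.mem_filter, Finset.mem_univ, true_and, Finset.mem_union, Finset.mem_image, mem_cn]
        constructor
        · intro h
          rcases D.inv y hy k h with h1 | h1
          · left
            calc k * y = k * y * k⁻¹ * k := by group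
              _ = y * k := by rw [h1]
          · right
            refine ⟨k0⁻¹ * k, ?_, by group⟩
            have e : k * y = y⁻¹ * k := by rw [← h1]; group
            have e' : k0⁻¹ * y⁻¹ = y * k0⁻¹ := by rw [← hk0i]; group
            rw [mul_assoc, e, ← mul_assoc, e', mul_assoc]
        · rintro (h | ⟨c, hc, rfl⟩)
          · rw [h]; simp
          · have : k0 * c * y * (k0 * c)⁻¹ = y⁻¹ := by
              rw [← hk0i, mul_assoc k0 c y, hc]; group
            rw [this]; simp
      rw [this, Finset.card_union_of_disjoint, Finset.card_image_of_injective _ (mul_right_injective k0)]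
      · ring
      · rw [Finset.disjoint_left]
        rintro k hk hk'
        obtain ⟨c, hc, rfl⟩ := Finset.mem_image.1 hk'
        rw [mem_cn] at hk hc
        apply hne
        have : k0 * y * c = y * k0 * c := by rw [mul_assoc, ← hc, ← mul_assoc, hk, mul_assoc]
        have := mul_right_cancel this
        rw [this]; group
    · left
      push Not at hex
      congr 1
      ext k
      rw [mem_cn]
      constructor
      · intro h
        have := hex k h
        calc k * y = k * y * k⁻¹ * k := by group
          _ = y * k := by rw [this]
      · intro h
        simp only [hNN, Finset.mem_filter, Finset.mem_univ, true_and]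
        rw [h, mem_cn]; simp
  · have hZc : Z ⊆ cn y := fun x hx => mem_cn.2 (D.comm x hx y)
    rw [← Finset.card_sdiff_of_subset hZc, ← Finset.card_univ, ← Finset.card_product univ]
    set P := (univ : Finset G) ×ˢ (cn y \ Z) with hP
    set φ : G × G → G := fun p => p.1⁻¹ * p.2 * p.1 with hφ
    have hmaps : ∀ p ∈ P, φ p ∈ Scl Z y := by
      rintro ⟨h, x⟩ hp
      simp only [hP, Finset.mem_product, Finset.mem_sdiff, Finset.mem_univ, true_and] at hp
      simp only [Scl, hφ, Finset.mem_filter, Finset.mem_univ, true_and]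
      refine ⟨?_, h, ?_⟩
      · have := D.conj x h⁻¹
        rw [inv_inv] at this
        rw [this]; exact hp.2
      · have : h * (h⁻¹ * x * h) * h⁻¹ = x := by group
        rw [this]; exact hp.1
    rw [Finset.card_eq_sum_card_fiberwise (s := P) (f := φ) (t := Scl Z y) hmaps]
    rw [Finset.sum_const_nat (m := NN.card), mul_comm]
    intro w hw
    simp only [Scl, Finset.mem_filter, Finset.mem_univ, true_and] at hw
    obtain ⟨hwZ, h0, hw0⟩ := hw
    set x0 := h0 * w * h0⁻¹ with hx0
    have hx0Z : x0 ∉ Z := by rw [hx0, D.conj]; exact hwZ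
    have hcx : cn x0 = cn y := D.cn_eq hx0Z hy hw0
    -- characterization of NN
    have hchar : ∀ k, k ∈ NN ↔ k * x0 * k⁻¹ ∈ cn y := by
      intro k
      simp only [hNN, Finset.mem_filter, Finset.mem_univ, true_and]
      have hyk : k * y * k⁻¹ ∉ Z := by rw [D.conj]; exact hy
      have hxk : k * x0 * k⁻¹ ∉ Z := by rw [D.conj]; exact hx0Z
      have hxy : k * x0 * k⁻¹ ∈ cn (k * y * k⁻¹) := cn_conj.2 hw0
      have e := D.cn_eq hxk hyk hxy
      have sym : ∀ a b : G, a ∈ cn b ↔ b ∈ cn a := fun a b => by rw [mem_cn, mem_cn, eq_comm]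
      rw [sym, ← e, sym]
    apply Finset.card_bij (fun p _ => p.1 * h0⁻¹)
    · rintro ⟨h, x⟩ hp
      simp only [hP, hφ, Finset.mem_filter, Finset.mem_product, Finset.mem_sdiff, Finset.mem_univ, true_and] at hp
      rw [hchar]
      have : h * h0⁻¹ * x0 * (h * h0⁻¹)⁻¹ = x := by
        rw [hx0, ← hp.2]; group
      rw [this]; exact hp.1.1
    · rintro ⟨h, x⟩ hp ⟨h', x'⟩ hp' e
      simp only [hφ, Finset.mem_filter] at hp hp' e
      have e1 : h = h' := mul_right_cancel e
      subst e1
      have := mul_right_cancel (hp.2.trans hp'.2.symm)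
      rw [mul_left_cancel this]
    · intro k hk
      rw [hchar] at hk
      refine ⟨(k * h0, k * x0 * k⁻¹), ?_, by simp⟩
      simp only [hP, hφ, Finset.mem_filter, Finset.mem_product, Finset.mem_sdiff, Finset.mem_univ, true_and]
      refine ⟨⟨hk, ?_⟩, ?_⟩
      · rw [D.conj]; exact hx0Z
      · rw [hx0]; group

lemma ZData.scl_self {y : G} (hy : y ∉ Z) : y ∈ Scl Z y := by
  simp only [Scl, Finset.mem_filter, Finset.mem_univ, true_and]
  exact ⟨hy, 1, by simp [mem_cn]⟩

lemma ZData.scl_disj (D : ZData Z) {y y' : G} (hy : y ∉ Z) (hy' : y' ∉ Z) (h : y' ∉ Scl Z y) : Disjoint (Scl Z y) (Scl Z y') := by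
  rw [Finset.disjoint_left]
  intro x hx hx'
  simp only [Scl, Finset.mem_filter, Finset.mem_univ, true_and] at hx hx' h
  obtain ⟨hxZ, a, ha⟩ := hx
  obtain ⟨-, b, hb⟩ := hx'
  apply h
  refine ⟨hy', a * b⁻¹, ?_⟩
  have hbZ : b * x * b⁻¹ ∉ Z := by rw [D.conj]; exact hxZ
  have haZ : a * x * a⁻¹ ∉ Z := by rw [D.conj]; exact hxZ
  have e1 : cn (a * x * a⁻¹) = cn y := D.cn_eq haZ hy ha
  have e2 : y' ∈ cn (b * x * b⁻¹) := by rw [D.cn_eq hbZ hy' hb]; simp [mem_cn]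
  rw [← e1]
  have e3 := (cn_conj (k := a * b⁻¹)).2 e2
  have e4 : a * b⁻¹ * (b * x * b⁻¹) * (a * b⁻¹)⁻¹ = a * x * a⁻¹ := by group
  rwa [e4] at e3

lemma type_arith (n z e s N : ℕ) (hz : 0 < z) (hn : 0 < n) (he : 2 ≤ e) (hN : N = e * z ∨ N = 2 * (e * z))
    (h : N * s = n * (e * z - z)) : (N = e * z ∧ e * s = n * (e - 1) ∧ (2 * s = n ∨ 2 * n ≤ 3 * s)) ∨
      (N = 2 * (e * z) ∧ 2 * (e * s) = n * (e - 1) ∧ (4 * s = n ∨ n ≤ 3 * s) ∧ 2 * s < n) := by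
  obtain ⟨f, rfl⟩ : ∃ f, e = f + 1 := ⟨e - 1, by omega⟩
  have hf : 1 ≤ f := by omega
  have e0 : (f + 1) * z - z = f * z := by rw [add_mul, one_mul]; omega
  rw [e0] at h
  simp only [Nat.add_sub_cancel]
  rcases hN with hN | hN
  · left
    refine ⟨hN, ?_⟩
    rw [hN] at h
    have h1 : (f + 1) * s = n * f := by
      have : ((f + 1) * s) * z = (n * f) * z := by linarith
      exact Nat.eq_of_mul_eq_mul_right hz this
    refine ⟨h1, ?_⟩
    rcases Nat.lt_or_ge f 2 with h2 | h2
    · have : f = 1 := by omega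
      subst this; left; omega
    · right
      by_contra hc
      push Not at hc
      have : (f + 1) * (3 * s) < (f + 1) * (2 * n) := Nat.mul_lt_mul_of_pos_left hc (by omega)
      nlinarith
  · right
    refine ⟨hN, ?_⟩
    rw [hN] at h
    have h1 : 2 * ((f + 1) * s) = n * f := by
      have : (2 * ((f + 1) * s)) * z = (n * f) * z := by linarith
      exact Nat.eq_of_mul_eq_mul_right hz this
    refine ⟨h1, ?_, ?_⟩
    · rcases Nat.lt_or_ge f 2 with h2 | h2
      · have : f = 1 := by omega
        subst this; left; omega
      · right
        by_contra hc
        push Not at hc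
        have : (f + 1) * (3 * s) < (f + 1) * n := Nat.mul_lt_mul_of_pos_left hc (by omega)
        nlinarith
    · by_contra hc
      push Not at hc
      have : (f + 1) * n ≤ (f + 1) * (2 * s) := Nat.mul_le_mul_left _ hc
      nlinarith

lemma ZData.main (D : ZData Z) {y : G} (hy : y ∉ Z) (h7 : 7 * Z.card ≤ (cn y).card) : Fintype.card G ≤ 2 * (cn y).card := by
  set n := Fintype.card G with hn
  have hn0 : 0 < n := Fintype.card_pos
  set z := Z.card with hz
  have hz0 : 0 < z := Finset.card_pos.2 ⟨1, D.one⟩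
  have hZc : ∀ y, Z ⊆ cn y := fun y x hx => mem_cn.2 (D.comm x hx y)
  have types : ∀ x, x ∉ Z → ∃ e N, 2 ≤ e ∧ (cn x).card = e * z ∧ N ≤ n ∧
      ((N = e * z ∧ e * (Scl Z x).card = n * (e - 1) ∧ (2 * (Scl Z x).card = n ∨ 2 * n ≤ 3 * (Scl Z x).card)) ∨
      (N = 2 * (e * z) ∧ 2 * (e * (Scl Z x).card) = n * (e - 1) ∧ (4 * (Scl Z x).card = n ∨ n ≤ 3 * (Scl Z x).card) ∧ 2 * (Scl Z x).card < n)) := by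
    intro x hx
    obtain ⟨N, h1, h2, h3⟩ := D.scl_count hx
    obtain ⟨e, he⟩ := D.dvd x
    rw [mul_comm, ← hz] at he
    have hlt : z < (cn x).card := Finset.card_lt_card ⟨hZc x, fun h => hx (h (by simp [mem_cn]))⟩
    have he2 : 2 ≤ e := by
      by_contra hc
      have : e ≤ 1 := by omega
      have : e * z ≤ 1 * z := Nat.mul_le_mul_right _ this
      omega
    refine ⟨e, N, he2, he, h2, ?_⟩
    rw [he] at h1 h3
    exact type_arith n z e _ N hz0 hn0 he2 h1 h3
  have hdis : ∀ x, x ∉ Z → Disjoint Z (Scl Z x) := by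
    intro x hx
    rw [Finset.disjoint_left]
    intro w hw hw'
    exact (Finset.mem_filter.1 hw').2.1 hw
  -- existence of new class given a set
  have new : ∀ S : Finset G, S.card < n → ∃ w, w ∉ S := by
    intro S hS
    by_contra hc
    push Not at hc
    have : S = univ := Finset.eq_univ_iff_forall.2 hc
    rw [this, Finset.card_univ] at hS
    omega
  obtain ⟨e0, N0, he0, hc0, hN0, ht0⟩ := types y hy
  have he7 : 7 ≤ e0 := by
    rw [hc0] at h7
    exact Nat.le_of_mul_le_mul_right h7 hz0
  rw [hc0]
  by_contra hcon
  push Not at hcon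
  set s0 := (Scl Z y).card with hs0
  have c0 : (Z ∪ Scl Z y).card = z + s0 := Finset.card_union_of_disjoint (hdis y hy)
  obtain ⟨f, rfl⟩ : ∃ f, e0 = f + 1 := ⟨e0 - 1, by omega⟩
  simp only [Nat.add_sub_cancel] at ht0
  rcases ht0 with ⟨hN, hs, -⟩ | ⟨hN, hs, -, -⟩
  · have b1 : 6 * n ≤ 7 * s0 := by
      by_contra hc
      push Not at hc
      have : (f + 1) * (7 * s0) < (f + 1) * (6 * n) := Nat.mul_lt_mul_of_pos_left hc (by omega)
      nlinarith
    have b2 : z + s0 < n := by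
      by_contra hc
      push Not at hc
      have : (f + 1) * n ≤ (f + 1) * (z + s0) := Nat.mul_le_mul_left _ hc
      nlinarith
    obtain ⟨y1, hy1⟩ := new _ (by rw [c0]; exact b2)
    rw [Finset.mem_union, not_or] at hy1
    obtain ⟨e1, N1, he1, hc1, hN1, ht1⟩ := types y1 hy1.1
    have d := D.scl_disj hy hy1.1 hy1.2
    have := Finset.card_le_univ (Scl Z y ∪ Scl Z y1)
    rw [Finset.card_union_of_disjoint d] at this
    omega
  · have b1 : 3 * n ≤ 7 * s0 := by
      by_contra hc
      push Not at hc
      have : (f + 1) * (7 * s0) < (f + 1) * (3 * n) := Nat.mul_lt_mul_of_pos_left hc (by omega)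
      nlinarith
    have b2 : 2 * z + 2 * s0 < n := by
      by_contra hc
      push Not at hc
      have : (f + 1) * n ≤ (f + 1) * (2 * z + 2 * s0) := Nat.mul_le_mul_left _ hc
      nlinarith
    obtain ⟨y1, hy1⟩ := new _ (by rw [c0]; omega)
    rw [Finset.mem_union, not_or] at hy1
    obtain ⟨e1, N1, he1, hc1, hN1, ht1⟩ := types y1 hy1.1
    have d1 := D.scl_disj hy hy1.1 hy1.2
    set s1 := (Scl Z y1).card with hs1
    have c1 : (Z ∪ Scl Z y ∪ Scl Z y1).card = z + s0 + s1 := by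
      rw [Finset.card_union_of_disjoint, c0]
      rw [Finset.disjoint_union_left]; exact ⟨hdis y1 hy1.1, d1⟩
    have t1 := Finset.card_le_univ (Z ∪ Scl Z y ∪ Scl Z y1)
    rw [c1] at t1
    obtain ⟨y2, hy2⟩ := new (Z ∪ Scl Z y ∪ Scl Z y1) (by rw [c1]; omega)
    simp only [Finset.mem_union, not_or] at hy2
    obtain ⟨e2, N2, he2, hc2, hN2, ht2⟩ := types y2 hy2.1.1
    have d02 := D.scl_disj hy hy2.1.1 hy2.1.2
    have d12 := D.scl_disj hy1.1 hy2.1.1 hy2.2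
    set s2 := (Scl Z y2).card with hs2
    have c2 : (Z ∪ Scl Z y ∪ Scl Z y1 ∪ Scl Z y2).card = z + s0 + s1 + s2 := by
      rw [Finset.card_union_of_disjoint, c1]
      rw [Finset.disjoint_union_left, Finset.disjoint_union_left]; exact ⟨⟨hdis y2 hy2.1.1, d02⟩, d12⟩
    have t2 := Finset.card_le_univ (Z ∪ Scl Z y ∪ Scl Z y1 ∪ Scl Z y2)
    rw [c2] at t2
    obtain ⟨y3, hy3⟩ := new (Z ∪ Scl Z y ∪ Scl Z y1 ∪ Scl Z y2) (by rw [c2]; omega)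
    simp only [Finset.mem_union, not_or] at hy3
    obtain ⟨e3, N3, he3, hc3, hN3, ht3⟩ := types y3 hy3.1.1.1
    have d03 := D.scl_disj hy hy3.1.1.1 hy3.1.1.2
    have d13 := D.scl_disj hy1.1 hy3.1.1.1 hy3.1.2
    have d23 := D.scl_disj hy2.1.1 hy3.1.1.1 hy3.2
    set s3 := (Scl Z y3).card with hs3
    have t3 := Finset.card_le_univ (Z ∪ Scl Z y ∪ Scl Z y1 ∪ Scl Z y2 ∪ Scl Z y3)
    rw [Finset.card_union_of_disjoint (by
      rw [Finset.disjoint_union_left, Finset.disjoint_union_left, Finset.disjoint_union_left]; exact ⟨⟨⟨hdis y3 hy3.1.1.1, d03⟩, d13⟩, d23⟩), c2] at t3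
    omega

end grp
end IUC
end

section
open Finset
open scoped Pointwise
set_option maxHeartbeats 400000
set_option linter.unusedSectionVars false
namespace IUC

section
variable {F : Type*} [Field F] [DecidableEq F] [Fintype F]

lemma nonsc_conj (x k : SL F) : nonsc (k * x * k⁻¹) ↔ nonsc x := by
  have key : ∀ (c : M2 F) (x k : SL F), (∀ y : M2 F, c * y = y * c) → (x : M2 F) = c → ((k * x * k⁻¹ : SL F) : M2 F) = c := by
    intro c x k hc hx
    rw [Matrix.SpecialLinearGroup.coe_mul, Matrix.SpecialLinearGroup.coe_mul, hx, ← hc, mul_assoc, ← Matrix.SpecialLinearGroup.coe_mul]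
    simp
  have key2 : ∀ (x k : SL F), nonsc (k * x * k⁻¹) → nonsc x := by
    intro x k h
    exact ⟨fun e => h.1 (key 1 x k (by simp) e), fun e => h.2 (key (-1) x k (by simp) e)⟩
  constructor
  · exact key2 x k
  · intro h
    apply key2 _ k⁻¹
    have : k⁻¹ * (k * x * k⁻¹) * k⁻¹⁻¹ = x := by group
    rw [this]; exact h

lemma not_nonsc_iff (x : SL F) : ¬ nonsc x ↔ (x : M2 F) = 1 ∨ (x : M2 F) = -1 := by
  simp only [nonsc, not_and_or, not_not]

open Classical in
lemma zdata (two : (2 : F) ≠ 0) (Γ : Subgroup (SL F)) (hno : ∀ u ∈ Γ, (u : M2 F).trace = 2 → (u : M2 F) = 1) :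
    ZData (G := Γ) (univ.filter (fun x : Γ => ¬ nonsc (x : SL F))) := by
  have hno2 : ∀ u ∈ Γ, nonsc u → (u : M2 F).trace ≠ 2 ∧ (u : M2 F).trace ≠ -2 := by
    intro u hu hn
    refine ⟨fun h => hn.1 (hno u hu h), fun h => ?_⟩
    have hsq : ((u * u : SL F) : M2 F) = (-2 : F) • (u : M2 F) - 1 := by
      rw [Matrix.SpecialLinearGroup.coe_mul, cayley _ u.2, h]
    have h4 := hno (u * u) (mul_mem hu hu) (by
      rw [hsq, Matrix.trace_sub, Matrix.trace_smul, h]; simp; norm_num)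
    rw [hsq] at h4
    apply hn.2
    have h5 : (-2 : F) • (u : M2 F) = (-2 : F) • (-1 : M2 F) := by
      rw [sub_eq_iff_eq_add.1 h4]
      rw [smul_neg, neg_smul, neg_neg, two_smul]
    exact smul_right_injective _ (neg_ne_zero.2 two) h5
  have cm : ∀ x : SL F, ¬ nonsc x → ∀ y, x * y = y * x := by
    intro x hx y
    rw [not_nonsc_iff] at hx
    rw [coe_comm]
    rcases hx with h | h <;> rw [h] <;> simp
  have memZ : ∀ x : Γ, x ∈ univ.filter (fun x : Γ => ¬ nonsc (x : SL F)) ↔ ¬ nonsc (x : SL F) := by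
    intro x; simp
  refine ⟨?_, ?_, ?_, ?_, ?_, ?_⟩
  · rw [memZ, not_nonsc_iff]; simp
  · intro x k
    rw [memZ, memZ, not_iff_not]
    exact nonsc_conj (x : SL F) k
  · intro x hx y
    rw [memZ] at hx
    exact Subtype.ext (cm _ hx _)
  · intro g hg x y hx hy
    rw [memZ, not_not] at hg
    exact Subtype.ext (comm_trans hg (congrArg Subtype.val hx) (congrArg Subtype.val hy))
  · intro x hx k h
    rw [memZ, not_not] at hx
    have ht := hno2 x x.2 hx
    rcases same_tr (x := (x : SL F)) (y := (k * x * k⁻¹ : SL F)) ht.1 ht.2 two (congrArg Subtype.val h) (conj_trace _ _) with h1 | h1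
    · left; exact Subtype.ext h1
    · right; exact Subtype.ext h1
  · intro x
    let Zs : Subgroup Γ :=
      { carrier := {x | ¬ nonsc (x : SL F)}
        one_mem' := by
          show ¬ nonsc ((1 : Γ) : SL F)
          rw [not_nonsc_iff]; simp
        mul_mem' := by
          intro a b ha hb
          have ha' : ¬ nonsc (a : SL F) := ha
          have hb' : ¬ nonsc (b : SL F) := hb
          show ¬ nonsc ((a * b : Γ) : SL F)
          rw [not_nonsc_iff] at *
          rw [Subgroup.coe_mul, Matrix.SpecialLinearGroup.coe_mul]
          rcases ha' with h | h <;> rcases hb' with h' | h' <;> simp [h, h']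
        inv_mem' := by
          intro a ha
          have ha' : ¬ nonsc (a : SL F) := ha
          show ¬ nonsc ((a⁻¹ : Γ) : SL F)
          rw [not_nonsc_iff] at *
          rw [Subgroup.coe_inv, inv_coe]
          rcases ha' with h | h
          · left; rw [h]; simp; rw [two_smul]; simp
          · right; rw [h]; simp; rw [two_smul]; simp }
    have hle : Zs ≤ Subgroup.centralizer {x} := by
      intro a ha
      have ha' : ¬ nonsc (a : SL F) := ha
      rw [Subgroup.mem_centralizer_singleton_iff]
      exact Subtype.ext (cm _ ha' _)
    have := Subgroup.card_dvd_of_le hle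
    have e1 : Nat.card Zs = (univ.filter (fun x : Γ => ¬ nonsc (x : SL F))).card := by
      rw [Nat.card_eq_fintype_card, ← Fintype.card_subtype]
      apply Fintype.card_congr
      exact Equiv.refl _
    have e2 : Nat.card (Subgroup.centralizer {x}) = (cn x).card := by
      rw [Nat.card_eq_fintype_card]
      unfold cn
      rw [← Fintype.card_subtype]
      apply Fintype.card_congr
      apply Equiv.subtypeEquivRight
      intro a
      rw [Subgroup.mem_centralizer_singleton_iff]
    rwa [e1, e2] at this

end

section
variable {K : Type*} [Field K] [IsAlgClosed K]

lemma exists_iso (two : (2 : K) ≠ 0) (g : M2 K) : ∃ E : M2 K, E ≠ 0 ∧ E.det = 0 ∧ E.trace = 0 ∧ (E * g).trace = 0 := by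
  by_cases h : g 1 0 = 0
  · exact ⟨np none, np_ne _, np_det _, np_trace _, by
      rw [Matrix.trace_fin_two, Matrix.mul_apply, Matrix.mul_apply]; simp [np, Fin.sum_univ_two, h]⟩
  · obtain ⟨d, hd⟩ := IsAlgClosed.exists_pow_nat_eq ((g 0 0 - g 1 1) ^ 2 + 4 * g 0 1 * g 1 0) (n := 2) (by norm_num)
    refine ⟨np (some ((g 0 0 - g 1 1 + d) / (2 * g 1 0))), np_ne _, np_det _, np_trace _, ?_⟩
    rw [Matrix.trace_fin_two, Matrix.mul_apply, Matrix.mul_apply]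
    simp [np, Fin.sum_univ_two]
    field_simp
    linear_combination -hd

end

section
variable {q : ℕ} [Fact q.Prime] {K : Type*} [Field K] [IsAlgClosed K] [Algebra (ZMod q) K]

/-- reduction of SL2 to matrices over `K` -/
def toK (x : SL (ZMod q)) : M2 K := (x : M2 (ZMod q)).map (algebraMap (ZMod q) K)

lemma toK_mul (x y : SL (ZMod q)) : (toK (x * y) : M2 K) = toK x * toK y := by
  simp [toK, Matrix.map_mul]

lemma toK_det (x : SL (ZMod q)) : (toK x : M2 K).det = 1 := by
  have := (RingHom.map_det (algebraMap (ZMod q) K) (x : M2 (ZMod q)))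
  rw [x.2, map_one] at this
  exact this.symm

lemma toK_one : (toK (1 : SL (ZMod q)) : M2 K) = 1 := by
  simp [toK]

theorem growth (hq2 : (2 : ZMod q) ≠ 0) (hq3 : (3 : ZMod q) ≠ 0) {n : ℕ} (hn : 128 ≤ n) (H : Finset (SL (ZMod q))) (h1 : 1 ∈ H) (hs : ∀ x ∈ H, x⁻¹ ∈ H)
    (Q : ℕ) (hQ1 : 1 ≤ Q) (hQ : (H ^ n).card ≤ Q * H.card) (hbig : 10 ^ 7 * Q ^ 5 ≤ H.card) :
    (∃ E1 E2 : M2 K, E1 ≠ 0 ∧ E1.det = 0 ∧ E2 ≠ 0 ∧ E2.det = 0 ∧ ∀ h ∈ H, (E1 * toK h).trace = 0 ∨ (E2 * toK h).trace = 0) ∨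
    q ^ 6 ≤ 10 ^ 7 * Q ^ 5 * H.card ^ 2 := by
  classical
  have two : (2 : K) ≠ 0 := by
    intro h
    apply hq2
    apply (algebraMap (ZMod q) K).injective
    rw [map_ofNat, map_zero]; exact h
  have mapinj : ∀ A : M2 (ZMod q), A ≠ 0 → (A.map (algebraMap (ZMod q) K)) ≠ 0 := by
    intro A hA h
    apply hA
    ext i j
    have := congrFun (congrFun h i) j
    apply (algebraMap (ZMod q) K).injective
    simpa using this
  by_cases hfix : ∀ p : Option (ZMod q), ∃ h ∈ H, ((h : M2 (ZMod q)) * np p).trace ≠ 0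
  swap
  · push Not at hfix
    obtain ⟨p, hp⟩ := hfix
    left
    have hE : ((np p).map (algebraMap (ZMod q) K)).det = 0 := by
      have := (RingHom.map_det (algebraMap (ZMod q) K) (np p))
      rw [np_det, map_zero] at this
      exact this.symm
    refine ⟨(np p).map (algebraMap (ZMod q) K), (np p).map (algebraMap (ZMod q) K), mapinj _ (np_ne p), hE, mapinj _ (np_ne p), hE, ?_⟩
    intro h hh
    left
    have := hp h hh
    rw [Matrix.trace_mul_comm] at this
    rw [toK, ← Matrix.map_mul, ← AddMonoidHom.map_trace, this, map_zero]
  obtain ⟨g, hgΓ, hgr, R, hR14, hRH, hRc, hcount⟩ := pivot hn hq2 hq3 H h1 hs hfix Q hQ1 hQ hbig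
  set Γ := Subgroup.closure (H : Set (SL (ZMod q))) with hΓ
  have hqp : q.Prime := Fact.out
  by_cases hno : ∀ u ∈ Γ, (u : M2 (ZMod q)).trace = 2 → (u : M2 (ZMod q)) = 1
  swap
  · right
    push Not at hno
    obtain ⟨u, huΓ, ht, hne⟩ := hno
    set N : M2 (ZMod q) := (u : M2 (ZMod q)) - 1 with hN
    have hn0 : N ≠ 0 := sub_ne_zero.2 hne
    have hnt : N.trace = 0 := by simp [hN, Matrix.trace_sub, ht]
    have hnd : N.det = 0 := by rw [hN, det_sub_one _ u.2, ht]; ring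
    have hnn : N * N = 0 := sq_zero hnt hnd
    obtain ⟨p, c, hc0, hnp⟩ := exists_np hnt hnd hn0
    obtain ⟨h, hh, hhp⟩ := hfix p
    have hhn : ((h : M2 (ZMod q)) * N).trace ≠ 0 := by
      rw [hnp]; simp [hc0, hhp]
    have hpow : ∀ k : ℕ, ((u ^ k : SL (ZMod q)) : M2 (ZMod q)) = 1 + (k : ZMod q) • N := by
      intro k
      induction k with
      | zero => simp
      | succ k ih =>
        rw [pow_succ, Matrix.SpecialLinearGroup.coe_mul, ih]
        have : (u : M2 (ZMod q)) = 1 + N := by simp [hN]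
        rw [this, add_mul, mul_add, Matrix.smul_mul, mul_add, hnn]
        simp [add_smul]; abel
    set Γf : Finset (SL (ZMod q)) := univ.filter (fun x : SL (ZMod q) => x ∈ Γ) with hΓf
    have hcard : Nat.card Γ = Γf.card := by
      rw [Nat.card_eq_fintype_card, Fintype.card_subtype]
    set Y : Finset (SL (ZMod q)) := (Finset.range q).image (fun k => u ^ k) with hY
    have hYc : Y.card = q := by
      rw [hY, Finset.card_image_of_injOn, Finset.card_range]
      intro a ha b hb hab
      have ha' : a < q := by simpa using ha
      have hb' : b < q := by simpa using hb
      have e : ((u ^ a : SL (ZMod q)) : M2 (ZMod q)) = ((u ^ b : SL (ZMod q)) : M2 (ZMod q)) := congrArg Subtype.val hab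
      rw [hpow, hpow] at e
      have e2 : ((a : ZMod q) - b) • N = 0 := by
        rw [sub_smul, sub_eq_zero]; exact add_left_cancel e
      have e3 : (a : ZMod q) = b := sub_eq_zero.1 ((smul_eq_zero.1 e2).resolve_right hn0)
      rw [ZMod.natCast_eq_natCast_iff'] at e3
      rwa [Nat.mod_eq_of_lt ha', Nat.mod_eq_of_lt hb'] at e3
    have hYΓ : ∀ y ∈ Y, y ∈ Γ := by
      intro y hy
      obtain ⟨k, -, rfl⟩ := Finset.mem_image.1 hy
      exact pow_mem huΓ k
    have hhΓ : h ∈ Γ := Subgroup.subset_closure hh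
    have big := unip_count N hnt hnd Y (by
      intro y hy
      obtain ⟨k, -, rfl⟩ := Finset.mem_image.1 hy
      exact ⟨k, hpow k⟩) h hhn Γf (by
      intro x hx y hy z hz
      rw [hΓf, Finset.mem_filter]
      refine ⟨Finset.mem_univ _, ?_⟩
      exact mul_mem (mul_mem (mul_mem (mul_mem (hYΓ x hx) hhΓ) (hYΓ y hy)) (inv_mem hhΓ)) (hYΓ z hz))
    rw [hYc, ← hcard] at big
    have hcen := cen_card hgr.nonsc
    rw [ZMod.card] at hcen
    have hH2 : (H ^ 2).card ≤ Q * H.card := (pw_card h1 (by omega)).trans hQ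
    set X := H.card with hX
    have hX1 : 0 < X := Finset.card_pos.2 ⟨1, h1⟩
    have hq1 := hqp.two_le
    have s1 : q * q * (q - 1) * (R - 2) ≤ 2 * (Q * X) * (2 * q) := by
      calc q * q * (q - 1) * (R - 2) ≤ Nat.card Γ * (R - 2) := Nat.mul_le_mul_right _ big
        _ ≤ _ := hcount
        _ ≤ 2 * (Q * X) * (2 * q) := Nat.mul_le_mul (Nat.mul_le_mul_left _ hH2) hcen
    have s2 : q * q * R ≤ 16 * Q * X := by
      have a1 : q ≤ 2 * (q - 1) := by omega
      have a2 : R ≤ 2 * (R - 2) := by omega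
      have a3 : q * (q * q * R) ≤ q * (16 * Q * X) := by
        calc q * (q * q * R) ≤ (q * (q * (2 * (q - 1)) * (2 * (R - 2)))) := by gcongr
          _ = 4 * (q * q * (q - 1) * (R - 2)) := by ring
          _ ≤ 4 * (2 * (Q * X) * (2 * q)) := Nat.mul_le_mul_left _ s1
          _ = _ := by ring
      exact Nat.le_of_mul_le_mul_left a3 (by omega)
    have s3 : q ^ 6 * X ≤ (2985984 * Q ^ 5 * X ^ 2) * X := by
      calc q ^ 6 * X ≤ q ^ 6 * (729 * Q ^ 2 * R ^ 3) := Nat.mul_le_mul_left _ hRH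
        _ = 729 * Q ^ 2 * (q * q * R) ^ 3 := by ring
        _ ≤ 729 * Q ^ 2 * (16 * Q * X) ^ 3 := by gcongr
        _ = _ := by ring
    have s4 := Nat.le_of_mul_le_mul_right s3 hX1
    refine s4.trans ?_
    gcongr
    norm_num
  · left
    have D := zdata hq2 Γ hno
    set y : Γ := ⟨g, hgΓ⟩ with hy
    set Z := univ.filter (fun x : Γ => ¬ nonsc (x : SL (ZMod q))) with hZ
    have hyZ : y ∉ Z := by
      simp only [hZ, Finset.mem_filter, Finset.mem_univ, true_and, not_not]
      exact hgr.nonsc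
    have hZc : Z.card ≤ 2 := by
      have hci : (Z.image (fun x : Γ => ((x : SL (ZMod q)) : M2 (ZMod q)))).card = Z.card :=
        Finset.card_image_of_injective _ (fun a b h => Subtype.ext (Subtype.ext h))
      rw [← hci]
      refine (Finset.card_le_card ?_).trans (Finset.card_le_two (a := (1 : M2 (ZMod q))) (b := -1))
      intro e he
      obtain ⟨x, hx, rfl⟩ := Finset.mem_image.1 he
      have := (Finset.mem_filter.1 hx).2
      rw [not_nonsc_iff] at this
      simpa using this
    have hcy : R ≤ (cn y).card := by
      refine hRc.trans ?_
      have hci : ((cn y).image (fun x : Γ => (x : SL (ZMod q)))).card = (cn y).card :=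
        Finset.card_image_of_injective _ Subtype.val_injective
      rw [← hci]
      apply Finset.card_le_card
      intro x hx
      rw [Finset.mem_inter, mem_cen] at hx
      rw [Finset.mem_image]
      have hxΓ : x ∈ Γ := by
        have := hx.1
        rw [sq] at this
        obtain ⟨a, ha, b, hb, rfl⟩ := Finset.mem_mul.1 this
        exact mul_mem (Subgroup.subset_closure ha) (Subgroup.subset_closure hb)
      refine ⟨⟨x, hxΓ⟩, ?_, rfl⟩
      rw [mem_cn]
      exact Subtype.ext hx.2
    have main := D.main hyZ (by omega)
    obtain ⟨E, hE0, hEd, hEt, hEg⟩ := exists_iso two (toK g : M2 K)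
    have hEc : ∀ x ∈ cn y, (E * toK (x : SL (ZMod q))).trace = 0 := by
      intro x hx
      rw [mem_cn] at hx
      have hx' := coe_comm.1 (congrArg Subtype.val hx)
      obtain ⟨a, b, e⟩ := comm_param _ _ hgr.nonsc.ne_smul hx'
      have e2 : (toK (x : SL (ZMod q)) : M2 K) = (algebraMap (ZMod q) K a) • (1 : M2 K) + (algebraMap (ZMod q) K b) • toK g := by
        ext i j
        have := congrArg (algebraMap (ZMod q) K) (congrFun (congrFun e i) j)
        simp only [toK, Matrix.map_apply, Matrix.add_apply, Matrix.smul_apply, smul_eq_mul, map_add, map_mul] at this ⊢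
        rw [this]
        by_cases hij : i = j
        · subst hij; simp
        · simp [Matrix.one_apply, hij]
      rw [e2, mul_add, Matrix.trace_add]
      simp [hEt, hEg]
    by_cases hall : ∀ k : Γ, k ∈ cn y
    · refine ⟨E, E, hE0, hEd, hE0, hEd, ?_⟩
      intro h hh
      left
      exact hEc ⟨h, Subgroup.subset_closure hh⟩ (hall _)
    · push Not at hall
      obtain ⟨k, hk⟩ := hall
      have hun : cn y ∪ (cn y).image (fun c => k * c) = univ := by
        apply Finset.eq_univ_of_card
        apply le_antisymm (Finset.card_le_univ _)
        rw [Finset.card_union_of_disjoint, Finset.card_image_of_injective _ (mul_right_injective k)]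
        · omega
        · rw [Finset.disjoint_left]
          intro a ha ha'
          obtain ⟨c, hc, rfl⟩ := Finset.mem_image.1 ha'
          apply hk
          rw [mem_cn] at ha hc ⊢
          have : k * y * c = y * k * c := by rw [mul_assoc, ← hc, ← mul_assoc, ha, mul_assoc]
          exact mul_right_cancel this
      have hEk : E = E * toK ((k : SL (ZMod q))⁻¹) * toK (k : SL (ZMod q)) := by
        rw [mul_assoc, ← toK_mul, inv_mul_cancel, toK_one, mul_one]
      refine ⟨E, E * toK ((k : SL (ZMod q))⁻¹), hE0, hEd, ?_, ?_, ?_⟩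
      · intro h0
        rw [h0, zero_mul] at hEk
        exact hE0 hEk
      · rw [Matrix.det_mul, hEd, zero_mul]
      · intro h hh
        have hm := Finset.mem_univ (⟨h, Subgroup.subset_closure hh⟩ : Γ)
        rw [← hun, Finset.mem_union] at hm
        rcases hm with hm | hm
        · left; exact hEc _ hm
        · right
          obtain ⟨c, hc, hce⟩ := Finset.mem_image.1 hm
          have : h = (k : SL (ZMod q)) * c := (congrArg Subtype.val hce).symm
          rw [this, toK_mul, mul_assoc, ← mul_assoc (toK _) (toK _) (toK _), ← toK_mul, inv_mul_cancel, toK_one, one_mul]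
          exact hEc c hc
end
end IUC
end

section
open Finset
open scoped Pointwise
set_option maxHeartbeats 400000
set_option linter.unusedSectionVars false
namespace IUC

section
variable {q : ℕ} [Fact q.Prime] (K : Type*) [Field K] [IsAlgClosed K] [Algebra (ZMod q) K]

/-- non-concentration on rank-one hyperplane sections -/
def cnd (ν : SL (ZMod q) → ℝ) (a : ℝ) : Prop :=
  ∀ (E : M2 K) (P : SL (ZMod q) → Prop) [DecidablePred P], E ≠ 0 → E.det = 0 →
    (∀ g, P g → (E * toK g).trace = 0) → ∑ g, ν g * (if P g then (1:ℝ) else 0) ≤ a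

variable {K}

lemma toK_cancel (y : SL (ZMod q)) : (toK y : M2 K) * toK y⁻¹ = 1 := by
  rw [← toK_mul, mul_inv_cancel, toK_one]

lemma rk_mul {E : M2 K} (h0 : E ≠ 0) (hd : E.det = 0) (y : SL (ZMod q)) : E * toK y ≠ 0 ∧ (E * toK y).det = 0 := by
  constructor
  · intro h
    apply h0
    have : E * toK y * toK y⁻¹ = E := by rw [mul_assoc, toK_cancel, mul_one]
    rw [← this, h, zero_mul]
  · rw [Matrix.det_mul, hd, zero_mul]

lemma rk_mul' {E : M2 K} (h0 : E ≠ 0) (hd : E.det = 0) (y : SL (ZMod q)) : toK y * E ≠ 0 ∧ (toK y * E).det = 0 := by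
  constructor
  · intro h
    apply h0
    have : toK y⁻¹ * (toK y * E) = E := by rw [← mul_assoc, ← toK_mul, inv_mul_cancel, toK_one, one_mul]
    rw [← this, h, mul_zero]
  · rw [Matrix.det_mul, hd, mul_zero]

lemma cnd_conv {μ ν : SL (ZMod q) → ℝ} {a : ℝ} (h0 : ∀ x, 0 ≤ μ x) (h1 : ∑ x, μ x = 1) (h : cnd K ν a) :
    cnd K (conv μ ν) a := by
  intro E P _ hE hd hP
  rw [sum_conv_mul]
  calc ∑ y, ∑ z, μ y * ν z * (if P (y * z) then (1:ℝ) else 0) ≤ ∑ y, μ y * a := by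
        apply Finset.sum_le_sum
        intro y _
        have := h (E * toK y) (fun z => P (y * z)) (rk_mul hE hd y).1 (rk_mul hE hd y).2 (by
          intro g hg
          have := hP _ hg
          rwa [toK_mul, ← mul_assoc] at this)
        calc _ = μ y * ∑ z, ν z * (if P (y * z) then (1:ℝ) else 0) := by
              rw [Finset.mul_sum]; exact Finset.sum_congr rfl (fun z _ => by ring)
          _ ≤ _ := mul_le_mul_of_nonneg_left this (h0 y)
    _ = a := by rw [← Finset.sum_mul, h1, one_mul]

lemma cnd_pt {ν : SL (ZMod q) → ℝ} {a : ℝ} (h : cnd K ν a) (x : SL (ZMod q)) : ν x ≤ a := by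
  classical
  have h2 := rk_mul (K := K) (np_ne none) (np_det none) x⁻¹
  have := h (np none * toK x⁻¹) (fun g => g = x) h2.1 h2.2 (by
    rintro g rfl
    rw [mul_assoc, ← toK_mul, inv_mul_cancel, toK_one, mul_one, np_trace])
  simpa using this

lemma l2_le {ν : SL (ZMod q) → ℝ} {a : ℝ} (h0 : ∀ x, 0 ≤ ν x) (h1 : ∑ x, ν x = 1) (h : ∀ x, ν x ≤ a) :
    ∑ x, ν x ^ 2 ≤ a := by
  calc ∑ x, ν x ^ 2 ≤ ∑ x, ν x * a := by
        apply Finset.sum_le_sum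
        intro x _
        rw [sq]
        exact mul_le_mul_of_nonneg_left (h x) (h0 x)
    _ = a := by rw [← Finset.sum_mul, h1, one_mul]

theorem flat {T : ℝ} (hT : 2 ≤ T) {D L e : ℕ} (hL : 400000 ≤ L) (hD : 400000 + e ≤ D) (hq : (q:ℝ) = T ^ D) (hq5 : 5 ≤ q)
    {ν : SL (ZMod q) → ℝ} (h0 : ∀ x, 0 ≤ ν x) (h1 : ∑ x, ν x = 1) (hc : cnd K ν (T ^ L)⁻¹)
    (hM : 1 ≤ (∑ x, ν x ^ 2) * T ^ (2 * D + e)) : T * ∑ x, conv ν ν x ^ 2 < ∑ x, ν x ^ 2 := by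
  classical
  by_contra hcon
  push Not at hcon
  have hqp : q.Prime := Fact.out
  have hq2 : (2 : ZMod q) ≠ 0 := by
    intro h
    have : ((2 : ℕ) : ZMod q) = 0 := by exact_mod_cast h
    rw [ZMod.natCast_eq_zero_iff] at this
    have := Nat.le_of_dvd (by norm_num) this
    omega
  have hq3 : (3 : ZMod q) ≠ 0 := by
    intro h
    have : ((3 : ℕ) : ZMod q) = 0 := by exact_mod_cast h
    rw [ZMod.natCast_eq_zero_iff] at this
    have := Nat.le_of_dvd (by norm_num) this
    omega
  have hT0 : 0 < T := by linarith
  have hT1 : 1 < T := by linarith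
  have hTp : ∀ n : ℕ, 0 < T ^ n := fun n => pow_pos hT0 n
  obtain ⟨H, hH1, hHs, hHn, hlow, hup, c, hcc⟩ := bsg_main ν h0 h1 T hT _ rfl hcon
  set M := ∑ x, ν x ^ 2 with hMdef
  have hMle : M ≤ (T ^ L)⁻¹ := l2_le h0 h1 (cnd_pt hc)
  obtain ⟨n, hn⟩ : ∃ n : ℕ, n = 128 := ⟨_, rfl⟩
  obtain ⟨A, hA⟩ : ∃ A : ℕ, A = (549 * (n + 1)) * 5 + 29 := ⟨_, rfl⟩
  set Q : ℕ := ⌈T ^ (549 * (n + 1))⌉₊ with hQ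
  have hT549 : 1 ≤ T ^ (549 * (n + 1)) := one_le_pow₀ hT1.le
  have hQle : (Q:ℝ) ≤ 2 * T ^ (549 * (n + 1)) := by
    have := (Nat.ceil_lt_add_one (hTp (549 * (n + 1))).le).le
    rw [← hQ] at this
    linarith
  have hQ1 : 1 ≤ Q := by
    rw [hQ, Nat.one_le_ceil_iff]; exact hTp _
  have hQH : (H ^ n).card ≤ Q * H.card := by
    have := hHn n
    rw [← pow_mul] at this
    have h2 : ((H ^ n).card : ℝ) ≤ (Q:ℝ) * H.card := this.trans (by gcongr; exact Nat.le_ceil _)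
    exact_mod_cast h2
  have hQ5 : (10:ℝ) ^ 7 * (Q:ℝ) ^ 5 ≤ T ^ A := by
    calc (10:ℝ) ^ 7 * (Q:ℝ) ^ 5 ≤ 10 ^ 7 * (2 * T ^ (549 * (n + 1))) ^ 5 := by gcongr
      _ = (10 ^ 7 * 2 ^ 5) * (T ^ (549 * (n + 1))) ^ 5 := by ring
      _ ≤ T ^ 29 * (T ^ (549 * (n + 1))) ^ 5 := by
          gcongr
          calc (10:ℝ) ^ 7 * 2 ^ 5 ≤ 2 ^ 29 := by norm_num
            _ ≤ T ^ 29 := by gcongr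
      _ = T ^ A := by
          rw [← pow_mul, ← pow_add, hA]
          exact congrArg (fun k : ℕ => T ^ k) (add_comm _ _)
  have hHlow : T ^ (L - 310) ≤ (H.card : ℝ) := by
    have e1 : T ^ L = T ^ (L - 310) * T ^ 310 := by rw [← pow_add]; congr 1; omega
    have e2 : T ^ 310 * M * H.card ≤ T ^ 310 * (T ^ L)⁻¹ * H.card := by gcongr
    have e3 : T ^ 310 * (T ^ L)⁻¹ * H.card = H.card / T ^ (L - 310) := by
      rw [e1]
      have := (hTp 310).ne'
      have := (hTp (L-310)).ne'
      field_simp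
    have e4 : 1 ≤ H.card / T ^ (L - 310) := by rw [← e3]; exact hlow.trans e2
    rwa [le_div_iff₀ (hTp _), one_mul] at e4
  have hbig : 10 ^ 7 * Q ^ 5 ≤ H.card := by
    have : (10:ℝ) ^ 7 * (Q:ℝ) ^ 5 ≤ (H.card : ℝ) :=
      hQ5.trans ((pow_le_pow_right₀ hT1.le (by omega)).trans hHlow)
    exact_mod_cast this
  rcases growth (K := K) hq2 hq3 (n := n) (by omega) H hH1 hHs Q hQ1 hQH hbig with ⟨E1, E2, hE1, hd1, hE2, hd2, hall⟩ | hbad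
  · have r1 := rk_mul hE1 hd1 c⁻¹
    have r2 := rk_mul hE2 hd2 c⁻¹
    have b1 := hc _ (fun g => (E1 * toK c⁻¹ * toK g).trace = 0) r1.1 r1.2 (fun g h => h)
    have b2 := hc _ (fun g => (E2 * toK c⁻¹ * toK g).trace = 0) r2.1 r2.2 (fun g h => h)
    have b3 : ∑ x ∈ univ.filter (fun x => c⁻¹ * x ∈ H), ν x ≤ (T ^ L)⁻¹ + (T ^ L)⁻¹ := by
      refine le_trans ?_ (add_le_add b1 b2)
      rw [← Finset.sum_add_distrib, Finset.sum_filter]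
      apply Finset.sum_le_sum
      intro x _
      by_cases hx : c⁻¹ * x ∈ H
      · rw [if_pos hx]
        have := hall _ hx
        rw [toK_mul, ← mul_assoc, ← mul_assoc] at this
        have nx := h0 x
        rcases this with h | h
        · rw [if_pos h]
          split_ifs <;> simp <;> linarith
        · rw [if_pos h]
          split_ifs <;> simp <;> linarith
      · rw [if_neg hx]
        have nx := h0 x
        split_ifs <;> simp <;> linarith
    have b4 : 1 ≤ T ^ 317 * ((T ^ L)⁻¹ + (T ^ L)⁻¹) := hcc.trans (by gcongr)
    have b5 : T ^ L ≤ T ^ 317 * 2 := by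
      have e : T ^ 317 * ((T ^ L)⁻¹ + (T ^ L)⁻¹) = (T ^ 317 * 2) / T ^ L := by
        field_simp; ring
      rw [e, le_div_iff₀ (hTp _), one_mul] at b4
      exact b4
    have b6 : T ^ L ≤ T ^ 318 := by
      rw [pow_succ T 317]
      exact b5.trans (by gcongr)
    rw [pow_le_pow_iff_right₀ hT1] at b6
    omega
  · have c1 : (q:ℝ) ^ 6 ≤ T ^ A * (H.card:ℝ) ^ 2 := by
      have : (q:ℝ) ^ 6 ≤ 10 ^ 7 * (Q:ℝ) ^ 5 * (H.card:ℝ) ^ 2 := by exact_mod_cast hbad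
      refine this.trans ?_
      gcongr
    have c2 : (H.card : ℝ) ≤ T ^ (830 + (2 * D + e)) := by
      rw [pow_add]
      calc (H.card : ℝ) = H.card * 1 := by ring
        _ ≤ H.card * (M * T ^ (2 * D + e)) := by gcongr
        _ = (H.card * M) * T ^ (2 * D + e) := by ring
        _ ≤ _ := by gcongr
    have c3 : T ^ (D * 6) ≤ T ^ (A + (830 + (2 * D + e)) * 2) := by
      rw [pow_mul, ← hq, pow_add, pow_mul T (830 + (2 * D + e)) 2]
      refine c1.trans ?_
      gcongr
    rw [pow_le_pow_iff_right₀ hT1] at c3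
    omega

/-- iterated convolution square -/
noncomputable def dbl (ν : SL (ZMod q) → ℝ) : ℕ → SL (ZMod q) → ℝ
  | 0 => ν
  | k + 1 => conv (dbl ν k) (dbl ν k)

theorem flat_iter {T : ℝ} (hT : 2 ≤ T) {D L e : ℕ} (hL : 400000 ≤ L) (hD : 400000 + e ≤ D) (hq : (q:ℝ) = T ^ D) (hq5 : 5 ≤ q)
    {ν : SL (ZMod q) → ℝ} (h0 : ∀ x, 0 ≤ ν x) (h1 : ∑ x, ν x = 1) (hc : cnd K ν (T ^ L)⁻¹) :
    ∑ x, dbl ν (2 * D + e) x ^ 2 ≤ (T ^ (2 * D + e))⁻¹ := by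
  have hT0 : 0 < T := by linarith
  have hTp : ∀ n : ℕ, 0 < T ^ n := fun n => pow_pos hT0 n
  have key : ∀ k : ℕ, (∀ x, 0 ≤ dbl ν k x) ∧ (∑ x, dbl ν k x = 1) ∧ cnd K (dbl ν k) (T ^ L)⁻¹ := by
    intro k
    induction k with
    | zero => exact ⟨h0, h1, hc⟩
    | succ k ih =>
      obtain ⟨a, b, c⟩ := ih
      exact ⟨conv_nonneg a a, by rw [dbl, sum_conv, b, mul_one], cnd_conv a b c⟩
  have mono : ∀ k : ℕ, ∑ x, dbl ν (k + 1) x ^ 2 ≤ ∑ x, dbl ν k x ^ 2 := by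
    intro k
    obtain ⟨a, b, c⟩ := key (k + 1)
    exact l2_le a b (conv_self_le _)
  have main : ∀ k : ℕ, ∑ x, dbl ν k x ^ 2 ≤ (T ^ k)⁻¹ ∨ ∑ x, dbl ν k x ^ 2 ≤ (T ^ (2 * D + e))⁻¹ := by
    intro k
    induction k with
    | zero =>
      left
      simp only [pow_zero, inv_one]
      refine l2_le h0 h1 (fun x => ?_)
      rw [← h1]
      exact Finset.single_le_sum (f := ν) (fun i _ => h0 i) (Finset.mem_univ x)
    | succ k ih =>
      by_cases hs : ∑ x, dbl ν k x ^ 2 ≤ (T ^ (2 * D + e))⁻¹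
      · right
        exact (mono k).trans hs
      · left
        have ih' := ih.resolve_right hs
        push Not at hs
        obtain ⟨a, b, c⟩ := key k
        have := flat hT hL hD hq hq5 a b c (by
          rw [inv_eq_one_div, div_lt_iff₀ (hTp _)] at hs
          exact hs.le)
        have h3 : T * ∑ x, dbl ν (k + 1) x ^ 2 ≤ (T ^ k)⁻¹ := this.le.trans ih'
        rw [pow_succ, mul_inv, ← div_eq_mul_inv, le_div_iff₀ hT0, mul_comm]
        exact h3
  rcases main (2 * D + e) with h | h <;> exact h

end
end IUC
end

section
open Finset
open scoped Pointwise
set_option maxHeartbeats 400000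
set_option linter.unusedSectionVars false
namespace IUC

section
variable {Γ : Type*} [Group Γ]

/-- finite measures on a group as linear functionals -/
abbrev Mn (Γ : Type*) := (Γ → ℝ) →ₗ[ℝ] ℝ

/-- convolution of functionals -/
def cv (μ ν : Mn Γ) : Mn Γ where
  toFun f := μ (fun g => ν (fun h => f (g * h)))
  map_add' f f' := by
    rw [← map_add]
    congr 1
    funext g
    exact map_add ν _ _
  map_smul' c f := by
    rw [RingHom.id_apply, ← map_smul]
    congr 1
    funext g
    exact map_smul ν c _

lemma cv_apply (μ ν : Mn Γ) (f : Γ → ℝ) : cv μ ν f = μ (fun g => ν (fun h => f (g * h))) := rfl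

lemma cv_assoc (μ ν ρ : Mn Γ) : cv (cv μ ν) ρ = cv μ (cv ν ρ) := by
  ext f
  simp only [cv_apply, mul_assoc]

/-- probability functional supported on `S` -/
def IsP (μ : Mn Γ) (S : Set Γ) : Prop := (∀ f : Γ → ℝ, (∀ g ∈ S, 0 ≤ f g) → 0 ≤ μ f) ∧ μ (fun _ => 1) = 1

lemma IsP.cv {μ ν : Mn Γ} {S T U : Set Γ} (hμ : IsP μ S) (hν : IsP ν T) (h : ∀ g ∈ S, ∀ k ∈ T, g * k ∈ U) : IsP (cv μ ν) U := by
  constructor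
  · intro f hf
    exact hμ.1 _ (fun g hg => hν.1 _ (fun k hk => hf _ (h g hg k hk)))
  · rw [cv_apply, hν.2, hμ.2]

lemma IsP.mono {μ : Mn Γ} {S T : Set Γ} (hμ : IsP μ S) (h : S ⊆ T) : IsP μ T :=
  ⟨fun f hf => hμ.1 f (fun g hg => hf g (h hg)), hμ.2⟩

lemma IsP.le {μ : Mn Γ} {S : Set Γ} (hμ : IsP μ S) {f f' : Γ → ℝ} (h : ∀ g ∈ S, f g ≤ f' g) : μ f ≤ μ f' := by
  have := hμ.1 (f' - f) (fun g hg => by simpa using h g hg)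
  rw [map_sub] at this
  linarith

lemma IsP.const {μ : Mn Γ} {S : Set Γ} (hμ : IsP μ S) (c : ℝ) : μ (fun _ => c) = c := by
  have : (fun _ : Γ => c) = c • (fun _ => (1:ℝ)) := by funext; simp
  rw [this, map_smul, hμ.2]; simp

/-- average over powers -/
noncomputable def av (M : ℕ) (g : Γ) : Mn Γ where
  toFun f := (M:ℝ)⁻¹ * ∑ s ∈ range M, f (g ^ s)
  map_add' f f' := by simp [Finset.sum_add_distrib, mul_add]
  map_smul' c f := by simp [← Finset.mul_sum]; ring

lemma av_apply (M : ℕ) (g : Γ) (f : Γ → ℝ) : av M g f = (M:ℝ)⁻¹ * ∑ s ∈ range M, f (g ^ s) := rfl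

lemma IsP.av {M : ℕ} (hM : 0 < M) (g : Γ) (S : Set Γ) (h : ∀ s < M, g ^ s ∈ S) : IsP (av M g) S := by
  constructor
  · intro f hf
    rw [av_apply]
    apply mul_nonneg (by positivity)
    exact Finset.sum_nonneg (fun s hs => hf _ (h s (Finset.mem_range.1 hs)))
  · rw [av_apply]
    have : (M:ℝ) ≠ 0 := by positivity
    simp [this]

/-- point mass -/
def dl (g : Γ) : Mn Γ := LinearMap.proj g

lemma dl_apply (g : Γ) (f : Γ → ℝ) : dl g f = f g := rfl

lemma IsP.dl (g : Γ) (S : Set Γ) (h : g ∈ S) : IsP (dl g) S := ⟨fun f hf => hf g h, rfl⟩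

variable {X : Type*} [MulAction Γ X]

/-- action on functions -/
def ac (μ : Mn Γ) (p : X → ℝ) (z : X) : ℝ := μ (fun h => p (h⁻¹ • z))

lemma ac_cv (μ ν : Mn Γ) (p : X → ℝ) : ac (cv μ ν) p = ac μ (ac ν p) := by
  funext z
  simp only [ac, cv_apply, mul_inv_rev, mul_smul]

/-- the law of differences -/
noncomputable def al (M : ℕ) (n : ℤ) : ℝ :=
  (((range M ×ˢ range M).filter (fun p : ℕ × ℕ => (p.1 : ℤ) - p.2 = n)).card : ℝ) / (M:ℝ) ^ 2

lemma al_nonneg (M : ℕ) (n : ℤ) : 0 ≤ al M n := by unfold al; positivity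

lemma al_le (M : ℕ) (hM : 0 < M) (n : ℤ) : al M n ≤ 1 / M := by
  unfold al
  have : ((range M ×ˢ range M).filter (fun p : ℕ × ℕ => (p.1 : ℤ) - p.2 = n)).card ≤ M := by
    conv_rhs => rw [← Finset.card_range M]
    apply Finset.card_le_card_of_injOn (fun p => p.1)
    · intro p hp
      simp at hp
      simpa using hp.1.1
    · rintro ⟨a, b⟩ hp ⟨a', b'⟩ hp' heq
      simp at hp hp' heq
      subst heq
      simp only [Prod.mk.injEq, true_and]
      omega
  have h2 : ((((range M ×ˢ range M).filter (fun p : ℕ × ℕ => (p.1 : ℤ) - p.2 = n)).card : ℕ) : ℝ) ≤ M := by exact_mod_cast this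
  have hM' : (0:ℝ) < M := by exact_mod_cast hM
  rw [div_le_div_iff₀ (by positivity) hM']
  nlinarith

lemma al_sum (M : ℕ) (F : ℤ → ℝ) :
    (M:ℝ)⁻¹ * ∑ s ∈ range M, ((M:ℝ)⁻¹ * ∑ t ∈ range M, F ((s:ℤ) - t)) = ∑ n ∈ Finset.Icc (-(M:ℤ)) M, al M n * F n := by
  have h1 : ∑ p ∈ range M ×ˢ range M, F ((p.1:ℤ) - p.2) =
      ∑ n ∈ Finset.Icc (-(M:ℤ)) M, ∑ p ∈ (range M ×ˢ range M).filter (fun p : ℕ × ℕ => (p.1 : ℤ) - p.2 = n), F ((p.1:ℤ) - p.2) := by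
    symm
    apply Finset.sum_fiberwise_of_maps_to
    intro p hp
    simp at hp
    simp
    omega
  rw [Finset.sum_product] at h1
  rw [← Finset.mul_sum, h1, Finset.mul_sum, Finset.mul_sum]
  apply Finset.sum_congr rfl
  intro n _
  have : ∑ p ∈ (range M ×ˢ range M).filter (fun p : ℕ × ℕ => (p.1 : ℤ) - p.2 = n), F ((p.1:ℤ) - p.2) =
      ((range M ×ˢ range M).filter (fun p : ℕ × ℕ => (p.1 : ℤ) - p.2 = n)).card * F n := by
    rw [← nsmul_eq_mul, ← Finset.sum_const]
    apply Finset.sum_congr rfl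
    intro p hp
    rw [(Finset.mem_filter.1 hp).2]
  rw [this, al]
  ring

lemma al_total (M : ℕ) (hM : 0 < M) : ∑ n ∈ Finset.Icc (-(M:ℤ)) M, al M n = 1 := by
  have := al_sum M (fun _ => 1)
  simp only [mul_one] at this
  rw [← this]
  have : (M:ℝ) ≠ 0 := by positivity
  simp [this]

/-- `ℓ²` bound on a set -/
def Bd (p : X → ℝ) (D : Set X) (a : ℝ) : Prop := ∀ S : Finset X, (∀ z ∈ S, z ∈ D) → ∑ z ∈ S, p z ^ 2 ≤ a

lemma Bd.nonneg {p : X → ℝ} {D : Set X} {a : ℝ} (h : Bd p D a) : 0 ≤ a := by simpa using h ∅ (by simp)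

lemma Bd.mono {p : X → ℝ} {D : Set X} {a b : ℝ} (h : Bd p D a) (hab : a ≤ b) : Bd p D b := fun S hS => (h S hS).trans hab

/-- the difference operator -/
noncomputable def df (M : ℕ) (g : Γ) (p : X → ℝ) (z : X) : ℝ := ∑ n ∈ Finset.Icc (-(M:ℤ)) M, al M n * p ((g ^ n)⁻¹ • z)

lemma ac_diff (M : ℕ) (g : Γ) (p : X → ℝ) : ac (cv (av M g) (av M g⁻¹)) p = df M g p := by
  funext z
  rw [df, ← al_sum M (fun n => p ((g ^ n)⁻¹ • z))]
  simp only [ac, cv_apply, av_apply]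
  congr 1
  apply Finset.sum_congr rfl
  intro s _
  congr 1
  apply Finset.sum_congr rfl
  intro t _
  rw [zpow_sub, zpow_natCast, zpow_natCast, inv_pow]

open Classical in
lemma Bd.pull {p : X → ℝ} {D : Set X} {a : ℝ} (h : Bd p D a) (k : Γ) (S : Finset X) :
    ∑ z ∈ S, (if k • z ∈ D then p (k • z) else 0) ^ 2 ≤ a := by
  have := h ((S.filter (fun z => k • z ∈ D)).image (fun z => k • z)) (by
    intro z hz
    obtain ⟨y, hy, rfl⟩ := Finset.mem_image.1 hz
    exact (Finset.mem_filter.1 hy).2)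
  rw [Finset.sum_image (fun _ _ _ _ h => MulAction.injective k h), Finset.sum_filter] at this
  refine le_trans (le_of_eq ?_) this
  apply Finset.sum_congr rfl
  intro z _
  split_ifs <;> simp

open Classical in
lemma step (M : ℕ) (hM : 0 < M) (g : Γ) (p : X → ℝ) (D : Set X) (hD : ∀ n : ℤ, n ≠ 0 → ∀ z ∈ D, g ^ n • z ∉ D) (a b : ℝ)
    (ha : Bd p D a) (hb : Bd p Dᶜ b) :
    Bd (df M g p) D (2 * (a / M ^ 2) + 2 * (b / M)) ∧ Bd (df M g p) Dᶜ (2 * (a / M) + 2 * b) := by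
  have hM' : (0:ℝ) < M := by exact_mod_cast hM
  set I := Finset.Icc (-(M:ℤ)) M with hI
  set p1 : X → ℝ := fun z => if z ∈ D then p z else 0 with hp1
  set p2 : X → ℝ := fun z => if z ∈ Dᶜ then p z else 0 with hp2
  have hsplit : ∀ z, df M g p z = df M g p1 z + df M g p2 z := by
    intro z
    simp only [df]
    rw [← Finset.sum_add_distrib]
    apply Finset.sum_congr rfl
    intro n _
    rw [← mul_add]
    congr 1
    simp only [hp1, hp2, Set.mem_compl_iff]
    split_ifs <;> simp_all
  have hal2 : ∑ n ∈ I, al M n ^ 2 ≤ 1 / M := by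
    calc ∑ n ∈ I, al M n ^ 2 ≤ ∑ n ∈ I, (1 / (M:ℝ)) * al M n := by
          apply Finset.sum_le_sum
          intro n _
          rw [sq]
          exact mul_le_mul_of_nonneg_right (al_le M hM n) (al_nonneg M n)
      _ = 1 / M := by rw [← Finset.mul_sum, al_total M hM, mul_one]
  have huniq : ∀ (z : X) (n m : ℤ), (g ^ n)⁻¹ • z ∈ D → (g ^ m)⁻¹ • z ∈ D → n = m := by
    intro z n m hn hm
    by_contra hne
    apply hD (n - m) (sub_ne_zero.2 hne) _ hn
    have : g ^ (n - m) • (g ^ n)⁻¹ • z = (g ^ m)⁻¹ • z := by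
      rw [smul_smul, ← zpow_neg, ← zpow_neg, ← zpow_add]
      congr 2
      ring
    rwa [this]
  have comb : ∀ (S : Finset X) (x y : ℝ), ∑ z ∈ S, df M g p1 z ^ 2 ≤ x → ∑ z ∈ S, df M g p2 z ^ 2 ≤ y →
      ∑ z ∈ S, df M g p z ^ 2 ≤ 2 * x + 2 * y := by
    intro S x y hx hy
    calc ∑ z ∈ S, df M g p z ^ 2 ≤ ∑ z ∈ S, (2 * df M g p1 z ^ 2 + 2 * df M g p2 z ^ 2) := by
          apply Finset.sum_le_sum
          intro z _
          rw [hsplit z]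
          nlinarith [sq_nonneg (df M g p1 z - df M g p2 z)]
      _ = 2 * ∑ z ∈ S, df M g p1 z ^ 2 + 2 * ∑ z ∈ S, df M g p2 z ^ 2 := by
          rw [Finset.sum_add_distrib, Finset.mul_sum, Finset.mul_sum]
      _ ≤ _ := by linarith
  constructor
  · intro S hS
    apply comb
    · -- D from D
      have : ∀ z ∈ S, df M g p1 z ^ 2 ≤ p z ^ 2 / M ^ 2 := by
        intro z hz
        have e : df M g p1 z = al M 0 * p z := by
          rw [df, Finset.sum_eq_single 0]
          · simp [hp1, hS z hz]
          · intro n _ hn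
            have : (g ^ n)⁻¹ • z ∉ D := by
              rw [← zpow_neg]; exact hD (-n) (neg_ne_zero.2 hn) z (hS z hz)
            simp only [hp1, if_neg this, mul_zero]
          · intro h; exfalso; apply h; simp
        rw [e, mul_pow]
        have h1 := al_le M hM 0
        have h2 := al_nonneg M 0
        have h3 : al M 0 ^ 2 ≤ (1 / (M:ℝ)) ^ 2 := by gcongr
        calc al M 0 ^ 2 * p z ^ 2 ≤ (1 / (M:ℝ)) ^ 2 * p z ^ 2 := by gcongr
          _ = _ := by ring
      calc _ ≤ ∑ z ∈ S, p z ^ 2 / M ^ 2 := Finset.sum_le_sum this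
        _ = (∑ z ∈ S, p z ^ 2) / M ^ 2 := by rw [Finset.sum_div]
        _ ≤ _ := by gcongr; exact ha S hS
    · -- D from complement
      have h1 : ∀ z ∈ S, df M g p2 z ^ 2 ≤ (1 / (M:ℝ)) * ∑ n ∈ I, p2 ((g ^ n)⁻¹ • z) ^ 2 := by
        intro z _
        refine (Finset.sum_mul_sq_le_sq_mul_sq I _ _).trans ?_
        exact mul_le_mul_of_nonneg_right hal2 (Finset.sum_nonneg (fun _ _ => sq_nonneg _))
      have h2 : ∑ z ∈ S, ∑ n ∈ I, p2 ((g ^ n)⁻¹ • z) ^ 2 ≤ b := by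
        rw [← Finset.sum_product']
        have inj : Set.InjOn (fun x : X × ℤ => (g ^ x.2)⁻¹ • x.1) (S ×ˢ I : Finset (X × ℤ)) := by
          rintro ⟨z, n⟩ h ⟨z', n'⟩ h' heq
          simp only [Finset.coe_product, Set.mem_prod, Finset.mem_coe] at h h'
          simp only at heq
          have e : z' = g ^ (n' - n) • z := by
            rw [sub_eq_add_neg, zpow_add, zpow_neg, mul_smul, heq, smul_inv_smul]
          have : n' - n = 0 := by
            by_contra hne
            apply hD _ hne z (hS z h.1)
            rw [← e]
            exact hS z' h'.1
          have hn : n' = n := by omega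
          subst hn
          simp at e
          rw [e]
        have h3 := hb (((S ×ˢ I).filter (fun x : X × ℤ => (g ^ x.2)⁻¹ • x.1 ∈ Dᶜ)).image (fun x : X × ℤ => (g ^ x.2)⁻¹ • x.1)) (by
          intro z hz
          obtain ⟨y, hy, rfl⟩ := Finset.mem_image.1 hz
          exact (Finset.mem_filter.1 hy).2)
        rw [Finset.sum_image (fun x hx y hy h => inj (Finset.mem_coe.2 (Finset.mem_filter.1 hx).1) (Finset.mem_coe.2 (Finset.mem_filter.1 hy).1) h), Finset.sum_filter] at h3
        refine le_trans (le_of_eq ?_) h3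
        apply Finset.sum_congr rfl
        intro z _
        simp only [hp2]
        split_ifs <;> simp
      calc _ ≤ ∑ z ∈ S, (1 / (M:ℝ)) * ∑ n ∈ I, p2 ((g ^ n)⁻¹ • z) ^ 2 := Finset.sum_le_sum h1
        _ = (1 / (M:ℝ)) * ∑ z ∈ S, ∑ n ∈ I, p2 ((g ^ n)⁻¹ • z) ^ 2 := by rw [Finset.mul_sum]
        _ ≤ (1 / (M:ℝ)) * b := by gcongr
        _ = _ := by ring
  · intro S hS
    apply comb
    · have h1 : ∀ z ∈ S, df M g p1 z ^ 2 = ∑ n ∈ I, al M n ^ 2 * p1 ((g ^ n)⁻¹ • z) ^ 2 := by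
        intro z _
        by_cases hex : ∃ n ∈ I, (g ^ n)⁻¹ • z ∈ D
        · obtain ⟨n, hn, hnD⟩ := hex
          have hz : ∀ m ∈ I, m ≠ n → p1 ((g ^ m)⁻¹ • z) = 0 := by
            intro m _ hmn
            simp only [hp1]
            rw [if_neg]
            intro h
            exact hmn (huniq z _ _ h hnD)
          rw [df, Finset.sum_eq_single_of_mem n hn (fun m hm hmn => by rw [hz m hm hmn, mul_zero]),
            Finset.sum_eq_single_of_mem n hn (fun m hm hmn => by rw [hz m hm hmn]; ring)]
          ring
        · push Not at hex
          have hz : ∀ m ∈ I, p1 ((g ^ m)⁻¹ • z) = 0 := by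
            intro m hm
            simp only [hp1]
            rw [if_neg (hex m hm)]
          rw [df, Finset.sum_eq_zero (fun m hm => by rw [hz m hm, mul_zero]),
            Finset.sum_eq_zero (fun m hm => by rw [hz m hm]; ring)]
          ring
      calc ∑ z ∈ S, df M g p1 z ^ 2 = ∑ n ∈ I, al M n ^ 2 * ∑ z ∈ S, p1 ((g ^ n)⁻¹ • z) ^ 2 := by
            rw [Finset.sum_congr rfl h1, Finset.sum_comm]
            exact Finset.sum_congr rfl (fun n _ => by rw [Finset.mul_sum])
        _ ≤ ∑ n ∈ I, al M n ^ 2 * a := by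
            apply Finset.sum_le_sum
            intro n _
            exact mul_le_mul_of_nonneg_left (ha.pull _ S) (sq_nonneg _)
        _ ≤ (1 / M) * a := by
            rw [← Finset.sum_mul]
            exact mul_le_mul_of_nonneg_right hal2 ha.nonneg
        _ = a / M := by ring
    · have h1 : ∀ z ∈ S, df M g p2 z ^ 2 ≤ ∑ n ∈ I, al M n * p2 ((g ^ n)⁻¹ • z) ^ 2 := by
        intro z _
        have h := Finset.sum_sq_le_sum_mul_sum_of_sq_eq_mul I (r := fun n => al M n * p2 ((g ^ n)⁻¹ • z))
          (f := fun n => al M n) (g := fun n => al M n * p2 ((g ^ n)⁻¹ • z) ^ 2)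
          (fun n _ => al_nonneg M n) (fun n _ => mul_nonneg (al_nonneg M n) (sq_nonneg _)) (fun n _ => by ring)
        rw [al_total M hM, one_mul] at h
        exact h
      calc ∑ z ∈ S, df M g p2 z ^ 2 ≤ ∑ z ∈ S, ∑ n ∈ I, al M n * p2 ((g ^ n)⁻¹ • z) ^ 2 := Finset.sum_le_sum h1
        _ = ∑ n ∈ I, al M n * ∑ z ∈ S, p2 ((g ^ n)⁻¹ • z) ^ 2 := by
            rw [Finset.sum_comm]
            exact Finset.sum_congr rfl (fun n _ => by rw [Finset.mul_sum])
        _ ≤ ∑ n ∈ I, al M n * b := by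
            apply Finset.sum_le_sum
            intro n _
            refine mul_le_mul_of_nonneg_left ?_ (al_nonneg M n)
            have := hb.pull (g ^ n)⁻¹ S
            refine le_of_eq_of_le ?_ this
            apply Finset.sum_congr rfl
            intro z _
            simp only [hp2]
            congr 2
        _ = b := by rw [← Finset.sum_mul, al_total M hM, one_mul]

end
end IUC
end

section
open Finset
open scoped Pointwise
set_option maxHeartbeats 400000
set_option linter.unusedSectionVars false
namespace IUC

section
variable {Γ Γ' : Type*} [Group Γ] [Group Γ']

/-- pushforward -/
def pf (φ : Γ →* Γ') (μ : Mn Γ) : Mn Γ' where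
  toFun f := μ (fun g => f (φ g))
  map_add' f f' := map_add μ _ _
  map_smul' c f := map_smul μ c _

lemma pf_apply (φ : Γ →* Γ') (μ : Mn Γ) (f : Γ' → ℝ) : pf φ μ f = μ (fun g => f (φ g)) := rfl

lemma pf_cv (φ : Γ →* Γ') (μ ν : Mn Γ) : pf φ (cv μ ν) = cv (pf φ μ) (pf φ ν) := by
  ext f
  simp only [pf_apply, cv_apply, map_mul]

lemma pf_av (φ : Γ →* Γ') (M : ℕ) (g : Γ) : pf φ (av M g) = av M (φ g) := by
  ext f
  simp only [pf_apply, av_apply, map_pow]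

/-- difference law -/
noncomputable def uu (M : ℕ) (g : Γ) : Mn Γ := cv (av M g) (av M g⁻¹)

/-- the words -/
noncomputable def RR (M : ℕ) (g k : Γ) : ℕ → Mn Γ
  | 0 => uu M k
  | j + 1 => cv (RR M g k j) (cv (uu M g) (RR M g k j))

lemma pf_uu (φ : Γ →* Γ') (M : ℕ) (g : Γ) : pf φ (uu M g) = uu M (φ g) := by
  simp only [uu, pf_cv, pf_av, map_inv]

lemma pf_RR (φ : Γ →* Γ') (M : ℕ) (g k : Γ) (j : ℕ) : pf φ (RR M g k j) = RR M (φ g) (φ k) j := by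
  induction j with
  | zero => exact pf_uu _ _ _
  | succ j ih => simp only [RR, pf_cv, ih, pf_uu]

variable {X : Type*} [MulAction Γ X]

lemma RR_bd (M : ℕ) (hM : 0 < M) (g k : Γ) (D : Set X) (hD : ∀ n : ℤ, n ≠ 0 → ∀ z ∈ D, g ^ n • z ∉ D)
    (hD' : ∀ n : ℤ, n ≠ 0 → ∀ z ∉ D, k ^ n • z ∈ D) (j : ℕ) :
    ∀ (p : X → ℝ) (a b : ℝ), Bd p D a → Bd p Dᶜ b →
      Bd (ac (RR M g k j) p) D (2 * (16 / (M:ℝ) ^ 2) ^ (2 ^ j - 1) * (a + b / M)) ∧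
      Bd (ac (RR M g k j) p) Dᶜ (2 * (16 / (M:ℝ) ^ 2) ^ (2 ^ j - 1) * (a + b / M) / M) := by
  have hM' : (0:ℝ) < M := by exact_mod_cast hM
  induction j with
  | zero =>
    intro p a b ha hb
    have := step M hM k p Dᶜ (fun n hn z hz => by
      rw [Set.mem_compl_iff, not_not]
      exact hD' n hn z hz) b a hb (by rwa [compl_compl])
    rw [compl_compl] at this
    simp only [RR, uu, ac_diff]
    constructor
    · refine this.2.mono (le_of_eq ?_)
      simp; ring
    · refine this.1.mono (le_of_eq ?_)
      simp; field_simp; ring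
  | succ j ih =>
    intro p a b ha hb
    simp only [RR, ac_cv]
    have h1 := ih p a b ha hb
    have h2 := step M hM g _ D hD _ _ h1.1 h1.2
    have h3 := ih _ _ _ h2.1 h2.2
    have e : (2:ℕ) ^ (j + 1) - 1 = (2 ^ j - 1) + (2 ^ j - 1) + 1 := by
      have : 1 ≤ 2 ^ j := Nat.one_le_two_pow
      rw [pow_succ]; omega
    simp only [uu, ac_diff]
    set c := (16 / (M:ℝ) ^ 2) ^ (2 ^ j - 1) with hc
    have e2 : (16 / (M:ℝ) ^ 2) ^ (2 ^ (j + 1) - 1) = c * c * (16 / (M:ℝ) ^ 2) := by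
      rw [e, pow_add, pow_add, pow_one]
    rw [e2]
    constructor
    · refine h3.1.mono (le_of_eq ?_)
      field_simp; ring
    · refine h3.2.mono (le_of_eq ?_)
      field_simp; ring

open Classical in
lemma RR_pt (M : ℕ) (hM : 0 < M) (g k : Γ) (D : Set X) (hD : ∀ n : ℤ, n ≠ 0 → ∀ z ∈ D, g ^ n • z ∉ D)
    (hD' : ∀ n : ℤ, n ≠ 0 → ∀ z ∉ D, k ^ n • z ∈ D) (j : ℕ) (x y : X) :
    RR M g k j (fun h => if h • x = y then (1:ℝ) else 0) ≤ 2 * (4 / (M:ℝ)) ^ (2 ^ j - 1) := by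
  have hM' : (1:ℝ) ≤ M := by exact_mod_cast hM
  set p : X → ℝ := fun z => if z = x then 1 else 0 with hp
  have hb : ∀ E : Set X, Bd p E 1 := by
    intro E S _
    calc ∑ z ∈ S, p z ^ 2 = ∑ z ∈ S, p z := by
          apply Finset.sum_congr rfl
          intro z _
          simp only [hp]; split_ifs <;> simp
      _ ≤ 1 := by
          simp only [hp, Finset.sum_ite_eq']
          split_ifs <;> simp
  have h := RR_bd M hM g k D hD hD' j p 1 1 (hb _) (hb _)
  have e : RR M g k j (fun h => if h • x = y then (1:ℝ) else 0) = ac (RR M g k j) p y := by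
    simp only [ac, hp]
    congr 1
    funext h
    have hh : h • x = y ↔ h⁻¹ • y = x := by rw [inv_smul_eq_iff, eq_comm]
    simp only [hh]
  rw [e]
  set c := (16 / (M:ℝ) ^ 2) ^ (2 ^ j - 1) with hc
  have hc0 : 0 ≤ c := by positivity
  have hcc : c = ((4 / (M:ℝ)) ^ (2 ^ j - 1)) ^ 2 := by
    rw [hc, ← pow_mul, mul_comm _ 2, pow_mul]
    congr 1; ring
  have hinv : 1 / (M:ℝ) ≤ 1 := by rw [div_le_one (by linarith)]; exact hM'
  have hsq : ac (RR M g k j) p y ^ 2 ≤ 4 * c := by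
    by_cases hy : y ∈ D
    · have := h.1 {y} (by simpa using hy)
      simp only [Finset.sum_singleton] at this
      refine this.trans ?_
      nlinarith
    · have := h.2 {y} (by simpa using hy)
      simp only [Finset.sum_singleton] at this
      refine this.trans ?_
      have : 2 * c * (1 + 1 / (M:ℝ)) / M ≤ 2 * c * (1 + 1 / (M:ℝ)) := div_le_self (by positivity) hM'
      nlinarith
  apply abs_le_of_sq_le_sq' _ (by positivity) |>.2
  rw [mul_pow, ← hcc]
  linarith

end

section
open scoped LinearAlgebra.Projectivization MatrixGroups
open ModularGroup

/-- the complex projective line -/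
abbrev PC := ℙ ℂ (Fin 2 → ℂ)

/-- SL2(Z) to SL2(C) -/
noncomputable abbrev phC : SL(2, ℤ) →* Matrix.SpecialLinearGroup (Fin 2) ℂ := Matrix.SpecialLinearGroup.map (Int.castRingHom ℂ)

/-- ping-pong domain -/
def DC : Set PC := {p | ‖p.rep 0‖ ≤ ‖p.rep 1‖}

lemma mem_DC (v : Fin 2 → ℂ) (hv : v ≠ 0) : Projectivization.mk ℂ v hv ∈ DC ↔ ‖v 0‖ ≤ ‖v 1‖ := by
  obtain ⟨a, ha⟩ := Projectivization.exists_smul_eq_mk_rep ℂ v hv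
  show ‖(Projectivization.mk ℂ v hv).rep 0‖ ≤ ‖(Projectivization.mk ℂ v hv).rep 1‖ ↔ _
  rw [← ha]
  simp only [Units.smul_def, Pi.smul_apply, smul_eq_mul, norm_mul]
  have : 0 < ‖(a:ℂ)‖ := by simp
  exact mul_le_mul_iff_right₀ this

/-- generators -/
def gT : SL(2, ℤ) := T ^ 3
/-- second generator -/
def gS : SL(2, ℤ) := S * T ^ 3 * S⁻¹

lemma gT_zpow (n : ℤ) : ((gT ^ n : SL(2, ℤ)) : Matrix (Fin 2) (Fin 2) ℤ) = !![1, 3 * n; 0, 1] := by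
  have : gT ^ n = T ^ (3 * n) := by
    rw [gT, zpow_mul]; rfl
  rw [this, coe_T_zpow]

lemma gS_zpow (n : ℤ) : ((gS ^ n : SL(2, ℤ)) : Matrix (Fin 2) (Fin 2) ℤ) = !![1, 0; -3 * n, 1] := by
  have : gS ^ n = S * gT ^ n * S⁻¹ := by
    rw [gS, conj_zpow]; rfl
  rw [this, Matrix.SpecialLinearGroup.coe_mul, Matrix.SpecialLinearGroup.coe_mul, gT_zpow, Matrix.SpecialLinearGroup.coe_inv, coe_S]
  simp [Matrix.adjugate_fin_two]

lemma smul_C (g : SL(2, ℤ)) (v : Fin 2 → ℂ) (i : Fin 2) : (phC g • v) i = (g i 0 : ℂ) * v 0 + (g i 1 : ℂ) * v 1 := by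
  show (Matrix.mulVec (phC g : Matrix (Fin 2) (Fin 2) ℂ) v) i = _
  simp [Matrix.mulVec, dotProduct, Fin.sum_univ_two]

lemma ping (n : ℤ) (hn : n ≠ 0) (z : PC) (hz : z ∈ DC) : (phC gT) ^ n • z ∉ DC := by
  induction z using Projectivization.ind with | _ v hv =>
  rw [← map_zpow, Projectivization.smul_mk, mem_DC, smul_C, smul_C, gT_zpow]
  rw [mem_DC] at hz
  simp
  have h1 : v 1 ≠ 0 := by
    intro h
    rw [h, norm_zero] at hz
    apply hv
    funext i
    fin_cases i
    · simpa using hz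
    · simpa using h
  have hpos : 0 < ‖v 1‖ := norm_pos_iff.2 h1
  have hn1 : (1:ℝ) ≤ ‖(n:ℂ)‖ := by
    rw [Complex.norm_intCast]
    exact_mod_cast Int.one_le_abs hn
  have h3 : ‖(3 * (n:ℂ)) * v 1‖ ≥ 3 * ‖v 1‖ := by
    rw [norm_mul, norm_mul]
    simp only [Complex.norm_ofNat]
    nlinarith
  have := norm_sub_le (v 0 + (3 * (n:ℂ)) * v 1) (v 0)
  rw [add_sub_cancel_left] at this
  linarith

lemma pong (n : ℤ) (hn : n ≠ 0) (z : PC) (hz : z ∉ DC) : (phC gS) ^ n • z ∈ DC := by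
  induction z using Projectivization.ind with | _ v hv =>
  rw [← map_zpow, Projectivization.smul_mk, mem_DC, smul_C, smul_C, gS_zpow]
  rw [mem_DC] at hz
  simp
  push Not at hz
  have hn1 : (1:ℝ) ≤ ‖(n:ℂ)‖ := by
    rw [Complex.norm_intCast]
    exact_mod_cast Int.one_le_abs hn
  have h3 : ‖(3 * (n:ℂ)) * v 0‖ ≥ 3 * ‖v 0‖ := by
    rw [norm_mul, norm_mul]
    simp only [Complex.norm_ofNat]
    nlinarith [norm_nonneg (v 0)]
  have := norm_sub_le (v 1) (-(3 * (n:ℂ) * v 0) + v 1)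
  rw [show v 1 - (-(3 * (n:ℂ) * v 0) + v 1) = 3 * (n:ℂ) * v 0 by ring] at this
  linarith [norm_nonneg (v 0)]

open Classical in
/-- word count over `ℂ` -/
theorem word_count (M : ℕ) (hM : 0 < M) (j : ℕ) (x y : PC) :
    RR M gT gS j (fun h => if phC h • x = y then (1:ℝ) else 0) ≤ 2 * (4 / (M:ℝ)) ^ (2 ^ j - 1) := by
  have := RR_pt M hM (phC gT) (phC gS) DC ping pong j x y
  rwa [← pf_RR] at this

end
end IUC
end

section
open Finset
open scoped Pointwise
set_option maxHeartbeats 400000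
set_option linter.unusedSectionVars false
namespace IUC

section
/-- minors of size three -/
def d3 {R : Type*} [CommRing R] (u v w : Fin 4 → R) (i j k : Fin 4) : R :=
  u i * (v j * w k - v k * w j) - u j * (v i * w k - v k * w i) + u k * (v i * w j - v j * w i)

/-- cross product -/
def crs {R : Type*} [CommRing R] (u v w : Fin 4 → R) : Fin 4 → R :=
  ![d3 u v w 1 2 3, -d3 u v w 0 2 3, d3 u v w 0 1 3, -d3 u v w 0 1 2]

/-- pairing -/
def pr {R : Type*} [CommRing R] (a w : Fin 4 → R) : R := a 0 * w 0 + a 1 * w 1 + a 2 * w 2 + a 3 * w 3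

lemma crs_zero {R : Type*} [CommRing R] (u v w : Fin 4 → R) (h : crs u v w = 0) (i j k : Fin 4) : d3 u v w i j k = 0 := by
  have h0 := congrFun h 0
  have h1 := congrFun h 1
  have h2 := congrFun h 2
  have h3 := congrFun h 3
  simp only [crs, d3, Matrix.cons_val, Pi.zero_apply] at h0 h1 h2 h3
  fin_cases i <;> fin_cases j <;> fin_cases k <;> simp only [d3, Fin.zero_eta, Fin.mk_one, Fin.reduceFinMk] <;>
    first
      | ring1
      | linear_combination h0
      | linear_combination -h0
      | linear_combination h1
      | linear_combination -h1
      | linear_combination h2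
      | linear_combination -h2
      | linear_combination h3
      | linear_combination -h3

lemma crs_par {R : Type*} [CommRing R] (a u v w : Fin 4 → R) (hu : pr a u = 0) (hv : pr a v = 0) (hw : pr a w = 0) (j k : Fin 4) :
    crs u v w j * a k = crs u v w k * a j := by
  simp only [pr] at hu hv hw
  have key : ∀ l m : Fin 4, (a 0 * u 0 + a 1 * u 1 + a 2 * u 2 + a 3 * u 3) * (v l * w m - v m * w l)
     - (a 0 * v 0 + a 1 * v 1 + a 2 * v 2 + a 3 * v 3) * (u l * w m - u m * w l)
     + (a 0 * w 0 + a 1 * w 1 + a 2 * w 2 + a 3 * w 3) * (u l * v m - u m * v l) = 0 := by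
    intro l m; rw [hu, hv, hw]; ring
  have h01 := key 0 1
  have h02 := key 0 2
  have h03 := key 0 3
  have h12 := key 1 2
  have h13 := key 1 3
  have h23 := key 2 3
  fin_cases j <;> fin_cases k <;> simp only [crs, d3, Fin.zero_eta, Fin.mk_one, Fin.reduceFinMk, Matrix.cons_val] <;>
    first
      | ring1
      | linear_combination h01
      | linear_combination -h01
      | linear_combination h02
      | linear_combination -h02
      | linear_combination h03
      | linear_combination -h03
      | linear_combination h12
      | linear_combination -h12
      | linear_combination h13
      | linear_combination -h13
      | linear_combination h23
      | linear_combination -h23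

lemma quad_root (a b c : ℂ) : ∃ s t : ℂ, (s ≠ 0 ∨ t ≠ 0) ∧ a * s ^ 2 + b * s * t + c * t ^ 2 = 0 := by
  by_cases ha : a = 0
  · exact ⟨1, 0, Or.inl one_ne_zero, by simp [ha]⟩
  · obtain ⟨r, hr⟩ := IsAlgClosed.exists_pow_nat_eq (b ^ 2 - 4 * a * c) (n := 2) (by norm_num)
    refine ⟨(-b + r) / (2 * a), 1, Or.inr one_ne_zero, ?_⟩
    field_simp
    linear_combination hr

lemma dep_orth (a b c d : ℂ) (h : a * d = b * c) : ∃ s t : ℂ, (s ≠ 0 ∨ t ≠ 0) ∧ s * a + t * b = 0 ∧ s * c + t * d = 0 := by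
  by_cases h1 : a = 0 ∧ b = 0
  · by_cases h2 : c = 0 ∧ d = 0
    · exact ⟨1, 0, Or.inl one_ne_zero, by simp [h1.1], by simp [h2.1]⟩
    · refine ⟨d, -c, ?_, by simp [h1.1, h1.2], by ring⟩
      by_contra hc
      push Not at hc
      exact h2 ⟨by simpa using hc.2, hc.1⟩
  · refine ⟨b, -a, ?_, by ring, by linear_combination -h⟩
    by_contra hc
    push Not at hc
    exact h1 ⟨by simpa using hc.2, hc.1⟩

/-- rank one annihilator -/
lemma iso2 (p r : Fin 4 → ℂ) : ∃ x0 x1 y0 y1 : ℂ, (x0 ≠ 0 ∨ x1 ≠ 0) ∧ (y0 ≠ 0 ∨ y1 ≠ 0) ∧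
    pr ![x0 * y0, x0 * y1, x1 * y0, x1 * y1] p = 0 ∧ pr ![x0 * y0, x0 * y1, x1 * y0, x1 * y1] r = 0 := by
  obtain ⟨s, t, hst, h⟩ := quad_root (p 0 * r 2 - p 2 * r 0) (p 0 * r 3 + p 1 * r 2 - p 2 * r 1 - p 3 * r 0) (p 1 * r 3 - p 3 * r 1)
  obtain ⟨x, y, hxy, h1, h2⟩ := dep_orth (p 0 * s + p 1 * t) (p 2 * s + p 3 * t) (r 0 * s + r 1 * t) (r 2 * s + r 3 * t)
    (by linear_combination h)
  refine ⟨x, y, s, t, hxy, hst, ?_, ?_⟩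
  · simp only [pr, Matrix.cons_val]; linear_combination h1
  · simp only [pr, Matrix.cons_val]; linear_combination h2

lemma fac4 (e : Fin 4 → ℂ) (h0 : e ≠ 0) (hd : e 0 * e 3 = e 1 * e 2) : ∃ x0 x1 y0 y1 : ℂ, (x0 ≠ 0 ∨ x1 ≠ 0) ∧ (y0 ≠ 0 ∨ y1 ≠ 0) ∧
    e = ![x0 * y0, x0 * y1, x1 * y0, x1 * y1] := by
  by_cases h : e 0 = 0 ∧ e 1 = 0
  · refine ⟨0, 1, e 2, e 3, by simp, ?_, ?_⟩
    · by_contra hc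
      push Not at hc
      apply h0
      funext i
      fin_cases i
      · exact h.1
      · exact h.2
      · exact hc.1
      · exact hc.2
    · funext i
      fin_cases i <;> simp [h.1, h.2]
  · by_cases h0' : e 0 = 0
    · have h1 : e 1 ≠ 0 := fun h' => h ⟨h0', h'⟩
      have h2 : e 2 = 0 := by
        rw [h0', zero_mul] at hd
        exact (mul_eq_zero.1 hd.symm).resolve_left h1
      refine ⟨1, e 3 / e 1, e 0, e 1, by simp, Or.inr h1, ?_⟩
      funext i
      fin_cases i <;> simp [h0', h2, h1]
    · refine ⟨1, e 2 / e 0, e 0, e 1, by simp, Or.inl h0', ?_⟩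
      funext i
      fin_cases i
      · simp
      · simp
      · simp [h0']
      · simp
        field_simp
        linear_combination hd

lemma span2 (W : Set (Fin 4 → ℤ)) (h : ∀ u ∈ W, ∀ v ∈ W, ∀ w ∈ W, crs u v w = 0) :
    ∃ p r : Fin 4 → ℂ, ∀ w ∈ W, ∃ s t : ℂ, ∀ k, (w k : ℂ) = s * p k + t * r k := by
  by_cases h2 : ∃ u ∈ W, ∃ v ∈ W, ∃ i j : Fin 4, u i * v j - u j * v i ≠ 0
  · obtain ⟨u, hu, v, hv, i, j, hij⟩ := h2
    refine ⟨fun k => u k, fun k => v k, fun w hw => ?_⟩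
    have hne : ((u i : ℂ) * v j - u j * v i) ≠ 0 := by exact_mod_cast hij
    refine ⟨((w i : ℂ) * v j - w j * v i) / (u i * v j - u j * v i), ((u i : ℂ) * w j - u j * w i) / (u i * v j - u j * v i), fun k => ?_⟩
    have := crs_zero u v w (h u hu v hv w hw) i j k
    simp only [d3] at this
    have h3 : ((u i : ℂ) * (v j * w k - v k * w j) - u j * (v i * w k - v k * w i) + u k * (v i * w j - v j * w i)) = 0 := by
      exact_mod_cast this
    generalize hδ : ((u i : ℂ) * v j - u j * v i) = δ at hne ⊢
    field_simp
    linear_combination h3 - (w k : ℂ) * hδ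
  · push Not at h2
    by_cases h1 : ∃ u ∈ W, ∃ i : Fin 4, u i ≠ 0
    · obtain ⟨u, hu, i, hi⟩ := h1
      refine ⟨fun k => u k, 0, fun w hw => ?_⟩
      have hne : (u i : ℂ) ≠ 0 := by exact_mod_cast hi
      refine ⟨(w i : ℂ) / u i, 0, fun k => ?_⟩
      have := h2 u hu w hw i k
      have h3 : (u i : ℂ) * w k - u k * w i = 0 := by exact_mod_cast this
      field_simp
      linear_combination h3
    · push Not at h1
      refine ⟨0, 0, fun w hw => ⟨0, 0, fun k => ?_⟩⟩
      simp [h1 w hw k]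

lemma abs_mul_le' {a b A B : ℤ} (ha : |a| ≤ A) (hb : |b| ≤ B) : |a * b| ≤ A * B := by
  rw [abs_mul]
  exact mul_le_mul ha hb (abs_nonneg _) ((abs_nonneg _).trans ha)

lemma d3_bd (u v w : Fin 4 → ℤ) (X : ℤ) (hu : ∀ i, |u i| ≤ X) (hv : ∀ i, |v i| ≤ X) (hw : ∀ i, |w i| ≤ X) (i j k : Fin 4) :
    |d3 u v w i j k| ≤ 6 * X ^ 3 := by
  have m2 : ∀ i j, |v i * w j - v j * w i| ≤ 2 * X ^ 2 := by
    intro i j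
    refine (abs_sub _ _).trans ?_
    have := abs_mul_le' (hv i) (hw j)
    have := abs_mul_le' (hv j) (hw i)
    nlinarith
  unfold d3
  refine (abs_add_le _ _).trans ?_
  have h1 := abs_sub (u i * (v j * w k - v k * w j)) (u j * (v i * w k - v k * w i))
  have h2 := abs_mul_le' (hu i) (m2 j k)
  have h3 := abs_mul_le' (hu j) (m2 i k)
  have h4 := abs_mul_le' (hu k) (m2 i j)
  nlinarith

lemma crs_bd (u v w : Fin 4 → ℤ) (X : ℤ) (hu : ∀ i, |u i| ≤ X) (hv : ∀ i, |v i| ≤ X) (hw : ∀ i, |w i| ≤ X) (i : Fin 4) :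
    |crs u v w i| ≤ 6 * X ^ 3 := by
  have := d3_bd u v w X hu hv hw
  fin_cases i <;> simp [crs, abs_neg, this]

theorem lift_iso {q : ℕ} [Fact q.Prime] {K : Type*} [Field K] [CharP K q] (W : Set (Fin 4 → ℤ)) (X : ℤ) (hX1 : 1 ≤ X)
    (hX : 72 * X ^ 6 < q) (hW : ∀ w ∈ W, ∀ i, |w i| ≤ X) (a : Fin 4 → K) (ha : a ≠ 0) (hd : a 0 * a 3 = a 1 * a 2)
    (h : ∀ w ∈ W, pr a (fun i => (w i : K)) = 0) :
    ∃ x0 x1 y0 y1 : ℂ, (x0 ≠ 0 ∨ x1 ≠ 0) ∧ (y0 ≠ 0 ∨ y1 ≠ 0) ∧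
      ∀ w ∈ W, pr ![x0 * y0, x0 * y1, x1 * y0, x1 * y1] (fun i => (w i : ℂ)) = 0 := by
  have small : ∀ n : ℤ, (n : K) = 0 → |n| < q → n = 0 := by
    intro n hn hlt
    rw [CharP.intCast_eq_zero_iff K q] at hn
    exact Int.eq_zero_of_abs_lt_dvd hn hlt
  by_cases hA : ∃ u ∈ W, ∃ v ∈ W, ∃ w ∈ W, crs u v w ≠ 0
  · obtain ⟨u, hu, v, hv, w, hw, hne⟩ := hA
    set c := crs u v w with hc
    have hcb : ∀ i, |c i| ≤ 6 * X ^ 3 := crs_bd u v w X (hW u hu) (hW v hv) (hW w hw)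
    have hcast : ∀ i, ((c i : ℤ) : K) = crs (fun i => (u i : K)) (fun i => (v i : K)) (fun i => (w i : K)) i := by
      intro i
      fin_cases i <;> simp [hc, crs, d3]
    have hpar : ∀ j k, (c j : K) * a k = c k * a j := by
      intro j k
      rw [hcast, hcast]
      exact crs_par a _ _ _ (h u hu) (h v hv) (h w hw) j k
    obtain ⟨i, hi⟩ := Function.ne_iff.1 ha
    simp only [Pi.zero_apply] at hi
    have hct : ∀ k, (c k : K) = (c i : K) / a i * a k := by
      intro k
      have := hpar i k
      field_simp
      linear_combination -this
    set t := (c i : K) / a i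
    have e1 : c 0 * c 3 - c 1 * c 2 = 0 := by
      apply small
      · push_cast
        rw [hct 0, hct 1, hct 2, hct 3]
        linear_combination t ^ 2 * hd
      · have h1 := abs_mul_le' (hcb 0) (hcb 3)
        have h2 := abs_mul_le' (hcb 1) (hcb 2)
        have h3 := abs_sub (c 0 * c 3) (c 1 * c 2)
        nlinarith
    have e2 : ∀ w ∈ W, pr c w = 0 := by
      intro w hw
      apply small
      · have := h w hw
        simp only [pr] at this ⊢
        push_cast
        rw [hct 0, hct 1, hct 2, hct 3]
        linear_combination t * this
      · unfold pr
        have h0 := abs_mul_le' (hcb 0) (hW w hw 0)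
        have h1 := abs_mul_le' (hcb 1) (hW w hw 1)
        have h2 := abs_mul_le' (hcb 2) (hW w hw 2)
        have h3 := abs_mul_le' (hcb 3) (hW w hw 3)
        have a1 := abs_add_le (c 0 * w 0 + c 1 * w 1 + c 2 * w 2) (c 3 * w 3)
        have a2 := abs_add_le (c 0 * w 0 + c 1 * w 1) (c 2 * w 2)
        have a3 := abs_add_le (c 0 * w 0) (c 1 * w 1)
        have : X ^ 4 ≤ X ^ 6 := pow_le_pow_right₀ hX1 (by norm_num)
        have : 0 ≤ X ^ 4 := by positivity
        nlinarith
    obtain ⟨x0, x1, y0, y1, hx, hy, he⟩ := fac4 (fun i => (c i : ℂ)) (by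
      intro h0
      apply hne
      funext i
      have := congrFun h0 i
      simpa using this) (by
      have : c 0 * c 3 = c 1 * c 2 := by linarith
      exact_mod_cast this)
    refine ⟨x0, x1, y0, y1, hx, hy, fun w hw => ?_⟩
    rw [← he]
    have := e2 w hw
    simp only [pr] at this ⊢
    exact_mod_cast this
  · push Not at hA
    obtain ⟨p, r, hpr⟩ := span2 W hA
    obtain ⟨x0, x1, y0, y1, hx, hy, h1, h2⟩ := iso2 p r
    refine ⟨x0, x1, y0, y1, hx, hy, fun w hw => ?_⟩
    obtain ⟨s, t, hst⟩ := hpr w hw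
    simp only [pr] at h1 h2 ⊢
    rw [hst 0, hst 1, hst 2, hst 3]
    linear_combination s * h1 + t * h2
end
end IUC
end

section
open Finset
open scoped Pointwise
set_option maxHeartbeats 400000
set_option linter.unusedSectionVars false
namespace IUC

section
variable {G : Type*} [Group G] [Fintype G] [DecidableEq G]

/-- density of a functional -/
noncomputable def law (μ : Mn G) (x : G) : ℝ := μ (fun g => if x = g then 1 else 0)

lemma law_sum (μ : Mn G) (f : G → ℝ) : μ f = ∑ x, law μ x * f x := by
  rw [LinearMap.pi_apply_eq_sum_univ μ f]
  exact Finset.sum_congr rfl (fun x _ => by rw [smul_eq_mul, mul_comm]; rfl)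

lemma law_cv (μ ν : Mn G) : law (cv μ ν) = conv (law μ) (law ν) := by
  funext x
  have h1 := sum_conv_mul (law μ) (law ν) (fun g => if x = g then (1:ℝ) else 0)
  have h2 : ∑ g, conv (law μ) (law ν) g * (if x = g then (1:ℝ) else 0) = conv (law μ) (law ν) x := by simp
  rw [← h2, h1]
  show cv μ ν _ = _
  rw [cv_apply, law_sum μ]
  apply Finset.sum_congr rfl
  intro y _
  rw [law_sum ν, Finset.mul_sum]
  exact Finset.sum_congr rfl (fun z _ => by ring)

lemma law_nonneg {μ : Mn G} {S : Set G} (h : IsP μ S) (x : G) : 0 ≤ law μ x := h.1 _ (fun g _ => by split_ifs <;> simp)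

lemma law_one {μ : Mn G} {S : Set G} (h : IsP μ S) : ∑ x, law μ x = 1 := by
  have := law_sum μ (fun _ => 1)
  rw [h.2] at this
  simpa using this.symm

end

section
open scoped MatrixGroups LinearAlgebra.Projectivization

/-- size condition -/
def bdM (M : ℕ) (Z : ℤ) : Set (SL(2, ℤ)) := {g | ∀ i j, 12 * (M:ℤ) * |g i j| ≤ Z}

lemma mul_bd (g h : SL(2, ℤ)) (A B : ℤ) (hg : ∀ i j, |g i j| ≤ A) (hh : ∀ i j, |h i j| ≤ B) (i j : Fin 2) :
    |(g * h) i j| ≤ 2 * (A * B) := by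
  rw [Matrix.SpecialLinearGroup.coe_mul, Matrix.mul_apply, Fin.sum_univ_two]
  refine (abs_add_le _ _).trans ?_
  have h1 := abs_mul_le' (hg i 0) (hh 0 j)
  have h2 := abs_mul_le' (hg i 1) (hh 1 j)
  linarith

lemma bdM_mul (M : ℕ) (hM : 0 < M) (Z Z' : ℤ) (hZ : 0 ≤ Z) (g u h : SL(2, ℤ)) (hg : g ∈ bdM M Z) (hu : ∀ i j, |u i j| ≤ 3 * (M:ℤ)) (hh : h ∈ bdM M Z') :
    g * (u * h) ∈ bdM M (Z * Z') := by
  intro i j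
  have hM' : (0:ℤ) < M := by exact_mod_cast hM
  have h1 : ∀ k l, 2 * |(u * h) k l| ≤ Z' := by
    intro k l
    rw [Matrix.SpecialLinearGroup.coe_mul, Matrix.mul_apply, Fin.sum_univ_two]
    have h0 := abs_add_le (u k 0 * h 0 l) (u k 1 * h 1 l)
    have h1 := abs_mul_le' (hu k 0) (le_refl |h 0 l|)
    have h2 := abs_mul_le' (hu k 1) (le_refl |h 1 l|)
    have h3 := hh 0 l
    have h4 := hh 1 l
    nlinarith
  rw [Matrix.SpecialLinearGroup.coe_mul, Matrix.mul_apply, Fin.sum_univ_two]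
  have h0 := abs_add_le (g i 0 * (u * h) 0 j) (g i 1 * (u * h) 1 j)
  rw [abs_mul, abs_mul] at h0
  have e1 : (12 * (M:ℤ) * |g i 0|) * (2 * |(u * h) 0 j|) ≤ Z * Z' := mul_le_mul (hg i 0) (h1 0 j) (by positivity) hZ
  have e2 : (12 * (M:ℤ) * |g i 1|) * (2 * |(u * h) 1 j|) ≤ Z * Z' := mul_le_mul (hg i 1) (h1 1 j) (by positivity) hZ
  nlinarith

lemma uu_supp (M : ℕ) (hM : 0 < M) (g : SL(2, ℤ)) (S : Set (SL(2, ℤ))) (h : ∀ n : ℤ, |n| ≤ M → g ^ n ∈ S) : IsP (uu M g) S := by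
  refine IsP.cv (S := {x | ∃ s : ℕ, s < M ∧ x = g ^ (s:ℤ)}) (T := {x | ∃ s : ℕ, s < M ∧ x = g ^ (-(s:ℤ))})
    (IsP.av hM _ _ (fun s hs => ⟨s, hs, by simp⟩)) (IsP.av hM _ _ (fun s hs => ⟨s, hs, by simp⟩)) ?_
  rintro _ ⟨s, hs, rfl⟩ _ ⟨s', hs', rfl⟩
  rw [← zpow_add]
  apply h
  rw [abs_le]; omega

lemma RR_supp (M : ℕ) (hM : 0 < M) (j : ℕ) : IsP (RR M gT gS j) (bdM M ((6 * (M:ℤ)) ^ (2 ^ (j + 1)))) := by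
  have hM' : (1:ℤ) ≤ M := by exact_mod_cast hM
  have hT : IsP (uu M gT) {u | ∀ i j, |u i j| ≤ 3 * (M:ℤ)} := by
    apply uu_supp M hM
    intro n hn
    have h3 : |3 * n| ≤ 3 * (M:ℤ) := by rw [abs_mul]; norm_num; exact hn
    intro i j
    rw [gT_zpow]
    fin_cases i <;> fin_cases j <;> simp only [Fin.zero_eta, Fin.mk_one, Matrix.cons_val, Matrix.of_apply, Matrix.cons_val'] <;> first | exact h3 | (simp; try omega)
  induction j with
  | zero =>
    apply uu_supp M hM
    intro n hn
    have h3 : |-3 * n| ≤ 3 * (M:ℤ) := by rw [abs_mul]; norm_num; exact hn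
    have key : ∀ i j, |(gS ^ n : SL(2, ℤ)) i j| ≤ 3 * (M:ℤ) := by
      intro i j
      rw [gS_zpow]
      fin_cases i <;> fin_cases j <;> simp only [Fin.zero_eta, Fin.mk_one, Matrix.cons_val, Matrix.of_apply, Matrix.cons_val'] <;> first | exact h3 | (simp; try omega)
    intro i j
    have := key i j
    norm_num
    nlinarith
  | succ j ih =>
    refine IsP.cv ih (IsP.cv (U := {x | ∃ u h : SL(2, ℤ), (∀ i j, |u i j| ≤ 3 * (M:ℤ)) ∧ h ∈ bdM M ((6 * (M:ℤ)) ^ (2 ^ (j + 1))) ∧ x = u * h}) hT ih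
      (fun u hu h hh => ⟨u, h, hu, hh, rfl⟩)) ?_
    rintro g hg _ ⟨u, h, hu, hh, rfl⟩
    have := bdM_mul M hM _ _ (by positivity) g u h hg hu hh
    rwa [← pow_add, ← two_mul, ← pow_succ'] at this

variable {q : ℕ} [Fact q.Prime] {K : Type*} [Field K] [IsAlgClosed K] [Algebra (ZMod q) K]

variable (q) in
/-- reduction mod q -/
noncomputable abbrev piq : SL(2, ℤ) →* SL (ZMod q) := Matrix.SpecialLinearGroup.map (Int.castRingHom (ZMod q))

lemma to_points (x0 x1 y0 y1 : ℂ) (hx : x0 ≠ 0 ∨ x1 ≠ 0) (hy : y0 ≠ 0 ∨ y1 ≠ 0) :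
    ∃ X Y : PC, ∀ w : SL(2, ℤ), x0 * y0 * w 0 0 + x0 * y1 * w 1 0 + x1 * y0 * w 0 1 + x1 * y1 * w 1 1 = 0 → phC w • X = Y := by
  have hx' : (![x0, x1] : Fin 2 → ℂ) ≠ 0 := by
    intro h
    have h0 := congrFun h 0
    have h1 := congrFun h 1
    simp at h0 h1
    rcases hx with h | h
    · exact h h0
    · exact h h1
  have hy' : (![-y1, y0] : Fin 2 → ℂ) ≠ 0 := by
    intro h
    have h0 := congrFun h 0
    have h1 := congrFun h 1
    simp at h0 h1
    rcases hy with h | h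
    · exact h h1
    · exact h h0
  refine ⟨Projectivization.mk ℂ _ hx', Projectivization.mk ℂ _ hy', fun w hw => ?_⟩
  rw [Projectivization.smul_mk, Projectivization.mk_eq_mk_iff']
  have s0 := smul_C w ![x0, x1] 0
  have s1 := smul_C w ![x0, x1] 1
  simp only [Matrix.cons_val] at s0 s1
  by_cases h0 : y0 = 0
  · have h1 : y1 ≠ 0 := by tauto
    refine ⟨-(((w 0 0 : ℤ) : ℂ) * x0 + (w 0 1 : ℤ) * x1) / y1, ?_⟩
    funext i
    fin_cases i
    · simp only [Fin.zero_eta, s0]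
      simp
      field_simp
      ring
    · simp only [Fin.mk_one, s1]
      simp
      rw [h0] at hw ⊢
      have : y1 * (((w 1 0 : ℤ) : ℂ) * x0 + (w 1 1 : ℤ) * x1) = 0 := by linear_combination hw
      rw [(mul_eq_zero.1 this).resolve_left h1, mul_zero]
  · refine ⟨(((w 1 0 : ℤ) : ℂ) * x0 + (w 1 1 : ℤ) * x1) / y0, ?_⟩
    funext i
    fin_cases i
    · simp only [Fin.zero_eta, s0]
      simp
      field_simp
      linear_combination -hw
    · simp only [Fin.mk_one, s1]
      simp
      field_simp

instance : DecidableEq (SL (ZMod q)) := inferInstance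

theorem cnd_RR (M : ℕ) (hM : 50 ≤ M) (j : ℕ) (hq : (6 * M) ^ (20 * 2 ^ j) ≤ q) :
    cnd K (law (RR M (piq q gT) (piq q gS) j)) (2 * (4 / (M:ℝ)) ^ (2 ^ j - 1)) := by
  classical
  intro E P _ hE hd hP
  haveI : CharP K q := charP_of_injective_algebraMap (algebraMap (ZMod q) K).injective q
  have hM0 : 0 < M := by omega
  have hM' : (50:ℤ) ≤ M := by exact_mod_cast hM
  rw [← law_sum, ← pf_RR, pf_apply]
  set X : ℤ := (6 * (M:ℤ)) ^ (2 ^ (j + 1)) with hX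
  have hX2 : 73 ≤ X := by
    calc (73:ℤ) ≤ (6 * (M:ℤ)) ^ 1 := by rw [pow_one]; linarith
      _ ≤ X := pow_le_pow_right₀ (by linarith) Nat.one_le_two_pow
  have hXq : 72 * X ^ 6 < q := by
    have e : X ^ 10 ≤ (q : ℤ) := by
      have e1 : X ^ 10 = (((6 * M) ^ (20 * 2 ^ j) : ℕ) : ℤ) := by
        rw [hX, ← pow_mul]
        push_cast
        have : 2 ^ (j + 1) * 10 = 20 * 2 ^ j := by rw [pow_succ]; ring
        rw [this]
      rw [e1]
      exact_mod_cast hq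
    have e2 : X ^ 7 ≤ X ^ 10 := pow_le_pow_right₀ (by linarith) (by norm_num)
    have e3 : 0 < X ^ 6 := by positivity
    nlinarith
  have hbd : ∀ w ∈ bdM M X, ∀ i j, |w i j| ≤ X := by
    intro w hw i j
    have := hw i j
    nlinarith [abs_nonneg (w i j)]
  obtain ⟨x0, x1, y0, y1, hx, hy, hxy⟩ := lift_iso (q := q) (K := K)
    {v | ∃ w : SL(2, ℤ), w ∈ bdM M X ∧ P (piq q w) ∧ v = ![w 0 0, w 1 0, w 0 1, w 1 1]} X (by linarith) hXq (by
      rintro _ ⟨w, hw, _, rfl⟩ i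
      have := hbd w hw
      fin_cases i <;> simp [this])
    ![E 0 0, E 0 1, E 1 0, E 1 1] (by
      intro h
      apply hE
      exact m2ext (congrFun h 0) (congrFun h 1) (congrFun h 2) (congrFun h 3)) (by
      rw [Matrix.det_fin_two] at hd
      simp only [Matrix.cons_val]
      linear_combination hd) (by
      rintro _ ⟨w, _, hw, rfl⟩
      have := hP _ hw
      simp only [Matrix.trace_fin_two, Matrix.mul_apply, Fin.sum_univ_two, toK] at this
      simp [pr] at this ⊢
      linear_combination this)
  obtain ⟨x, y, h⟩ := to_points x0 x1 y0 y1 hx hy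
  refine le_trans ((RR_supp M hM0 j).le ?_) (word_count M hM0 j x y)
  intro w hw
  by_cases hpw : P (piq q w)
  · have h2 := h w (by
      have := hxy _ ⟨w, hw, hpw, rfl⟩
      simpa [pr] using this)
    rw [if_pos h2]
    split_ifs <;> norm_num
  · rw [if_neg hpw]
    split_ifs <;> norm_num

lemma cnd_conv' {μ ν : SL (ZMod q) → ℝ} {a : ℝ} (h0 : ∀ x, 0 ≤ μ x) (h1 : ∑ x, μ x = 1) (h : cnd K ν a) :
    cnd K (conv ν μ) a := by
  intro E P _ hE hd hP
  rw [sum_conv_mul, Finset.sum_comm]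
  calc ∑ z, ∑ y, ν y * μ z * (if P (y * z) then (1:ℝ) else 0) ≤ ∑ z, μ z * a := by
        apply Finset.sum_le_sum
        intro z _
        have := h (toK z * E) (fun y => P (y * z)) (rk_mul' hE hd z).1 (rk_mul' hE hd z).2 (by
          intro g hg
          have := hP _ hg
          rwa [toK_mul, ← mul_assoc, Matrix.trace_mul_comm, ← mul_assoc] at this)
        calc _ = μ z * ∑ y, ν y * (if P (y * z) then (1:ℝ) else 0) := by
              rw [Finset.mul_sum]; exact Finset.sum_congr rfl (fun z _ => by ring)
          _ ≤ _ := mul_le_mul_of_nonneg_left this (h0 z)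
    _ = a := by rw [← Finset.sum_mul, h1, one_mul]
end

section
variable {Γ : Type*} [Group Γ]
/-- symmetrised words -/
noncomputable def PP (M : ℕ) (g k : Γ) (j : ℕ) : Mn Γ := cv (av M g⁻¹) (cv (RR M g k j) (av M g))

lemma PP_succ (M : ℕ) (g k : Γ) (j : ℕ) : PP M g k (j + 1) = cv (PP M g k j) (PP M g k j) := by
  simp only [PP, RR, uu, cv_assoc]

lemma PP_zero (M : ℕ) (g s : Γ) : PP M g (s * g * s⁻¹) 0 =
    cv (cv (av M g⁻¹) (cv (dl s) (av M g))) (cv (av M g⁻¹) (cv (dl s⁻¹) (av M g))) := by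
  ext f
  simp only [PP, RR, uu, cv_apply, dl_apply, av_apply]
  have hc : (s * g * s⁻¹)⁻¹ = s * g⁻¹ * s⁻¹ := by group
  simp only [hc, conj_pow]
  simp only [mul_assoc, inv_mul_cancel_left]

lemma IsP_univ_av {M : ℕ} (hM : 0 < M) (g : Γ) : IsP (av M g) Set.univ := IsP.av hM _ _ (fun _ _ => trivial)

lemma IsP_uu {M : ℕ} (hM : 0 < M) (g : Γ) : IsP (uu M g) Set.univ :=
  IsP.cv (IsP_univ_av hM g) (IsP_univ_av hM g⁻¹) (fun _ _ _ _ => trivial)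

lemma IsP_RR {M : ℕ} (hM : 0 < M) (g k : Γ) (j : ℕ) : IsP (RR M g k j) Set.univ := by
  induction j with
  | zero => exact IsP_uu hM k
  | succ j ih => exact IsP.cv ih (IsP.cv (U := Set.univ) (IsP_uu hM g) ih (fun _ _ _ _ => trivial)) (fun _ _ _ _ => trivial)

lemma IsP_PP {M : ℕ} (hM : 0 < M) (g k : Γ) (j : ℕ) : IsP (PP M g k j) Set.univ :=
  IsP.cv (IsP_univ_av hM _) (IsP.cv (U := Set.univ) (IsP_RR hM g k j) (IsP_univ_av hM _) (fun _ _ _ _ => trivial)) (fun _ _ _ _ => trivial)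
end

section
variable {q : ℕ} [Fact q.Prime]

theorem cnd_PP {K : Type*} [Field K] [IsAlgClosed K] [Algebra (ZMod q) K] (M : ℕ) (hM : 50 ≤ M) (j : ℕ) (hq : (6 * M) ^ (20 * 2 ^ j) ≤ q) :
    cnd K (law (PP M (piq q gT) (piq q gS) j)) (2 * (4 / (M:ℝ)) ^ (2 ^ j - 1)) := by
  have hM0 : 0 < M := by omega
  rw [PP, law_cv, law_cv]
  exact cnd_conv (law_nonneg (IsP_univ_av hM0 _)) (law_one (IsP_univ_av hM0 _))
    (cnd_conv' (law_nonneg (IsP_univ_av hM0 _)) (law_one (IsP_univ_av hM0 _)) (cnd_RR M hM j hq))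

lemma dbl_PP (M : ℕ) (g k : SL (ZMod q)) (j i : ℕ) : dbl (law (PP M g k j)) i = law (PP M g k (j + i)) := by
  induction i with
  | zero => rfl
  | succ i ih =>
    rw [← add_assoc, PP_succ, law_cv, ← ih]; rfl

/-- the flattened law -/
theorem PP_flat {T : ℝ} (hT : 2 ≤ T) {D L e : ℕ} (hL : 400000 ≤ L) (hD : 400000 + e ≤ D) (hqT : (q:ℝ) = T ^ D) (hq5 : 5 ≤ q)
    (M : ℕ) (hM : 50 ≤ M) (j : ℕ) (hq : (6 * M) ^ (20 * 2 ^ j) ≤ q) (hc : 2 * (4 / (M:ℝ)) ^ (2 ^ j - 1) ≤ (T ^ L)⁻¹) :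
    ∑ x, law (PP M (piq q gT) (piq q gS) (j + (2 * D + e))) x ^ 2 ≤ (T ^ (2 * D + e))⁻¹ := by
  have hM0 : 0 < M := by omega
  rw [← dbl_PP]
  refine flat_iter (K := AlgebraicClosure (ZMod q)) hT hL hD hqT hq5 (law_nonneg (IsP_PP hM0 _ _ _)) (law_one (IsP_PP hM0 _ _ _)) ?_
  intro E P _ hE hd hP
  exact (cnd_PP M hM j hq E P hE hd hP).trans hc
end
end IUC
end

section
open Finset
open scoped Pointwise
set_option maxHeartbeats 400000
set_option linter.unusedSectionVars false
namespace IUC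

section
variable {G : Type*} [Group G] [Fintype G] [DecidableEq G] {Y : Type*} [Fintype Y] [DecidableEq Y] [MulAction G Y]

/-- inner product -/
def ip (f g : Y → ℝ) : ℝ := ∑ y, f y * g y

lemma ip_comm (f g : Y → ℝ) : ip f g = ip g f := Finset.sum_congr rfl (fun _ _ => mul_comm _ _)
lemma ip_self_nonneg (f : Y → ℝ) : 0 ≤ ip f f := Finset.sum_nonneg (fun _ _ => mul_self_nonneg _)
lemma ip_cs (f g : Y → ℝ) : ip f g ^ 2 ≤ ip f f * ip g g := by
  have := Finset.sum_mul_sq_le_sq_mul_sq univ f g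
  simpa only [ip, sq] using this

lemma sum_smul (f : Y → ℝ) (x : G) : ∑ y, f (x • y) = ∑ y, f y := Equiv.sum_comp (MulAction.toPerm x) f

lemma two_trans (f g : Y → ℝ) (hf : ∑ y, f y = 0) (hg : ∑ y, g y = 0)
    (h2 : ∀ a b c d : Y, a ≠ b → c ≠ d → ∃ x : G, x • a = c ∧ x • b = d) (h1 : ∀ a c : Y, ∃ x : G, x • a = c) (hn : 2 ≤ Fintype.card Y) :
    ((Fintype.card Y : ℝ) - 1) * ∑ x : G, (∑ y, f (x⁻¹ • y) * g y) ^ 2 = Fintype.card G * ip f f * ip g g := by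
  set H : Y → Y → ℝ := fun y z => ∑ x : G, f (x⁻¹ • y) * f (x⁻¹ • z) with hH
  have inv : ∀ (t : G) y z, H (t • y) (t • z) = H y z := by
    intro t y z
    simp only [hH]
    rw [← Equiv.sum_comp (Equiv.mulLeft t)]
    apply Finset.sum_congr rfl
    intro x _
    simp [mul_smul]
  obtain ⟨a, b, hab⟩ := Fintype.exists_pair_of_one_lt_card (α := Y) (by omega)
  set α := H a a with hα
  set β := H a b with hβ
  have hd : ∀ y, H y y = α := by
    intro y
    obtain ⟨x, rfl⟩ := h1 a y
    rw [inv]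
  have ho : ∀ y z, y ≠ z → H y z = β := by
    intro y z hyz
    obtain ⟨x, rfl, rfl⟩ := h2 a b y z hab hyz
    rw [inv]
  have hform : ∀ y z, H y z = β + (α - β) * (if y = z then 1 else 0) := by
    intro y z
    split_ifs with h
    · rw [h, hd]; ring
    · rw [ho y z h]; ring
  have e1 : α + ((Fintype.card Y : ℝ) - 1) * β = 0 := by
    have s1 : ∑ z, H a z = 0 := by
      simp only [hH]
      rw [Finset.sum_comm]
      apply Finset.sum_eq_zero
      intro x _
      rw [← Finset.mul_sum, sum_smul, hf, mul_zero]
    simp only [hform, Finset.sum_add_distrib, ← Finset.mul_sum, Finset.sum_ite_eq, Finset.mem_univ, if_true, Finset.sum_const, Finset.card_univ, nsmul_eq_mul] at s1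
    linarith
  have e2 : (Fintype.card Y : ℝ) * α = Fintype.card G * ip f f := by
    have s1 : ∑ y, H y y = Fintype.card G * ip f f := by
      simp only [hH]
      rw [Finset.sum_comm]
      have : ∀ x : G, ∑ y, f (x⁻¹ • y) * f (x⁻¹ • y) = ip f f := fun x => sum_smul (fun y => f y * f y) x⁻¹
      simp only [this, Finset.sum_const, Finset.card_univ, nsmul_eq_mul]
    simp only [hd, Finset.sum_const, Finset.card_univ, nsmul_eq_mul] at s1
    exact s1
  have e3 : ∑ x : G, (∑ y, f (x⁻¹ • y) * g y) ^ 2 = (α - β) * ip g g := by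
    have s1 : ∑ x : G, (∑ y, f (x⁻¹ • y) * g y) ^ 2 = ∑ y, ∑ z, H y z * (g y * g z) := by
      have t1 : ∀ x : G, (∑ y, f (x⁻¹ • y) * g y) ^ 2 = ∑ y, ∑ z, (f (x⁻¹ • y) * g y) * (f (x⁻¹ • z) * g z) := by
        intro x
        rw [sq, Finset.sum_mul_sum]
      simp only [t1, hH, Finset.sum_mul]
      rw [Finset.sum_comm]
      apply Finset.sum_congr rfl
      intro y _
      rw [Finset.sum_comm]
      exact Finset.sum_congr rfl (fun z _ => Finset.sum_congr rfl (fun x _ => by ring))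
    rw [s1]
    have s2 : ∀ y, ∑ z, H y z * (g y * g z) = (α - β) * (g y * g y) := by
      intro y
      have : ∀ z, H y z * (g y * g z) = β * g y * g z + (if y = z then (α - β) * (g y * g z) else 0) := by
        intro z
        rw [hform]
        split_ifs <;> ring
      simp only [this, Finset.sum_add_distrib, ← Finset.mul_sum, hg, Finset.sum_ite_eq, Finset.mem_univ, if_true]
      ring
    simp only [s2, ← Finset.mul_sum, ip]
  rw [e3]
  linear_combination (ip g g) * e2 - ip g g * e1

lemma ip_ac (μ : Mn G) (f g : Y → ℝ) : ip (ac μ f) g = ∑ x, law μ x * ∑ y, f (x⁻¹ • y) * g y := by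
  simp only [ip, ac, law_sum μ, Finset.sum_mul, Finset.mul_sum]
  rw [Finset.sum_comm]
  exact Finset.sum_congr rfl (fun z _ => Finset.sum_congr rfl (fun x _ => by ring))

lemma ip_ac_sq (μ : Mn G) (f g : Y → ℝ) : ip (ac μ f) g ^ 2 ≤ (∑ x, law μ x ^ 2) * ∑ x : G, (∑ y, f (x⁻¹ • y) * g y) ^ 2 := by
  rw [ip_ac]
  exact Finset.sum_mul_sq_le_sq_mul_sq univ _ _

lemma sum_ac {μ : Mn G} {S : Set G} (h : IsP μ S) (f : Y → ℝ) : ∑ y, ac μ f y = ∑ y, f y := by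
  have h2 := ip_ac μ f (fun _ => 1)
  simp only [ip, mul_one, sum_smul] at h2
  rw [h2, ← Finset.sum_mul, law_one h, one_mul]

variable (Y) in
/-- adjointness -/
def Adj (μ ν : Mn G) : Prop := ∀ f g : Y → ℝ, ip (ac μ f) g = ip f (ac ν g)

lemma Adj.cv {μ ν μ' ν' : Mn G} (h : Adj Y μ ν) (h' : Adj Y μ' ν') : Adj Y (cv μ μ') (cv ν' ν) := by
  intro f g
  rw [ac_cv, ac_cv, h, h']

lemma Adj_dl (x : G) : Adj Y (dl x) (dl x⁻¹) := by
  intro f g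
  simp only [ip, ac, dl_apply, inv_inv]
  rw [← sum_smul _ x]
  simp

lemma ac_av (M : ℕ) (x : G) (f : Y → ℝ) (y : Y) : ac (av M x) f y = (M:ℝ)⁻¹ * ∑ s ∈ range M, f ((x ^ s)⁻¹ • y) := rfl

lemma Adj_av (M : ℕ) (x : G) : Adj Y (av M x) (av M x⁻¹) := by
  intro f g
  simp only [ip, ac_av, Finset.mul_sum, Finset.sum_mul]
  rw [Finset.sum_comm]
  conv_rhs => rw [Finset.sum_comm]
  apply Finset.sum_congr rfl
  intro s _
  rw [← sum_smul _ (x ^ s)]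
  apply Finset.sum_congr rfl
  intro y _
  simp
  ring

lemma Adj_av' (M : ℕ) (x : G) : Adj Y (av M x⁻¹) (av M x) := by
  have := Adj_av (Y := Y) M x⁻¹
  rwa [inv_inv] at this

/-- the basic operator -/
noncomputable def TT (M : ℕ) (g s : G) : Mn G := cv (av M g⁻¹) (cv (dl s) (av M g))

lemma Adj_TT (M : ℕ) (g s : G) : Adj Y (TT M g s) (TT M g s⁻¹) := by
  have := (Adj_av' (Y := Y) M g).cv ((Adj_dl (Y := Y) s).cv (Adj_av (Y := Y) M g))
  rwa [cv_assoc] at this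

lemma Adj_PP (M : ℕ) (g s : G) (j : ℕ) : Adj Y (PP M g (s * g * s⁻¹) j) (PP M g (s * g * s⁻¹) j) := by
  induction j with
  | zero =>
    rw [PP_zero]
    have := (Adj_TT (Y := Y) M g s).cv (Adj_TT (Y := Y) M g s⁻¹)
    rwa [inv_inv] at this
  | succ j ih => rw [PP_succ]; exact ih.cv ih

lemma PP_iter (M : ℕ) (g s : G) (f : Y → ℝ) (i : ℕ) :
    ip (ac (TT M g s⁻¹) f) (ac (TT M g s⁻¹) f) ^ (2 ^ i) ≤ ip (ac (PP M g (s * g * s⁻¹) i) f) f * ip f f ^ (2 ^ i - 1) := by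
  set a0 := ip (ac (TT M g s⁻¹) f) (ac (TT M g s⁻¹) f) with ha0
  have h0 : 0 ≤ a0 := ip_self_nonneg _
  have hF : 0 ≤ ip f f := ip_self_nonneg _
  induction i with
  | zero =>
    simp only [pow_zero, pow_one, Nat.sub_self, mul_one]
    rw [PP_zero]
    have := (Adj_TT (Y := Y) M g s) (ac (TT M g s⁻¹) f) f
    rw [← ac_cv] at this
    exact this.symm.le
  | succ i ih =>
    have h1 : (a0 ^ 2 ^ i) ^ 2 ≤ (ip (ac (PP M g (s * g * s⁻¹) i) f) f * ip f f ^ (2 ^ i - 1)) ^ 2 :=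
      pow_le_pow_left₀ (by positivity) ih 2
    have h2 : ip (ac (PP M g (s * g * s⁻¹) i) f) f ^ 2 ≤ ip (ac (PP M g (s * g * s⁻¹) (i + 1)) f) f * ip f f := by
      have := ip_cs (ac (PP M g (s * g * s⁻¹) i) f) f
      rwa [← Adj_PP (Y := Y) M g s i, ← ac_cv, ← PP_succ] at this
    have e : 2 ^ (i + 1) - 1 = 1 + (2 ^ i - 1) * 2 := by
      have : 1 ≤ 2 ^ i := Nat.one_le_two_pow
      rw [pow_succ]; omega
    have e1 : a0 ^ (2 ^ (i + 1)) = (a0 ^ 2 ^ i) ^ 2 := by rw [← pow_mul, ← pow_succ]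
    have e2 : ip f f ^ (1 + (2 ^ i - 1) * 2) = ip f f * (ip f f ^ (2 ^ i - 1)) ^ 2 := by rw [pow_add, pow_one, pow_mul]
    rw [e, e1, e2]
    refine h1.trans ?_
    rw [mul_pow, ← mul_assoc]
    exact mul_le_mul_of_nonneg_right h2 (by positivity)

lemma jensen (M : ℕ) (hM : 0 < M) (F : ℕ → Y → ℝ) (c : ℝ) (h : ∀ s < M, ip (F s) (F s) ≤ c) :
    ip (fun y => (M:ℝ)⁻¹ * ∑ s ∈ range M, F s y) (fun y => (M:ℝ)⁻¹ * ∑ s ∈ range M, F s y) ≤ c := by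
  have hM' : (0:ℝ) < M := by exact_mod_cast hM
  have h1 : ∀ y, ((M:ℝ)⁻¹ * ∑ s ∈ range M, F s y) * ((M:ℝ)⁻¹ * ∑ s ∈ range M, F s y) ≤ (M:ℝ)⁻¹ * ∑ s ∈ range M, F s y * F s y := by
    intro y
    have := sq_sum_le_card_mul_sum_sq (s := range M) (f := fun s => F s y)
    rw [card_range] at this
    simp only [sq] at this
    calc _ = (M:ℝ)⁻¹ * (M:ℝ)⁻¹ * ((∑ s ∈ range M, F s y) * (∑ s ∈ range M, F s y)) := by ring
      _ ≤ (M:ℝ)⁻¹ * (M:ℝ)⁻¹ * (M * ∑ s ∈ range M, F s y * F s y) := mul_le_mul_of_nonneg_left this (by positivity)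
      _ = _ := by field_simp
  refine (Finset.sum_le_sum (fun y _ => h1 y)).trans ?_
  rw [← Finset.mul_sum, Finset.sum_comm]
  calc (M:ℝ)⁻¹ * ∑ s ∈ range M, ip (F s) (F s) ≤ (M:ℝ)⁻¹ * ∑ s ∈ range M, c := by
        apply mul_le_mul_of_nonneg_left _ (by positivity)
        exact Finset.sum_le_sum (fun s hs => h s (Finset.mem_range.1 hs))
    _ = c := by simp; field_simp

lemma av_contr (M : ℕ) (hM : 0 < M) (x : G) (f : Y → ℝ) : ip (ac (av M x) f) (ac (av M x) f) ≤ ip f f := by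
  refine jensen M hM (fun s y => f ((x ^ s)⁻¹ • y)) _ (fun s _ => ?_)
  exact (sum_smul (fun y => f y * f y) _).le

lemma av_near (M : ℕ) (hM : 0 < M) (x : G) (f : Y → ℝ) (c : ℝ) (h : ∀ s < M, ip (fun y => f ((x ^ s)⁻¹ • y) - f y) (fun y => f ((x ^ s)⁻¹ • y) - f y) ≤ c) :
    ip (fun y => ac (av M x) f y - f y) (fun y => ac (av M x) f y - f y) ≤ c := by
  have hM' : (0:ℝ) < M := by exact_mod_cast hM
  have e : (fun y => ac (av M x) f y - f y) = fun y => (M:ℝ)⁻¹ * ∑ s ∈ range M, (f ((x ^ s)⁻¹ • y) - f y) := by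
    funext y
    rw [ac_av, Finset.sum_sub_distrib, mul_sub]
    simp
    field_simp
  rw [e]
  exact jensen M hM (fun s y => f ((x ^ s)⁻¹ • y) - f y) c h

lemma ip_abs (f g : Y → ℝ) {a b : ℝ} (hf : ip f f ≤ a) (hg : ip g g ≤ b) : |ip f g| ≤ √(a * b) := by
  apply Real.abs_le_sqrt
  exact (ip_cs f g).trans (mul_le_mul hf hg (ip_self_nonneg _) ((ip_self_nonneg _).trans hf))

/-- replacing the twist by the smoothed twist -/
lemma smooth (M : ℕ) (hM : 0 < M) (x s : G) (f g : Y → ℝ) {F H cf cg : ℝ} (hF : ip f f ≤ F) (hH : ip g g ≤ H)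
    (hf : ∀ t < M, ip (fun y => f ((x ^ t)⁻¹ • y) - f y) (fun y => f ((x ^ t)⁻¹ • y) - f y) ≤ cf)
    (hg : ∀ t < M, ip (fun y => g ((x ^ t)⁻¹ • y) - g y) (fun y => g ((x ^ t)⁻¹ • y) - g y) ≤ cg) :
    |ip (ac (TT M x s) g) f - ip (ac (dl s) g) f| ≤ √(cg * F) + √(H * cf) := by
  have h1 := av_near M hM x f cf hf
  have h2 := av_near M hM x g cg hg
  set f' := ac (av M x) f with hf'
  set g' := ac (av M x) g with hg'
  have e : ip (ac (TT M x s) g) f = ip (ac (dl s) g') f' := by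
    rw [TT, ac_cv, ac_cv, Adj_av' (Y := Y) M x]
  have e2 : ip (ac (TT M x s) g) f - ip (ac (dl s) g) f
      = ip (ac (dl s) (fun y => g' y - g y)) f' + ip (ac (dl s) g) (fun y => f' y - f y) := by
    rw [e]
    simp only [ip, ac, dl_apply, ← Finset.sum_sub_distrib, ← Finset.sum_add_distrib]
    exact Finset.sum_congr rfl (fun y _ => by ring)
  have iso : ∀ k : Y → ℝ, ip (ac (dl s) k) (ac (dl s) k) = ip k k := fun k => sum_smul (fun y => k y * k y) s⁻¹
  rw [e2]
  refine (abs_add_le _ _).trans (add_le_add ?_ ?_)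
  · exact ip_abs _ _ ((iso _).trans_le h2) ((av_contr M hM x f).trans hF)
  · exact ip_abs _ _ ((iso _).trans_le hH) h1

end
end IUC
end

section
open Finset
open scoped Pointwise
set_option maxHeartbeats 400000
set_option linter.unusedSectionVars false
namespace IUC

section
variable {G : Type*} [Group G] [Fintype G] [DecidableEq G] {Y : Type*} [Fintype Y] [DecidableEq Y] [MulAction G Y]

/-- indicator -/
def ind (P : Finset Y) (y : Y) : ℝ := if y ∈ P then 1 else 0

lemma sum_ind (P : Finset Y) : ∑ y, ind P y = P.card := by
  simp [ind]

lemma ip_ind (P Q : Finset Y) : ip (ind P) (ind Q) = ((P ∩ Q).card : ℝ) := by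
  rw [← sum_ind]
  apply Finset.sum_congr rfl
  intro y _
  simp only [ind, Finset.mem_inter]
  split_ifs <;> simp_all

lemma ind_smul (P : Finset Y) (x : G) (y : Y) : ind P (x⁻¹ • y) = ind (x • P) y := by
  simp only [ind, Finset.inv_smul_mem_iff]

lemma ip_ind_sub (P Q : Finset Y) (h : P.card = Q.card) :
    ip (fun y => ind P y - ind Q y) (fun y => ind P y - ind Q y) = 2 * ((P \ Q).card : ℝ) := by
  have e : ip (fun y => ind P y - ind Q y) (fun y => ind P y - ind Q y) = ip (ind P) (ind P) - 2 * ip (ind P) (ind Q) + ip (ind Q) (ind Q) := by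
    simp only [ip, Finset.mul_sum, ← Finset.sum_sub_distrib, ← Finset.sum_add_distrib]
    exact Finset.sum_congr rfl (fun y _ => by ring)
  rw [e, ip_ind, ip_ind, ip_ind, Finset.inter_self, Finset.inter_self]
  have h1 := Finset.card_sdiff_add_card_inter P Q
  have h2 : ((P \ Q).card : ℝ) + ((P ∩ Q).card : ℝ) = P.card := by exact_mod_cast h1
  have h3 : (P.card : ℝ) = Q.card := by exact_mod_cast h
  linarith

end

section
variable {q : ℕ} [Fact q.Prime]

/-- projective line -/
abbrev PL (q : ℕ) [Fact q.Prime] := Projectivization (ZMod q) (Fin 2 → ZMod q)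

noncomputable instance : Fintype (PL q) := Fintype.ofFinite _
noncomputable instance : DecidableEq (PL q) := Classical.decEq _

lemma card_PL : Fintype.card (PL q) = q + 1 := by
  have := Projectivization.card_of_finrank_two (k := ZMod q) (V := Fin 2 → ZMod q) (by simp)
  rw [Nat.card_eq_fintype_card, Nat.card_eq_fintype_card, ZMod.card] at this
  exact this

lemma card_SL_le : Fintype.card (SL (ZMod q)) ≤ 2 * q ^ 3 := by
  let φ : SL (ZMod q) → (ZMod q × ZMod q × ZMod q) × Bool := fun g =>
    if g.1 0 0 = 0 then ((g.1 0 0, g.1 0 1, g.1 1 1), true) else ((g.1 0 0, g.1 0 1, g.1 1 0), false)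
  have hi : Function.Injective φ := by
    intro g h hgh
    have dg := g.2
    have dh := h.2
    rw [Matrix.det_fin_two] at dg dh
    simp only [φ] at hgh
    have key : g.1 0 0 = h.1 0 0 ∧ g.1 0 1 = h.1 0 1 ∧ g.1 1 0 = h.1 1 0 ∧ g.1 1 1 = h.1 1 1 := by
      split_ifs at hgh with h1 h2 h2
      · simp only [Prod.mk.injEq, and_true] at hgh
        obtain ⟨e1, e2, e3⟩ := hgh
        refine ⟨e1, e2, ?_, e3⟩
        rw [h1] at dg
        rw [h2, ← e2] at dh
        have hb : g.1 0 1 ≠ 0 := by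
          intro hb
          rw [hb] at dg
          simp at dg
        exact mul_left_cancel₀ hb (by linear_combination dh - dg)
      · simp at hgh
      · simp at hgh
      · simp only [Prod.mk.injEq, and_true] at hgh
        obtain ⟨e1, e2, e3⟩ := hgh
        refine ⟨e1, e2, e3, ?_⟩
        rw [← e1, ← e2, ← e3] at dh
        exact mul_left_cancel₀ h1 (by linear_combination dg - dh)
    obtain ⟨k1, k2, k3, k4⟩ := key
    ext a b
    fin_cases a <;> fin_cases b
    · exact k1
    · exact k2
    · exact k3
    · exact k4
  have := Fintype.card_le_of_injective φ hi
  simp only [Fintype.card_prod, ZMod.card, Fintype.card_bool] at this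
  calc _ ≤ _ := this
    _ = _ := by ring

/-- spectral step -/
lemma spectral (M i : ℕ) (t s : SL (ZMod q)) {δ : ℝ} (hδ : ∑ x, law (PP M t (s * t * s⁻¹) i) x ^ 2 ≤ δ)
    (f : PL q → ℝ) (hf : ∑ y, f y = 0) {ρ : ℝ} (hρ : 0 ≤ ρ) (hr : δ * (2 * (q:ℝ) ^ 2) ≤ (ρ ^ (2 ^ i)) ^ 2) :
    ip (ac (TT M t s⁻¹) f) (ac (TT M t s⁻¹) f) ≤ ρ * ip f f := by
  have hq0 : (0:ℝ) < q := by exact_mod_cast (Fact.out : q.Prime).pos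
  have hF := ip_self_nonneg f
  have ha := ip_self_nonneg (ac (TT M t s⁻¹) f)
  have h2 : ∀ {a b c d : PL q}, a ≠ b → c ≠ d → ∃ g : SL (ZMod q), g • a = c ∧ g • b = d := MulAction.is_two_pretransitive_iff.1 (inferInstance : MulAction.IsMultiplyPretransitive (SL (ZMod q)) (PL q) 2)
  have hcard : 2 ≤ Fintype.card (PL q) := by
    rw [card_PL]
    have := (Fact.out : q.Prime).pos
    omega
  have h1 : ∀ a c : PL q, ∃ x : SL (ZMod q), x • a = c := by
    intro a c
    obtain ⟨b, hb⟩ := Fintype.exists_ne_of_one_lt_card (by omega) a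
    obtain ⟨d, hd⟩ := Fintype.exists_ne_of_one_lt_card (by omega) c
    obtain ⟨x, hx, _⟩ := h2 hb.symm hd.symm
    exact ⟨x, hx⟩
  have ht := two_trans (G := SL (ZMod q)) f f hf hf (fun a b c d h h' => h2 h h') h1 hcard
  rw [card_PL] at ht
  push_cast at ht
  rw [add_sub_cancel_right] at ht
  set Sx := ∑ x : SL (ZMod q), (∑ y, f (x⁻¹ • y) * f y) ^ 2 with hSx
  have hG : (Fintype.card (SL (ZMod q)) : ℝ) ≤ 2 * (q:ℝ) ^ 3 := by exact_mod_cast card_SL_le (q := q)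
  have hS : Sx ≤ 2 * (q:ℝ) ^ 2 * (ip f f) ^ 2 := by
    have : (q:ℝ) * Sx ≤ q * (2 * (q:ℝ) ^ 2 * (ip f f) ^ 2) := by
      rw [ht, mul_assoc, ← sq]
      calc _ ≤ 2 * (q:ℝ) ^ 3 * (ip f f) ^ 2 := mul_le_mul_of_nonneg_right hG (by positivity)
        _ = _ := by ring
    exact le_of_mul_le_mul_left this hq0
  have hS0 : 0 ≤ Sx := Finset.sum_nonneg (fun _ _ => sq_nonneg _)
  have hδ0 : 0 ≤ δ := (Finset.sum_nonneg (fun _ _ => sq_nonneg _)).trans hδ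
  have h3 : ip (ac (PP M t (s * t * s⁻¹) i) f) f ^ 2 ≤ (ρ ^ (2 ^ i) * ip f f) ^ 2 := by
    calc _ ≤ _ := ip_ac_sq _ f f
      _ ≤ δ * (2 * (q:ℝ) ^ 2 * (ip f f) ^ 2) := mul_le_mul hδ hS hS0 hδ0
      _ = (δ * (2 * (q:ℝ) ^ 2)) * (ip f f) ^ 2 := by ring
      _ ≤ (ρ ^ (2 ^ i)) ^ 2 * (ip f f) ^ 2 := mul_le_mul_of_nonneg_right hr (sq_nonneg _)
      _ = _ := by rw [mul_pow]
  have h4 : ip (ac (PP M t (s * t * s⁻¹) i) f) f ≤ ρ ^ (2 ^ i) * ip f f := le_of_sq_le_sq h3 (by positivity)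
  have h5 := PP_iter M t s f i
  have h6 : ip (ac (TT M t s⁻¹) f) (ac (TT M t s⁻¹) f) ^ (2 ^ i) ≤ (ρ * ip f f) ^ (2 ^ i) := by
    refine h5.trans ((mul_le_mul_of_nonneg_right h4 (by positivity)).trans ?_)
    rw [mul_assoc, ← pow_succ', Nat.sub_add_cancel Nat.one_le_two_pow, mul_pow]
  exact (pow_le_pow_iff_left₀ ha (by positivity) (by positivity)).1 h6

/-- affine point -/
def pt (z : ZMod q) : PL q := Projectivization.mk (ZMod q) ![z, 1] (by
  intro h
  have := congrFun h 1
  simp at this)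

lemma pt_inj : Function.Injective (pt (q := q)) := by
  intro z w h
  rw [pt, pt, Projectivization.mk_eq_mk_iff'] at h
  obtain ⟨a, ha⟩ := h
  have h0 := congrFun ha 0
  have h1 := congrFun ha 1
  simp at h0 h1
  rw [h1, one_mul] at h0
  exact h0.symm

lemma piq_entry (g : Matrix.SpecialLinearGroup (Fin 2) ℤ) (a b : Fin 2) : (piq q g).1 a b = ((g.1 a b : ℤ) : ZMod q) := rfl

lemma smul_T (z : ZMod q) : piq q gT • pt z = pt (z + 3) := by
  have h := gT_zpow 1
  rw [zpow_one] at h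
  rw [pt, Projectivization.smul_mk, pt, Projectivization.mk_eq_mk_iff']
  refine ⟨1, ?_⟩
  rw [one_smul]
  show _ = Matrix.mulVec (piq q gT).1 ![z, 1]
  funext a
  simp only [Matrix.mulVec, dotProduct, Fin.sum_univ_two, piq_entry, h]
  fin_cases a <;> simp

lemma smul_T_pow (n : ℕ) (z : ZMod q) : (piq q gT) ^ n • pt z = pt (z + ((3 * n : ℕ) : ZMod q)) := by
  induction n with
  | zero => simp
  | succ n ih =>
    rw [pow_succ', mul_smul, ih, smul_T]
    congr 1
    push_cast
    ring

lemma smul_S (z : ZMod q) (hz : z ≠ 0) : piq q ModularGroup.S • pt z = pt (-z⁻¹) := by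
  rw [pt, Projectivization.smul_mk, pt, Projectivization.mk_eq_mk_iff']
  refine ⟨z, ?_⟩
  show _ = Matrix.mulVec (piq q ModularGroup.S).1 ![z, 1]
  funext a
  simp only [Matrix.mulVec, dotProduct, Fin.sum_univ_two, piq_entry]
  fin_cases a <;> simp [hz, ModularGroup.S]

/-- boundary of a union of intervals -/
lemma bdry (N n : ℕ) (Λ A : Finset (ZMod q)) (hA : A = (Finset.Icc 1 N).image (Nat.cast : ℕ → ZMod q) + Λ) :
    ((A.image (fun z => z + (n : ZMod q))) \ A).card ≤ n * Λ.card := by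
  have hsub : (A.image (fun z => z + (n : ZMod q))) \ A ⊆ (Finset.Icc (N + 1) (N + n)).image (Nat.cast : ℕ → ZMod q) + Λ := by
    intro w hw
    rw [Finset.mem_sdiff, Finset.mem_image] at hw
    obtain ⟨⟨z, hz, rfl⟩, hn⟩ := hw
    rw [hA, Finset.mem_add] at hz
    obtain ⟨y, hy, l, hl, rfl⟩ := hz
    rw [Finset.mem_image] at hy
    obtain ⟨k, hk, rfl⟩ := hy
    rw [Finset.mem_Icc] at hk
    have e : (k : ZMod q) + l + n = ((k + n : ℕ) : ZMod q) + l := by push_cast; ring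
    rw [e] at hn ⊢
    refine Finset.add_mem_add (Finset.mem_image_of_mem _ (Finset.mem_Icc.2 ⟨?_, by omega⟩)) hl
    by_contra hc
    apply hn
    rw [hA]
    exact Finset.add_mem_add (Finset.mem_image_of_mem _ (Finset.mem_Icc.2 ⟨by omega, by omega⟩)) hl
  refine (Finset.card_le_card hsub).trans (Finset.card_add_le.trans (Nat.mul_le_mul_right _ ?_))
  refine Finset.card_image_le.trans ?_
  rw [Nat.card_Icc]; omega

lemma bdry_neg (N n : ℕ) (Λ A : Finset (ZMod q)) (hA : A = (Finset.Icc 1 N).image (Nat.cast : ℕ → ZMod q) + Λ) :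
    (((-A).image (fun z => z + (n : ZMod q))) \ (-A)).card ≤ n * Λ.card := by
  refine le_trans ?_ (bdry N n Λ A hA)
  have hinj : Function.Injective (fun z : ZMod q => z + (n : ZMod q)) := add_left_injective _
  rw [← Finset.card_sdiff_comm (Finset.card_image_of_injective A hinj).symm]
  apply Finset.card_le_card_of_injOn (fun z => -z + (n : ZMod q))
  · intro z hz
    simp only [Finset.coe_sdiff, Set.mem_sdiff, Finset.mem_coe, Finset.mem_image, Finset.mem_neg'] at hz ⊢
    obtain ⟨⟨w, hw, rfl⟩, h2⟩ := hz
    refine ⟨by simpa using hw, ?_⟩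
    rintro ⟨v, hv, h⟩
    apply h2
    have : v = -(w + n) := by linear_combination h
    rw [← this]; exact hv
  · intro a _ b _ h
    simpa using h

lemma smul_image_T (n : ℕ) (A : Finset (ZMod q)) : (piq q gT) ^ n • A.image pt = (A.image (fun z => z + ((3 * n : ℕ) : ZMod q))).image pt := by
  rw [Finset.smul_finset_def, Finset.image_image, Finset.image_image]
  apply Finset.image_congr
  intro z _
  exact smul_T_pow n z

lemma var_ind (A : Finset (ZMod q)) (L M : ℕ) (h : ∀ n : ℕ, ((A.image (fun z => z + (n : ZMod q))) \ A).card ≤ n * L) (c : ℝ) (t : ℕ) (ht : t < M) :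
    ip (fun y => (ind (A.image pt) (((piq q gT) ^ t)⁻¹ • y) - c) - (ind (A.image pt) y - c))
      (fun y => (ind (A.image pt) (((piq q gT) ^ t)⁻¹ • y) - c) - (ind (A.image pt) y - c)) ≤ 6 * M * L := by
  simp only [sub_sub_sub_cancel_right, ind_smul, smul_image_T]
  have hinj : Function.Injective (fun z : ZMod q => z + ((3 * t : ℕ) : ZMod q)) := add_left_injective _
  rw [ip_ind_sub, ← Finset.image_sdiff _ _ pt_inj, Finset.card_image_of_injective _ pt_inj]
  · have h1 := h (3 * t)
    have h2 : 3 * t * L ≤ 3 * M * L := Nat.mul_le_mul_right _ (by omega)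
    have h3 : ((((A.image (fun z => z + ((3 * t : ℕ) : ZMod q))) \ A).card : ℕ) : ℝ) ≤ 3 * M * L := by exact_mod_cast h1.trans h2
    linarith
  · rw [Finset.card_image_of_injective _ pt_inj, Finset.card_image_of_injective _ pt_inj, Finset.card_image_of_injective _ hinj]

/-- core inequality -/
theorem core (N M i : ℕ) (hM : 0 < M) {δ ρ : ℝ} (hρ : 0 ≤ ρ)
    (hδ : ∑ x, law (PP M (piq q gT) (piq q gS) i) x ^ 2 ≤ δ) (hr : δ * (2 * (q:ℝ) ^ 2) ≤ (ρ ^ (2 ^ i)) ^ 2)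
    (Λ₁ Λ₂ A B : Finset (ZMod q)) (hA : A = (Finset.Icc 1 N).image (Nat.cast : ℕ → ZMod q) + Λ₁)
    (hB : B = (Finset.Icc 1 N).image (Nat.cast : ℕ → ZMod q) + Λ₂) (h0 : (0 : ZMod q) ∉ B) :
    |((A ∩ B.image (·⁻¹)).card : ℝ) - (A.card : ℝ) * B.card / (q + 1)| ≤
      √(B.card * (ρ * A.card)) + (√(6 * M * Λ₂.card * A.card) + √(B.card * (6 * M * Λ₁.card))) := by
  have hq0 : (0:ℝ) < q := by exact_mod_cast (Fact.out : q.Prime).pos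
  set t := piq q gT with ht
  set s := piq q ModularGroup.S with hs
  have hgs : piq q gS = s * t * s⁻¹ := by
    rw [gS, map_mul, map_mul, map_inv, hs, ht, gT]
  rw [hgs] at hδ
  set c : ℝ := A.card / (q + 1) with hc
  set f : PL q → ℝ := fun y => ind (A.image pt) y - c with hfdef
  set g : PL q → ℝ := fun y => ind ((-B).image pt) y with hgdef
  have cA : (A.image (pt (q := q))).card = A.card := Finset.card_image_of_injective _ pt_inj
  have cB : ((-B).image (pt (q := q))).card = B.card := by
    rw [Finset.card_image_of_injective _ pt_inj, Finset.card_neg]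
  have hf0 : ∑ y, f y = 0 := by
    simp only [hfdef, Finset.sum_sub_distrib, sum_ind, cA, Finset.sum_const, Finset.card_univ, card_PL, nsmul_eq_mul, hc]
    push_cast
    field_simp
    ring
  have hg1 : ∑ y, g y = B.card := by
    simp only [hgdef, sum_ind, cB]
  have hff : ip f f ≤ A.card := by
    have : ip f f = ip (ind (A.image pt)) (ind (A.image pt)) - c * ∑ y, ind (A.image pt) y - c * ∑ y, f y := by
      simp only [ip, hfdef, Finset.mul_sum, ← Finset.sum_sub_distrib]
      exact Finset.sum_congr rfl (fun y _ => by ring)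
    rw [this, hf0, ip_ind, sum_ind, Finset.inter_self, cA]
    have : 0 ≤ c * A.card := by positivity
    linarith
  have hgg : ip g g ≤ B.card := by
    have : ip g g = (((-B).image (pt (q := q))).card : ℝ) := by
      have := ip_ind ((-B).image (pt (q := q))) ((-B).image pt)
      rwa [Finset.inter_self] at this
    rw [this, cB]
  have hX : ip (ac (dl s) g) f = ((A ∩ B.image (·⁻¹)).card : ℝ) - (A.card : ℝ) * B.card / (q + 1) := by
    have e0 : s • (-B).image pt = (B.image (·⁻¹)).image (pt (q := q)) := by
      rw [Finset.smul_finset_def, Finset.image_image, Finset.image_image, ← Finset.image_neg_eq_neg, Finset.image_image]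
      apply Finset.image_congr
      intro z hz
      have hz0 : z ≠ 0 := by
        rintro rfl
        exact h0 hz
      simp only [Function.comp]
      rw [hs, smul_S _ (neg_ne_zero.2 hz0)]
      congr 1
      rw [inv_neg, neg_neg]
    have e1 : ac (dl s) g = ind ((B.image (·⁻¹)).image pt) := by
      funext y
      rw [← e0, ← ind_smul]
      simp only [ac, dl_apply, hgdef]
    have e2 : ip (ac (dl s) g) f = ip (ind ((B.image (·⁻¹)).image pt)) (ind (A.image pt)) - c * ∑ y, ac (dl s) g y := by
      rw [e1]
      simp only [ip, hfdef, Finset.mul_sum, ← Finset.sum_sub_distrib]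
      exact Finset.sum_congr rfl (fun y _ => by ring)
    have e3 : ∑ y, ac (dl s) g y = B.card := by
      rw [← hg1]
      simp only [ac, dl_apply]
      exact sum_smul g s⁻¹
    rw [e2, e3, ip_ind, ← Finset.image_inter _ _ pt_inj, Finset.card_image_of_injective _ pt_inj, Finset.inter_comm, hc]
    ring
  have hsm := smooth M hM t s f g hff hgg
    (fun u hu => var_ind A Λ₁.card M (fun n => bdry N n Λ₁ A hA) c u hu)
    (cg := 6 * M * Λ₂.card) (fun u hu => by
      have := var_ind (-B) Λ₂.card M (fun n => bdry_neg N n Λ₂ B hB) 0 u hu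
      simpa only [sub_zero] using this)
  have hsp := spectral M i t s hδ f hf0 hρ hr
  have h1 : |ip (ac (TT M t s) g) f| ≤ √(B.card * (ρ * A.card)) := by
    rw [Adj_TT (Y := PL q) M t s g f]
    exact ip_abs _ _ hgg (hsp.trans (mul_le_mul_of_nonneg_left hff hρ))
  rw [← hX]
  have e : ip (ac (dl s) g) f = ip (ac (TT M t s) g) f - (ip (ac (TT M t s) g) f - ip (ac (dl s) g) f) := by ring
  rw [e]
  exact (abs_sub _ _).trans (add_le_add h1 hsm)

end
end IUC
end

section
open Finset
open scoped Pointwise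
set_option maxHeartbeats 400000
set_option linter.unusedSectionVars false
namespace IUC

lemma exists_j (q b : ℕ) (hb : 2 ≤ b) (hq : b ^ 40 ≤ q) : ∃ j, 1 ≤ j ∧ b ^ (20 * 2 ^ j) ≤ q ∧ q < b ^ (40 * 2 ^ j) := by
  have hex : ∃ j, q < b ^ (40 * 2 ^ j) := by
    refine ⟨q, ?_⟩
    calc q < 2 ^ q := Nat.lt_two_pow_self
      _ ≤ b ^ q := Nat.pow_le_pow_left hb q
      _ ≤ b ^ (40 * 2 ^ q) := Nat.pow_le_pow_right (by omega) (by
        have : q < 2 ^ q := Nat.lt_two_pow_self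
        omega)
  classical
  refine ⟨Nat.find hex, ?_, ?_, Nat.find_spec hex⟩
  · by_contra h
    have h0 : Nat.find hex = 0 := by omega
    have := Nat.find_spec hex
    rw [h0, pow_zero, mul_one] at this
    omega
  · rcases h : Nat.find hex with _ | n
    · have := Nat.find_spec hex
      rw [h, pow_zero, mul_one] at this
      omega
    · have := Nat.find_min hex (m := n) (by omega)
      rw [not_lt] at this
      have e : 20 * 2 ^ (n + 1) = 40 * 2 ^ n := by rw [pow_succ]; ring
      rw [e]; exact this

lemma hc_aux (M n : ℕ) (hM : 50 ≤ M) (hn : 2 ≤ n) (x : ℝ) (hx : 0 < x) (hxn : x ^ 16 ≤ ((6 * M : ℕ) : ℝ) ^ n) :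
    2 * (4 / (M:ℝ)) ^ (n - 1) ≤ x⁻¹ := by
  have hM' : (50:ℝ) ≤ M := by exact_mod_cast hM
  have hM0 : (0:ℝ) < M := by linarith
  set w := 2 * (4 / (M:ℝ)) ^ (n - 1) with hw
  have hw0 : 0 ≤ w := by positivity
  have h41 : 4 / (M:ℝ) ≤ 1 := by rw [div_le_one hM0]; linarith
  have h1 : w ^ 16 ≤ (256 * (4 / (M:ℝ)) ^ 8) ^ n := by
    rw [hw, mul_pow, mul_pow, ← pow_mul, ← pow_mul]
    apply mul_le_mul _ _ (by positivity) (by positivity)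
    · calc (2:ℝ) ^ 16 = 256 ^ 2 := by norm_num
        _ ≤ 256 ^ n := pow_le_pow_right₀ (by norm_num) hn
    · exact pow_le_pow_of_le_one (by positivity) h41 (by omega)
  have h2 : (w * x) ^ 16 ≤ 1 := by
    rw [mul_pow]
    calc w ^ 16 * x ^ 16 ≤ (256 * (4 / (M:ℝ)) ^ 8) ^ n * ((6 * M : ℕ) : ℝ) ^ n := mul_le_mul h1 hxn (by positivity) (by positivity)
      _ = (256 * (4 / (M:ℝ)) ^ 8 * ((6 * M : ℕ) : ℝ)) ^ n := by rw [← mul_pow]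
      _ ≤ 1 := by
        apply pow_le_one₀ (by positivity)
        have : 256 * (4 / (M:ℝ)) ^ 8 * ((6 * M : ℕ) : ℝ) = 100663296 / (M:ℝ) ^ 7 := by
          push_cast
          field_simp
          norm_num
        rw [this, div_le_one (by positivity)]
        calc (100663296:ℝ) ≤ 50 ^ 7 := by norm_num
          _ ≤ (M:ℝ) ^ 7 := pow_le_pow_left₀ (by norm_num) hM' 7
  have h3 : w * x ≤ 1 := by
    by_contra hcon
    push Not at hcon
    have := one_lt_pow₀ hcon (n := 16) (by norm_num)
    linarith
  rw [← one_div, le_div_iff₀ hx]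
  exact h3

/-- choice of parameters -/
lemma params (L D k : ℕ) (hL : 400000 ≤ L) (hD : D = 640 * L) (hk : k = 2 * D + 3) (q : ℕ) [Fact q.Prime] (M : ℕ) (hM : 50 ≤ M)
    (hb : (6 * M) ^ 40 ≤ q) (h2 : 2 ^ D ≤ q) :
    ∃ (i : ℕ) (δ : ℝ), ∑ x, law (PP M (piq q gT) (piq q gS) i) x ^ 2 ≤ δ ∧
      δ * (2 * (q:ℝ) ^ 2) ≤ ((((6 * M : ℕ) : ℝ) ^ (-(20 / ((D:ℝ) * 2 ^ k)))) ^ (2 ^ i)) ^ 2 := by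
  obtain ⟨j, hj1, hj2, hj3⟩ := exists_j q (6 * M) (by omega) hb
  have hq0 : (0:ℝ) < q := by exact_mod_cast (Fact.out : q.Prime).pos
  have hD0 : D ≠ 0 := by omega
  have hDr : (0:ℝ) < D := by exact_mod_cast Nat.pos_of_ne_zero hD0
  set T : ℝ := (q:ℝ) ^ ((D:ℝ)⁻¹) with hT
  have hT0 : 0 < T := Real.rpow_pos_of_pos hq0 _
  have hTD : T ^ D = q := Real.rpow_inv_natCast_pow hq0.le hD0
  have hT2 : 2 ≤ T := by
    have : (2:ℝ) ^ D ≤ T ^ D := by rw [hTD]; exact_mod_cast h2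
    exact (pow_le_pow_iff_left₀ (by norm_num) hT0.le hD0).1 this
  have hn2 : 2 ≤ 2 ^ j := by
    calc 2 = 2 ^ 1 := by norm_num
      _ ≤ 2 ^ j := Nat.pow_le_pow_right (by norm_num) hj1
  have hx : (T ^ L) ^ 16 ≤ ((6 * M : ℕ) : ℝ) ^ (2 ^ j) := by
    have : ((T ^ L) ^ 16) ^ 40 ≤ (((6 * M : ℕ) : ℝ) ^ (2 ^ j)) ^ 40 := by
      rw [← pow_mul, ← pow_mul, ← pow_mul, show L * (16 * 40) = D by omega, hTD, mul_comm (2 ^ j) 40]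
      exact_mod_cast hj3.le
    exact (pow_le_pow_iff_left₀ (by positivity) (by positivity) (by norm_num)).1 this
  have hc := hc_aux M (2 ^ j) hM hn2 (T ^ L) (by positivity) hx
  have hq5 : 5 ≤ q := by
    refine le_trans ?_ hb
    calc 5 ≤ 6 * M := by omega
      _ ≤ (6 * M) ^ 40 := Nat.le_self_pow (by norm_num) _
  have hfl := PP_flat (q := q) hT2 (D := D) (L := L) (e := 3) hL (by omega) hTD.symm hq5 M hM j hj2 hc
  refine ⟨j + (2 * D + 3), (T ^ (2 * D + 3))⁻¹, hfl, ?_⟩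
  have hbr : (0:ℝ) < ((6 * M : ℕ) : ℝ) := by
    have : 0 < 6 * M := by omega
    exact_mod_cast this
  have hpow : (((6 * M : ℕ) : ℝ) ^ (-(20 / ((D:ℝ) * 2 ^ k)))) ^ (2 ^ (j + (2 * D + 3))) = ((((6 * M : ℕ) : ℝ) ^ (20 * 2 ^ j)) ^ ((D:ℝ)⁻¹))⁻¹ := by
    rw [← hk, ← Real.rpow_natCast (_ ^ (-(20 / ((D:ℝ) * 2 ^ k)))), ← Real.rpow_natCast _ (20 * 2 ^ j), ← Real.rpow_mul hbr.le, ← Real.rpow_mul hbr.le, ← Real.rpow_neg hbr.le]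
    congr 1
    have : (2:ℝ) ^ k ≠ 0 := by positivity
    push_cast
    rw [pow_add]
    field_simp
  rw [hpow]
  have hge : T⁻¹ ≤ ((((6 * M : ℕ) : ℝ) ^ (20 * 2 ^ j)) ^ ((D:ℝ)⁻¹))⁻¹ := by
    apply inv_anti₀ (by positivity)
    apply Real.rpow_le_rpow (by positivity) _ (by positivity)
    exact_mod_cast hj2
  refine le_trans ?_ (pow_le_pow_left₀ (by positivity) hge 2)
  rw [← hTD]
  have e : (T ^ (2 * D + 3))⁻¹ * (2 * (T ^ D) ^ 2) = 2 * (T⁻¹) ^ 3 := by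
    have : T ^ (2 * D + 3) = (T ^ D) ^ 2 * T ^ 3 := by rw [pow_add, ← pow_mul, mul_comm D 2]
    rw [this]
    have h1 : T ^ D ≠ 0 := by positivity
    generalize T ^ D = U at *
    field_simp
  rw [e, pow_succ]
  have h1 : T⁻¹ ≤ 2⁻¹ := inv_anti₀ (by norm_num) hT2
  have h3 : 0 ≤ T⁻¹ ^ 2 := by positivity
  nlinarith

lemma trivial_bd (q : ℕ) [Fact q.Prime] (A B : Finset (ZMod q)) :
    |((A ∩ B.image (·⁻¹)).card : ℝ) - (A.card : ℝ) * B.card / q| ≤ √((A.card : ℝ) * B.card) ∧ √((A.card : ℝ) * B.card) ≤ q := by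
  have hq0 : (0:ℝ) < q := by exact_mod_cast (Fact.out : q.Prime).pos
  have hA : (A.card : ℝ) ≤ q := by
    have := Finset.card_le_univ A
    rw [ZMod.card] at this
    exact_mod_cast this
  have hB : (B.card : ℝ) ≤ q := by
    have := Finset.card_le_univ B
    rw [ZMod.card] at this
    exact_mod_cast this
  have hA0 : (0:ℝ) ≤ A.card := by positivity
  have hB0 : (0:ℝ) ≤ B.card := by positivity
  have h1 : ((A ∩ B.image (·⁻¹)).card : ℝ) ≤ √((A.card : ℝ) * B.card) := by
    apply Real.le_sqrt_of_sq_le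
    have a1 : ((A ∩ B.image (·⁻¹)).card : ℝ) ≤ A.card := by exact_mod_cast Finset.card_le_card Finset.inter_subset_left
    have a2 : ((A ∩ B.image (·⁻¹)).card : ℝ) ≤ B.card := by
      exact_mod_cast (Finset.card_le_card Finset.inter_subset_right).trans Finset.card_image_le
    rw [sq]
    exact mul_le_mul a1 a2 (by positivity) hA0
  have h2 : √((A.card : ℝ) * B.card) ≤ q := by
    rw [Real.sqrt_le_left hq0.le, sq]
    exact mul_le_mul hA hB hB0 hq0.le
  have h3 : (A.card : ℝ) * B.card / q ≤ √((A.card : ℝ) * B.card) := by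
    rw [div_le_iff₀ hq0]
    calc (A.card : ℝ) * B.card = √((A.card : ℝ) * B.card) * √((A.card : ℝ) * B.card) := (Real.mul_self_sqrt (by positivity)).symm
      _ ≤ _ := mul_le_mul_of_nonneg_left h2 (by positivity)
  refine ⟨?_, h2⟩
  have h4 : 0 ≤ (A.card : ℝ) * B.card / q := by positivity
  have h5 : (0:ℝ) ≤ ((A ∩ B.image (·⁻¹)).card : ℝ) := by positivity
  rw [abs_le]
  constructor <;> linarith

lemma exists_M (N : ℕ) (hN : 300 ^ 40 ≤ N) : ∃ M : ℕ, 50 ≤ M ∧ (6 * M) ^ 40 ≤ N ∧ (N:ℝ) ^ ((40:ℝ)⁻¹) ≤ 4 * ((6 * M : ℕ) : ℝ) := by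
  have hN0 : (0:ℝ) ≤ (N:ℝ) := by positivity
  set x : ℝ := (N:ℝ) ^ ((40:ℝ)⁻¹) with hx
  have hx0 : 0 ≤ x := by positivity
  have hx40 : x ^ 40 = N := by
    have := Real.rpow_inv_natCast_pow hN0 (n := 40) (by norm_num)
    push_cast at this
    exact this
  have hx300 : 300 ≤ x := by
    have : (300:ℝ) ^ 40 ≤ x ^ 40 := by rw [hx40]; exact_mod_cast hN
    exact (pow_le_pow_iff_left₀ (by norm_num) hx0 (by norm_num)).1 this
  set m := ⌊x⌋₊ with hm
  have hm1 : 300 ≤ m := Nat.le_floor (by exact_mod_cast hx300)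
  have hm2 : (m:ℝ) ≤ x := Nat.floor_le hx0
  have hm3 : x < m + 1 := Nat.lt_floor_add_one x
  refine ⟨m / 6, by omega, ?_, ?_⟩
  · have h1 : (6 * (m / 6)) ^ 40 ≤ m ^ 40 := Nat.pow_le_pow_left (by omega) 40
    have h2 : ((m ^ 40 : ℕ) : ℝ) ≤ N := by
      rw [← hx40]; push_cast
      exact pow_le_pow_left₀ (by positivity) hm2 40
    exact h1.trans (by exact_mod_cast h2)
  · have h1 : m + 1 ≤ 4 * (6 * (m / 6)) := by omega
    have h2 : ((m + 1 : ℕ) : ℝ) ≤ ((4 * (6 * (m / 6)) : ℕ) : ℝ) := by exact_mod_cast h1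
    push_cast at h2 ⊢
    linarith

lemma final (L D k : ℕ) (hL : 400000 ≤ L) (hD : D = 640 * L) (hk : k = 2 * D + 3) :
    ∃ κ C : ℝ, 0 < κ ∧ 0 < C ∧
      ∀ q N : ℕ, q.Prime → 0 < N → ∀ Λ₁ Λ₂ A B : Finset (ZMod q),
        A = (Finset.Icc 1 N).image (Nat.cast : ℕ → ZMod q) + Λ₁ →
        A.card = N * Λ₁.card →
        B = (Finset.Icc 1 N).image (Nat.cast : ℕ → ZMod q) + Λ₂ →
        B.card = N * Λ₂.card →
        (0 : ZMod q) ∉ B →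
        abs (((A ∩ B.image (·⁻¹)).card : ℝ) - (A.card : ℝ) * B.card / q) ≤
          C * Real.sqrt ((A.card : ℝ) * B.card) * (N : ℝ) ^ (-κ) := by
  have hDr : (1:ℝ) ≤ D := by
    have : 1 ≤ D := by omega
    exact_mod_cast this
  have hD20 : (20:ℝ) ≤ D := by
    have : 20 ≤ D := by omega
    exact_mod_cast this
  set η : ℝ := 20 / ((D:ℝ) * 2 ^ k) with hη
  have hη0 : 0 < η := by positivity
  have hη1 : η ≤ 1 := by
    rw [hη, div_le_one (by positivity)]
    have : (1:ℝ) ≤ 2 ^ k := one_le_pow₀ (by norm_num)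
    nlinarith
  refine ⟨η / 80, 5 + 2 ^ D, by positivity, by positivity, ?_⟩
  intro q N hq hN Λ₁ Λ₂ A B hA hAc hB hBc h0
  haveI : Fact q.Prime := ⟨hq⟩
  have hq0 : (0:ℝ) < q := by exact_mod_cast hq.pos
  have hN1 : (1:ℝ) ≤ N := by exact_mod_cast hN
  have hNp : (0:ℝ) < N := by linarith
  obtain ⟨htr, hSq⟩ := trivial_bd q A B
  set S := √((A.card : ℝ) * B.card) with hS
  have hS0 : 0 ≤ S := Real.sqrt_nonneg _
  have hSS : S * S = (A.card : ℝ) * B.card := Real.mul_self_sqrt (by positivity)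
  set Nk := (N:ℝ) ^ (-(η / 80)) with hNk
  have hNk0 : 0 < Nk := Real.rpow_pos_of_pos hNp _
  have h2D : (0:ℝ) < 2 ^ D := by positivity
  by_cases hsmall : N < 2 ^ D
  · refine htr.trans ?_
    have h1 : 1 ≤ 2 ^ D * Nk := by
      have e1 : (N:ℝ) ≤ 2 ^ D := by exact_mod_cast hsmall.le
      have e2 : (N:ℝ)⁻¹ ≤ Nk := by
        rw [← Real.rpow_neg_one]
        exact Real.rpow_le_rpow_of_exponent_le hN1 (by linarith)
      calc (1:ℝ) = N * (N:ℝ)⁻¹ := (mul_inv_cancel₀ hNp.ne').symm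
        _ ≤ 2 ^ D * Nk := mul_le_mul e1 e2 (by positivity) (by positivity)
    calc S = S * 1 := (mul_one _).symm
      _ ≤ S * ((5 + 2 ^ D) * Nk) := mul_le_mul_of_nonneg_left (by linarith) hS0
      _ = _ := by ring
  push Not at hsmall
  by_cases hS1 : S = 0
  · rw [hS1] at htr ⊢
    simpa using htr
  have hΛ : Λ₁.card ≠ 0 := by
    intro h
    apply hS1
    rw [hS, hAc, h]
    simp
  have hNq : N ≤ q := by
    have h1 := Finset.card_le_univ A
    rw [ZMod.card, hAc] at h1
    exact (Nat.le_mul_of_pos_right N (Nat.pos_of_ne_zero hΛ)).trans h1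
  have h300 : 300 ^ 40 ≤ N := by
    calc 300 ^ 40 ≤ (2 ^ 9) ^ 40 := Nat.pow_le_pow_left (by norm_num) 40
      _ = 2 ^ (9 * 40) := (pow_mul 2 9 40).symm
      _ ≤ 2 ^ D := Nat.pow_le_pow_right (by norm_num) (by omega)
      _ ≤ N := hsmall
  obtain ⟨M, hM, hb, hbN⟩ := exists_M N h300
  obtain ⟨i, δ, hδ, hr⟩ := params L D k hL hD hk q M hM (hb.trans hNq) (hsmall.trans hNq)
  rw [← hη] at hr
  set ρ : ℝ := ((6 * M : ℕ) : ℝ) ^ (-η) with hρ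
  have hρ0 : 0 ≤ ρ := by positivity
  have hcore := core N M i (by omega) hρ0 hδ hr Λ₁ Λ₂ A B hA hB h0
  -- bound on the gain
  have hbp : (0:ℝ) < ((6 * M : ℕ) : ℝ) := by
    have : 0 < 6 * M := by omega
    exact_mod_cast this
  have hρ1 : ρ ≤ (2 * Nk) ^ 2 := by
    have e1 : ρ ≤ ((N:ℝ) ^ ((40:ℝ)⁻¹) / 4) ^ (-η) := by
      apply Real.rpow_le_rpow_of_nonpos (by positivity) (by linarith) (by linarith)
    have e2 : ((N:ℝ) ^ ((40:ℝ)⁻¹) / 4) ^ (-η) = Nk ^ 2 * 4 ^ η := by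
      rw [Real.div_rpow (by positivity) (by norm_num), ← Real.rpow_mul hNp.le, Real.rpow_neg (by norm_num) η, div_inv_eq_mul, hNk,
        ← Real.rpow_natCast, ← Real.rpow_mul hNp.le]
      congr 2
      push_cast
      ring
    have e3 : (4:ℝ) ^ η ≤ 4 := by
      calc (4:ℝ) ^ η ≤ 4 ^ (1:ℝ) := Real.rpow_le_rpow_of_exponent_le (by norm_num) hη1
        _ = 4 := Real.rpow_one 4
    rw [e2] at e1
    calc ρ ≤ _ := e1
      _ ≤ Nk ^ 2 * 4 := mul_le_mul_of_nonneg_left e3 (by positivity)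
      _ = _ := by ring
  have hA0 : (0:ℝ) ≤ A.card := by positivity
  have hB0 : (0:ℝ) ≤ B.card := by positivity
  have t1 : √(B.card * (ρ * A.card)) ≤ 2 * Nk * S := by
    rw [Real.sqrt_le_left (by positivity)]
    calc (B.card : ℝ) * (ρ * A.card) = ρ * (S * S) := by rw [hSS]; ring
      _ ≤ (2 * Nk) ^ 2 * (S * S) := mul_le_mul_of_nonneg_right hρ1 (by positivity)
      _ = _ := by ring
  -- smoothing error
  have hMN : 6 * (M:ℝ) ≤ N * Nk ^ 2 := by
    have e1 : (6 * (M:ℝ)) ^ 2 ≤ N := by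
      have : (6 * M) ^ 2 ≤ N := (Nat.pow_le_pow_right (by omega) (by norm_num)).trans hb
      exact_mod_cast this
    have e2 : 6 * (M:ℝ) ≤ √(N:ℝ) := Real.le_sqrt_of_sq_le e1
    refine e2.trans ?_
    rw [Real.sqrt_eq_rpow, hNk, ← Real.rpow_natCast, ← Real.rpow_mul hNp.le]
    nth_rewrite 2 [← Real.rpow_one (N:ℝ)]
    rw [← Real.rpow_add hNp]
    apply Real.rpow_le_rpow_of_exponent_le hN1
    push_cast
    linarith
  have hAc' : (A.card : ℝ) = N * Λ₁.card := by exact_mod_cast hAc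
  have hBc' : (B.card : ℝ) = N * Λ₂.card := by exact_mod_cast hBc
  have t2 : √(6 * M * Λ₂.card * A.card) ≤ Nk * S := by
    rw [Real.sqrt_le_left (by positivity)]
    calc (6 * M * Λ₂.card * A.card : ℝ) = (6 * M) * (Λ₂.card * A.card) := by ring
      _ ≤ (N * Nk ^ 2) * (Λ₂.card * A.card) := mul_le_mul_of_nonneg_right hMN (by positivity)
      _ = Nk ^ 2 * (A.card * B.card) := by rw [hBc']; ring
      _ = _ := by rw [← hSS]; ring
  have t3 : √(B.card * (6 * M * Λ₁.card)) ≤ Nk * S := by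
    rw [Real.sqrt_le_left (by positivity)]
    calc (B.card * (6 * M * Λ₁.card) : ℝ) = (6 * M) * (Λ₁.card * B.card) := by ring
      _ ≤ (N * Nk ^ 2) * (Λ₁.card * B.card) := mul_le_mul_of_nonneg_right hMN (by positivity)
      _ = Nk ^ 2 * (A.card * B.card) := by rw [hAc']; ring
      _ = _ := by rw [← hSS]; ring
  -- main term
  have t4 : |(A.card : ℝ) * B.card / (q + 1) - (A.card : ℝ) * B.card / q| ≤ Nk * S := by
    have e : (A.card : ℝ) * B.card / (q + 1) - (A.card : ℝ) * B.card / q = -(S * S / (q * (q + 1))) := by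
      rw [hSS]; field_simp; ring
    rw [e, abs_neg, abs_of_nonneg (by positivity)]
    have e2 : (N:ℝ)⁻¹ ≤ Nk := by
      rw [← Real.rpow_neg_one]
      exact Real.rpow_le_rpow_of_exponent_le hN1 (by linarith)
    have e3 : (q:ℝ)⁻¹ ≤ (N:ℝ)⁻¹ := inv_anti₀ hNp (by exact_mod_cast hNq)
    calc S * S / (q * (q + 1)) ≤ q * S / (q * q) := by
          apply div_le_div₀ (by positivity) (mul_le_mul_of_nonneg_right hSq hS0) (by positivity)
          exact mul_le_mul_of_nonneg_left (by linarith) hq0.le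
      _ = (q:ℝ)⁻¹ * S := by field_simp
      _ ≤ Nk * S := mul_le_mul_of_nonneg_right (e3.trans e2) hS0
  have hfin := abs_sub_le ((A ∩ B.image (·⁻¹)).card : ℝ) ((A.card : ℝ) * B.card / (q + 1)) ((A.card : ℝ) * B.card / q)
  refine hfin.trans ?_
  have hpos : 0 ≤ 2 ^ D * (S * Nk) := by positivity
  calc _ ≤ 2 * Nk * S + (Nk * S + Nk * S) + Nk * S := by linarith
    _ = 5 * (S * Nk) := by ring
    _ ≤ 5 * (S * Nk) + 2 ^ D * (S * Nk) := by linarith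
    _ = _ := by ring

end IUC
end


open Pointwise

/-- Asymptotic formula for `|A ∩ B⁻¹|` where `A = I ∔ Λ₁`, `B = I ∔ Λ₂` are
unions of shifted copies of the interval `I = {1,…,N}` in `ℤ/qℤ`. -/
theorem interval_union_inverse_count :
    ∃ κ C : ℝ, 0 < κ ∧ 0 < C ∧
      ∀ q N : ℕ, q.Prime → 0 < N → ∀ Λ₁ Λ₂ A B : Finset (ZMod q),
        A = (Finset.Icc 1 N).image (Nat.cast : ℕ → ZMod q) + Λ₁ →
        A.card = N * Λ₁.card →
        B = (Finset.Icc 1 N).image (Nat.cast : ℕ → ZMod q) + Λ₂ →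
        B.card = N * Λ₂.card →
        (0 : ZMod q) ∉ B →
        abs (((A ∩ B.image (·⁻¹)).card : ℝ) - (A.card : ℝ) * B.card / q) ≤
          C * Real.sqrt ((A.card : ℝ) * B.card) * (N : ℝ) ^ (-κ) := by
  exact IUC.final 400000 (640 * 400000) (2 * (640 * 400000) + 3) le_rfl rfl rfl
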